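/- arXiv:math/0209062 — 5 statements merged into one kernel-verified Lean document; each statement's English description precedes it below -/
import Mathlib

section
/- For every integer n ≥ 3 and every set C of n−1 distinct real numbers, the number of equivalence classes of real polynomials f of degree n whose set of critical values C(f) equals C is equal to K_{n−1}, the number of up-down permutations of {1,…,n−1}. -/
/-- A permutation of `{1,…,m}` (encoded as `Fin m`, 0-indexed) is up-down if
`σ(i) < σ(i+1)` for odd 1-based positions `i` and `σ(i) > σ(i+1)` for even ones. -/
def IsUpDown {m : ℕ} (σ : Equiv.Perm (Fin m)) : Prop :=
  ∀ i : ℕ, ∀ h : i + 1 < m,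
    if i % 2 = 0 then σ ⟨i, by omega⟩ < σ ⟨i + 1, h⟩ else σ ⟨i + 1, h⟩ < σ ⟨i, by omega⟩

/-- `K m` is the number of up-down permutations of `{1,…,m}` (Euler–Bernoulli numbers). -/
noncomputable def eulerBernoulli (m : ℕ) : ℕ :=
  Nat.card {σ : Equiv.Perm (Fin m) // IsUpDown σ}

/-- The set of (complex) critical values of a real polynomial `f`:
`C(f) = {f(z) : z ∈ ℂ, f′(z) = 0}`. -/
def realCritVals (f : Polynomial ℝ) : Set ℂ :=
  {w | ∃ z : ℂ, Polynomial.aeval z (Polynomial.derivative f) = 0 ∧ Polynomial.aeval z f = w}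

/-- Two real polynomials are equivalent if `f(X) = g(aX + b)` for some real `a ≠ 0`, `b`. -/
def RealPolyEquiv (f g : Polynomial ℝ) : Prop :=
  ∃ a b : ℝ, a ≠ 0 ∧ f = g.comp (Polynomial.C a * Polynomial.X + Polynomial.C b)

open Filter Topology Polynomial

/-- A proper `C¹` map of a finite-dimensional real space to itself with everywhere injective
derivative is a bijection. -/
theorem bijective_of_injective_fderiv_of_tendsto_cocompact {E : Type*} [NormedAddCommGroup E]
    [NormedSpace ℝ E] [FiniteDimensional ℝ E] {f : E → E} (hf : ContDiff ℝ 1 f)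
    (hinj : ∀ x, Function.Injective (fderiv ℝ f x))
    (hprop : Tendsto f (cocompact E) (cocompact E)) : Function.Bijective f := by
  have hloc : IsLocalHomeomorph f := by
    refine IsLocalHomeomorph.mk f fun x ↦ ?_
    let L : E ≃L[ℝ] E :=
      (LinearEquiv.ofInjectiveEndo (fderiv ℝ f x : E →ₗ[ℝ] E) (hinj x)).toContinuousLinearEquiv
    have hL : HasFDerivAt f (L : E →L[ℝ] E) x := by
      have : (L : E →L[ℝ] E) = fderiv ℝ f x := by ext v; rfl
      rw [this]
      exact (hf.differentiable one_ne_zero x).hasFDerivAt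
    exact ⟨hf.contDiffAt.toOpenPartialHomeomorph f hL one_ne_zero,
      hf.contDiffAt.mem_toOpenPartialHomeomorph_source hL one_ne_zero, fun _ _ ↦ rfl⟩
  have hproper : IsProperMap f :=
    isProperMap_iff_tendsto_cocompact.2 ⟨hf.continuous, hprop⟩
  have hcov : IsCoveringMap f := by
    rw [isCoveringMap_iff_isCoveringMapOn_univ]
    refine hproper.isClosedMap.isCoveringMapOn_of_isLocalHomeomorphOn (fun y _ ↦ ?_)
      fun x _ ↦ hloc x
    refine (hproper.isCompact_preimage isCompact_singleton).finite ?_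
    exact .of_openPartialHomeomorph f subset_rfl fun x _ ↦ by
      obtain ⟨φ, hφ, rfl⟩ := hloc x
      exact ⟨φ, hφ, rfl⟩
  have hsec : ∀ a : E, ∃ s : C(E, E), s (f a) = a ∧ ∀ y, f (s y) = y := fun a ↦ by
    obtain ⟨s, ⟨hs, hfs⟩, -⟩ := hcov.existsUnique_continuousMap_lifts (.id E) (f a) a rfl
    exact ⟨s, hs, fun y ↦ congrFun hfs y⟩
  refine ⟨fun a b hab ↦ ?_, fun y ↦ ?_⟩
  · obtain ⟨s, hs, hfs⟩ := hsec a
    have : s ∘ f = id := hcov.eq_of_comp_eq (s.continuous.comp hf.continuous) continuous_id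
      (funext fun x ↦ hfs (f x)) a hs
    calc a = s (f a) := hs.symm
      _ = s (f b) := by rw [hab]
      _ = b := congrFun this b
  · obtain ⟨s, -, hfs⟩ := hsec 0
    exact ⟨s y, hfs y⟩

/-- The antiderivative of a polynomial that vanishes at `0`. -/
noncomputable def Polynomial.primitive (p : ℝ[X]) : ℝ[X] :=
  p.sum fun n a ↦ monomial (n + 1) (a / (n + 1))

theorem Polynomial.derivative_primitive (p : ℝ[X]) : derivative p.primitive = p := by
  conv_rhs => rw [← p.sum_monomial_eq]
  simp only [primitive, Polynomial.sum, derivative_sum]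
  refine Finset.sum_congr rfl fun n _ ↦ ?_
  rw [derivative_monomial, Nat.add_sub_cancel]
  congr 1
  push_cast
  field_simp

theorem Polynomial.eval_primitive {p : ℝ[X]} {N : ℕ} (hp : p.natDegree < N) (t : ℝ) :
    p.primitive.eval t = ∑ n ∈ Finset.range N, p.coeff n / (n + 1) * t ^ (n + 1) := by
  rw [primitive, p.sum_over_range' (by simp) N hp, eval_finsetSum]
  simp [eval_monomial]

theorem Polynomial.hasDerivAt_primitive (p : ℝ[X]) (t : ℝ) :
    HasDerivAt (fun t ↦ p.primitive.eval t) (p.eval t) t := by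
  simpa [derivative_primitive] using p.primitive.hasDerivAt t

/-- The monic polynomial with roots `x i`. -/
noncomputable def nodePoly {ι : Type*} [Fintype ι] (x : ι → ℝ) : ℝ[X] := ∏ j, (X - C (x j))

theorem eval_nodePoly {ι : Type*} [Fintype ι] (x : ι → ℝ) (t : ℝ) :
    (nodePoly x).eval t = ∏ j, (t - x j) := by
  simp [nodePoly, eval_prod]

theorem natDegree_nodePoly {ι : Type*} [Fintype ι] (x : ι → ℝ) :
    (nodePoly x).natDegree = Fintype.card ι := by
  simp [nodePoly, natDegree_prod_of_monic _ _ fun j _ ↦ monic_X_sub_C (x j)]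

/-- The increment of a primitive of `nodePoly x` between two consecutive nodes. -/
noncomputable def gapIntegral {k : ℕ} (x : Fin (k + 1) → ℝ) (i : Fin k) : ℝ :=
  (nodePoly x).primitive.eval (x i.succ) - (nodePoly x).primitive.eval (x i.castSucc)

theorem neg_one_pow_mul_eval_nodePoly {k : ℕ} {x : Fin (k + 1) → ℝ} (hx : StrictMono x)
    (i : Fin k) {t : ℝ} (ht : t ∈ Set.Ioo (x i.castSucc) (x i.succ)) :
    (-1) ^ (k + i : ℕ) * (nodePoly x).eval t = ∏ j, |t - x j| := by
  have h : ∀ j, t - x j = (if i.castSucc < j then -1 else 1) * |t - x j| := fun j ↦ by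
    split_ifs with hj
    · have : x i.succ ≤ x j := hx.monotone (Fin.castSucc_lt_iff_succ_le.1 hj)
      rw [abs_of_neg (by linarith [ht.2])]
      ring
    · have : x j ≤ x i.castSucc := hx.monotone (not_lt.1 hj)
      rw [abs_of_pos (by linarith [ht.1]), one_mul]
  rw [eval_nodePoly, Finset.prod_congr rfl fun j _ ↦ h j, Finset.prod_mul_distrib,
    Finset.prod_ite, Finset.prod_const_one, mul_one, Finset.prod_const, ← mul_assoc, ← pow_add]
  have hcard : (Finset.univ.filter fun j ↦ i.castSucc < j).card = k - i := by
    calc _ = (Finset.Ioi i.castSucc).card := by congr 1; ext j; simp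
      _ = k - i := by simp
  rw [hcard, show k + i + (k - i) = 2 * k by omega, pow_mul]
  simp

theorem prod_abs_sub_pos {k : ℕ} {x : Fin (k + 1) → ℝ} (hx : StrictMono x) (i : Fin k) {t : ℝ}
    (ht : t ∈ Set.Ioo (x i.castSucc) (x i.succ)) : 0 < ∏ j, |t - x j| := by
  refine Finset.prod_pos fun j _ ↦ abs_pos.2 (sub_ne_zero.2 ?_)
  rintro rfl
  have h1 := hx.lt_iff_lt.1 ht.1
  have h2 := hx.lt_iff_lt.1 ht.2
  exact absurd (Fin.castSucc_lt_iff_succ_le.1 h1) (not_le.2 h2)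

theorem strictMonoOn_primitive_nodePoly {k : ℕ} {x : Fin (k + 1) → ℝ} (hx : StrictMono x)
    (i : Fin k) :
    StrictMonoOn (fun t ↦ (-1) ^ (k + i : ℕ) * (nodePoly x).primitive.eval t)
      (Set.Icc (x i.castSucc) (x i.succ)) := by
  refine strictMonoOn_of_deriv_pos (convex_Icc _ _) (by fun_prop) fun t ht ↦ ?_
  rw [interior_Icc] at ht
  rw [(((nodePoly x).hasDerivAt_primitive t).const_mul _).deriv,
    neg_one_pow_mul_eval_nodePoly hx i ht]
  exact prod_abs_sub_pos hx i ht

theorem neg_one_pow_mul_gapIntegral_pos {k : ℕ} {x : Fin (k + 1) → ℝ} (hx : StrictMono x)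
    (i : Fin k) : 0 < (-1) ^ (k + i : ℕ) * gapIntegral x i := by
  have hlt : x i.castSucc < x i.succ := hx i.castSucc_lt_succ
  have := strictMonoOn_primitive_nodePoly hx i (Set.left_mem_Icc.2 hlt.le)
    (Set.right_mem_Icc.2 hlt.le) hlt
  rw [gapIntegral, mul_sub]
  linarith

theorem abs_gapIntegral {k : ℕ} {x : Fin (k + 1) → ℝ} (hx : StrictMono x)
    (i : Fin k) : |gapIntegral x i| = (-1) ^ (k + i : ℕ) * gapIntegral x i := by
  rw [← abs_of_pos (neg_one_pow_mul_gapIntegral_pos hx i), abs_mul]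
  simp

theorem gapIntegral_ne_zero {k : ℕ} {x : Fin (k + 1) → ℝ} (hx : StrictMono x) (i : Fin k) :
    gapIntegral x i ≠ 0 :=
  right_ne_zero_of_mul (neg_one_pow_mul_gapIntegral_pos hx i).ne'

theorem pow_le_abs_gapIntegral {k : ℕ} {x : Fin (k + 1) → ℝ} (hx : StrictMono x) (i : Fin k) :
    ((x i.succ - x i.castSucc) / 3) ^ (k + 2) ≤ |gapIntegral x i| := by
  have hlt : x i.castSucc < x i.succ := hx i.castSucc_lt_succ
  obtain ⟨d, hd⟩ : ∃ d, d = (x i.succ - x i.castSucc) / 3 := ⟨_, rfl⟩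
  have hd0 : 0 < d := by rw [hd]; linarith
  have hmono := (strictMonoOn_primitive_nodePoly hx i).monotoneOn
  have h1 := hmono (Set.left_mem_Icc.2 hlt.le)
    (show x i.castSucc + d ∈ Set.Icc _ _ by constructor <;> linarith) (by linarith)
  have h2 := hmono (show x i.succ - d ∈ Set.Icc _ _ by constructor <;> linarith)
    (Set.right_mem_Icc.2 hlt.le) (by linarith)
  obtain ⟨ξ, hξ, hslope⟩ := exists_hasDerivAt_eq_slope
    (fun t ↦ (-1) ^ (k + i : ℕ) * (nodePoly x).primitive.eval t) _
    (show x i.castSucc + d < x i.succ - d by linarith) (by fun_prop)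
    (fun t _ ↦ ((nodePoly x).hasDerivAt_primitive t).const_mul _)
  rw [neg_one_pow_mul_eval_nodePoly hx i ⟨by linarith [hξ.1], by linarith [hξ.2]⟩,
    eq_div_iff (by linarith)] at hslope
  have hprod : d ^ (k + 1) ≤ ∏ j, |ξ - x j| := by
    calc d ^ (k + 1) = ∏ _j : Fin (k + 1), d := by simp
      _ ≤ _ := Finset.prod_le_prod (fun _ _ ↦ hd0.le) fun j _ ↦ by
        rcases lt_or_ge i.castSucc j with hj | hj
        · have : x i.succ ≤ x j := hx.monotone (Fin.castSucc_lt_iff_succ_le.1 hj)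
          rw [abs_sub_comm]
          exact le_trans (by linarith [hξ.2]) (le_abs_self _)
        · have : x j ≤ x i.castSucc := hx.monotone hj
          exact le_trans (by linarith [hξ.1]) (le_abs_self _)
  have hlen : x i.succ - d - (x i.castSucc + d) = d := by linarith
  rw [hlen] at hslope
  rw [← hd, abs_gapIntegral hx, gapIntegral, mul_sub, pow_succ d]
  have := mul_le_mul_of_nonneg_right hprod hd0.le
  simp only at h1 h2
  linarith

theorem abs_gapIntegral_le {k : ℕ} {x : Fin (k + 1) → ℝ} (hx : StrictMono x) (i : Fin k) {L : ℝ}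
    (hL : ∀ a b, x a - x b ≤ L) :
    |gapIntegral x i| ≤ (x i.succ - x i.castSucc) * L ^ (k + 1) := by
  have hlt : x i.castSucc < x i.succ := hx i.castSucc_lt_succ
  obtain ⟨ξ, hξ, hslope⟩ := exists_hasDerivAt_eq_slope
    (fun t ↦ (-1) ^ (k + i : ℕ) * (nodePoly x).primitive.eval t) _ hlt (by fun_prop)
    (fun t _ ↦ ((nodePoly x).hasDerivAt_primitive t).const_mul _)
  rw [neg_one_pow_mul_eval_nodePoly hx i hξ, eq_div_iff (by linarith)] at hslope
  have hprod : ∏ j, |ξ - x j| ≤ L ^ (k + 1) := by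
    calc ∏ j, |ξ - x j| ≤ ∏ _j : Fin (k + 1), L :=
        Finset.prod_le_prod (fun _ _ ↦ abs_nonneg _) fun j _ ↦ by
          have h1 := hL i.succ j
          have h2 := hL j i.castSucc
          rw [abs_le]
          constructor <;> linarith [hξ.1, hξ.2]
      _ = _ := by simp
  rw [abs_gapIntegral hx, gapIntegral, mul_sub, ← hslope, mul_comm]
  exact mul_le_mul_of_nonneg_left hprod (by linarith)

theorem contDiff_coeff_prod {E ι : Type*} [NormedAddCommGroup E] [NormedSpace ℝ E]
    (s : Finset ι) {p : ι → E → ℝ[X]} (hp : ∀ j n, ContDiff ℝ 1 fun u ↦ (p j u).coeff n) (n : ℕ) :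
    ContDiff ℝ 1 fun u ↦ (∏ j ∈ s, p j u).coeff n := by
  classical
  induction s using Finset.induction_on generalizing n with
  | empty => simpa using contDiff_const
  | insert a s ha ih =>
    simp only [Finset.prod_insert ha, coeff_mul]
    exact ContDiff.sum fun c _ ↦ (hp a c.1).mul (ih c.2)

theorem contDiff_coeff_nodePoly {E ι : Type*} [NormedAddCommGroup E] [NormedSpace ℝ E]
    [Fintype ι] {x : E → ι → ℝ} (hx : ∀ j, ContDiff ℝ 1 fun u ↦ x u j) (n : ℕ) :
    ContDiff ℝ 1 fun u ↦ (nodePoly (x u)).coeff n := by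
  refine contDiff_coeff_prod _ (fun j n ↦ ?_) n
  simp only [coeff_sub]
  refine contDiff_const.sub ?_
  simp only [coeff_C]
  split_ifs
  exacts [hx j, contDiff_const]

theorem contDiff_gapIntegral {E : Type*} [NormedAddCommGroup E] [NormedSpace ℝ E] {k : ℕ}
    {x : E → Fin (k + 1) → ℝ} (hx : ∀ j, ContDiff ℝ 1 fun u ↦ x u j) (i : Fin k) :
    ContDiff ℝ 1 fun u ↦ gapIntegral (x u) i := by
  have hdeg : ∀ u, (nodePoly (x u)).natDegree < k + 2 := fun u ↦ by simp [natDegree_nodePoly]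
  have hcoeff := contDiff_coeff_nodePoly hx
  simp only [gapIntegral, eval_primitive (hdeg _)]
  exact (ContDiff.sum fun n _ ↦ ((hcoeff n).div_const _).mul ((hx _).pow _)).sub
    (ContDiff.sum fun n _ ↦ ((hcoeff n).div_const _).mul ((hx _).pow _))

theorem hasDerivAt_coeff_prod {ι : Type*} [DecidableEq ι] (s : Finset ι) {p : ι → ℝ → ℝ[X]}
    {p' : ι → ℝ[X]} {τ : ℝ}
    (hp : ∀ j n, HasDerivAt (fun τ ↦ (p j τ).coeff n) ((p' j).coeff n) τ) (n : ℕ) :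
    HasDerivAt (fun τ ↦ (∏ j ∈ s, p j τ).coeff n)
      ((∑ j ∈ s, p' j * ∏ l ∈ s.erase j, p l τ).coeff n) τ := by
  induction s using Finset.induction_on generalizing n with
  | empty => simpa using hasDerivAt_const τ _
  | insert a s ha ih =>
    have hsum : ∑ j ∈ insert a s, p' j * ∏ l ∈ (insert a s).erase j, p l τ =
        p' a * ∏ l ∈ s, p l τ + p a τ * ∑ j ∈ s, p' j * ∏ l ∈ s.erase j, p l τ := by
      rw [Finset.sum_insert ha, Finset.erase_insert ha, Finset.mul_sum]
      congr 1
      refine Finset.sum_congr rfl fun j hj ↦ ?_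
      have hja : a ≠ j := fun h ↦ ha (h ▸ hj)
      rw [Finset.erase_insert_of_ne hja,
        Finset.prod_insert fun h ↦ ha (Finset.mem_of_mem_erase h)]
      ring
    simp only [Finset.prod_insert ha, coeff_mul, hsum, coeff_add]
    rw [← Finset.sum_add_distrib]
    exact HasDerivAt.fun_sum fun c _ ↦ (hp a c.1).mul (ih c.2)

/-- The derivative of `nodePoly x` when the nodes move with velocities `x'`. -/
noncomputable def nodeVariation {ι : Type*} [Fintype ι] [DecidableEq ι] (x x' : ι → ℝ) : ℝ[X] :=
  ∑ j, C (-x' j) * ∏ l ∈ Finset.univ.erase j, (X - C (x l))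

theorem hasDerivAt_coeff_nodePoly {ι : Type*} [Fintype ι] [DecidableEq ι] {x : ℝ → ι → ℝ}
    {x' : ι → ℝ} {τ : ℝ} (hx : ∀ j, HasDerivAt (fun τ ↦ x τ j) (x' j) τ) (n : ℕ) :
    HasDerivAt (fun τ ↦ (nodePoly (x τ)).coeff n) ((nodeVariation (x τ) x').coeff n) τ := by
  refine hasDerivAt_coeff_prod Finset.univ (p := fun j τ ↦ X - C (x τ j)) (p' := fun j ↦ C (-x' j))
    (fun j n ↦ ?_) n
  simp only [coeff_sub, coeff_C]
  split_ifs
  · exact (hx j).const_sub _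
  · exact hasDerivAt_const _ _

theorem natDegree_nodeVariation_lt {k : ℕ} (x x' : Fin (k + 1) → ℝ) :
    (nodeVariation x x').natDegree < k + 1 := by
  refine Nat.lt_succ_of_le (natDegree_sum_le_of_forall_le _ _ fun j _ ↦ ?_)
  refine (natDegree_C_mul_le _ _).trans ?_
  simp [natDegree_prod_of_monic _ _ fun j _ ↦ monic_X_sub_C (x j)]

theorem eval_nodeVariation {ι : Type*} [Fintype ι] [DecidableEq ι] (x x' : ι → ℝ) (j : ι) :
    (nodeVariation x x').eval (x j) = -x' j * ∏ l ∈ Finset.univ.erase j, (x j - x l) := by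
  rw [nodeVariation, eval_finsetSum, Finset.sum_eq_single j]
  · simp [eval_prod]
  · intro b _ hb
    simp only [eval_mul, eval_prod, eval_sub, eval_X, eval_C]
    rw [Finset.prod_eq_zero (Finset.mem_erase.2 ⟨hb.symm, Finset.mem_univ j⟩) (sub_self _),
      mul_zero]
  · simp

theorem hasDerivAt_eval_primitive {p : ℝ → ℝ[X]} {p' : ℝ[X]} {τ : ℝ} {t : ℝ → ℝ} {t' : ℝ} {N : ℕ}
    (hdeg : ∀ τ, (p τ).natDegree < N) (hdeg' : p'.natDegree < N)
    (hp : ∀ n, HasDerivAt (fun τ ↦ (p τ).coeff n) (p'.coeff n) τ) (ht : HasDerivAt t t' τ) :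
    HasDerivAt (fun τ ↦ (p τ).primitive.eval (t τ))
      (p'.primitive.eval (t τ) + (p τ).eval (t τ) * t') τ := by
  simp only [eval_primitive (hdeg _), eval_primitive hdeg', eval_eq_sum_range' (hdeg τ)]
  rw [Finset.sum_mul, ← Finset.sum_add_distrib]
  refine HasDerivAt.fun_sum fun n _ ↦ ?_
  refine (((hp n).div_const ((n : ℝ) + 1)).fun_mul (ht.fun_pow (n + 1))).congr_deriv ?_
  rw [Nat.add_sub_cancel]
  push_cast
  field_simp

theorem hasDerivAt_gapIntegral {k : ℕ} {x : ℝ → Fin (k + 1) → ℝ} {x' : Fin (k + 1) → ℝ} {τ : ℝ}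
    (hx : ∀ j, HasDerivAt (fun τ ↦ x τ j) (x' j) τ) (i : Fin k) :
    HasDerivAt (fun τ ↦ gapIntegral (x τ) i)
      ((nodeVariation (x τ) x').primitive.eval (x τ i.succ) -
        (nodeVariation (x τ) x').primitive.eval (x τ i.castSucc)) τ := by
  have hdeg : ∀ u, (nodePoly (x u)).natDegree < k + 2 := fun u ↦ by simp [natDegree_nodePoly]
  have hdeg' : (nodeVariation (x τ) x').natDegree < k + 2 :=
    (natDegree_nodeVariation_lt _ _).trans (by simp)
  have hnode : ∀ j, (nodePoly (x τ)).eval (x τ j) = 0 := fun j ↦ by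
    rw [eval_nodePoly]
    exact Finset.prod_eq_zero (Finset.mem_univ j) (sub_self _)
  have hcoeff := hasDerivAt_coeff_nodePoly hx
  simpa [gapIntegral, hnode] using (hasDerivAt_eval_primitive hdeg hdeg' hcoeff (hx i.succ)).fun_sub
    (hasDerivAt_eval_primitive hdeg hdeg' hcoeff (hx i.castSucc))

/-- An infinitesimal motion of the nodes fixing the first one and all gap integrals is trivial. -/
theorem eq_zero_of_nodeVariation {k : ℕ} {x x' : Fin (k + 1) → ℝ} (hx : StrictMono x)
    (h0 : x' 0 = 0)
    (h : ∀ i : Fin k, (nodeVariation x x').primitive.eval (x i.succ) =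
      (nodeVariation x x').primitive.eval (x i.castSucc)) : x' = 0 := by
  have hroot : ∀ i : Fin k, ∃ ξ ∈ Set.Ioo (x i.castSucc) (x i.succ),
      (nodeVariation x x').eval ξ = 0 := fun i ↦
    exists_hasDerivAt_eq_zero (hx i.castSucc_lt_succ) (by fun_prop) (h i).symm
      fun t _ ↦ (nodeVariation x x').hasDerivAt_primitive t
  choose ξ hξ hξ0 using hroot
  have hcons : StrictMono (Fin.cons (x 0) ξ : Fin (k + 1) → ℝ) := by
    rw [Fin.strictMono_iff_lt_succ]
    intro i
    refine lt_of_le_of_lt ?_ (by simpa using (hξ i).1)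
    refine Fin.cases ?_ (fun j ↦ ?_) i.castSucc
    · simp
    · simpa using (hξ j).2.le
  have hzero : nodeVariation x x' = 0 := by
    refine eq_zero_of_natDegree_lt_card_of_eval_eq_zero _ hcons.injective (fun i ↦ ?_)
      (by simpa using natDegree_nodeVariation_lt x x')
    refine Fin.cases ?_ (fun j ↦ ?_) i
    · simp [eval_nodeVariation, h0]
    · simpa using hξ0 j
  funext j
  have := eval_nodeVariation x x' j
  rw [hzero, eval_zero, eq_comm, mul_eq_zero, neg_eq_zero] at this
  refine this.resolve_right (Finset.prod_ne_zero_iff.2 fun l hl ↦ sub_ne_zero.2 ?_)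
  exact hx.injective.ne (Finset.ne_of_mem_erase hl).symm

/-- The nodes starting at `0` with gaps `exp (u i)`. -/
noncomputable def expNodes {k : ℕ} (u : Fin k → ℝ) : Fin (k + 1) → ℝ :=
  Fin.partialSum fun i ↦ Real.exp (u i)

theorem expNodes_zero {k : ℕ} (u : Fin k → ℝ) : expNodes u 0 = 0 := Fin.partialSum_zero _

theorem expNodes_succ {k : ℕ} (u : Fin k → ℝ) (i : Fin k) :
    expNodes u i.succ = expNodes u i.castSucc + Real.exp (u i) := Fin.partialSum_succ _ i

theorem strictMono_expNodes {k : ℕ} (u : Fin k → ℝ) : StrictMono (expNodes u) := by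
  rw [Fin.strictMono_iff_lt_succ]
  intro i
  rw [expNodes_succ]
  linarith [Real.exp_pos (u i)]

theorem eq_expNodes {k : ℕ} {x : Fin (k + 1) → ℝ} (hx : StrictMono x) (h0 : x 0 = 0) :
    x = expNodes fun i ↦ Real.log (x i.succ - x i.castSucc) := by
  funext j
  refine Fin.induction (by rw [h0, expNodes_zero]) (fun i hi ↦ ?_) j
  rw [expNodes_succ, ← hi, Real.exp_log (sub_pos.2 (hx i.castSucc_lt_succ))]
  ring

theorem contDiff_expNodes {k : ℕ} (j : Fin (k + 1)) :
    ContDiff ℝ 1 fun u : Fin k → ℝ ↦ expNodes u j := by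
  refine Fin.induction ?_ (fun i hi ↦ ?_) j
  · simpa only [expNodes_zero] using contDiff_const
  · simp only [expNodes_succ]
    fun_prop

/-- The logarithms of the gap integrals, as functions of the logarithms of the gaps. -/
noncomputable def logGapIntegral {k : ℕ} (u : Fin k → ℝ) (i : Fin k) : ℝ :=
  Real.log (gapIntegral (expNodes u) i)

theorem contDiff_logGapIntegral {k : ℕ} : ContDiff ℝ 1 (logGapIntegral (k := k)) :=
  contDiff_pi.2 fun i ↦ (contDiff_gapIntegral contDiff_expNodes i).log
    fun u ↦ gapIntegral_ne_zero (strictMono_expNodes u) i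

theorem injective_fderiv_logGapIntegral {k : ℕ} (u : Fin k → ℝ) :
    Function.Injective (fderiv ℝ logGapIntegral u) := by
  rw [injective_iff_map_eq_zero]
  intro w hw
  have hline : HasDerivAt (fun τ : ℝ ↦ u + τ • w) w 0 := by
    simpa using ((hasDerivAt_id (0 : ℝ)).smul_const w).const_add u
  obtain ⟨x', hx'⟩ : ∃ x' : Fin (k + 1) → ℝ,
      ∀ j, HasDerivAt (fun τ : ℝ ↦ expNodes (u + τ • w) j) (x' j) 0 :=
    ⟨fun j ↦ _, fun j ↦ (((contDiff_expNodes j).comp (contDiff_const.add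
      (contDiff_id.smul contDiff_const))).differentiable one_ne_zero 0).hasDerivAt⟩
  have hlog := ((contDiff_logGapIntegral.differentiable one_ne_zero
    (u + (0 : ℝ) • w)).hasFDerivAt.comp_hasDerivAt (0 : ℝ) hline)
  rw [zero_smul, add_zero, hw, hasDerivAt_pi] at hlog
  have hzero : x' = 0 := by
    refine eq_zero_of_nodeVariation (strictMono_expNodes u) ?_ fun i ↦ ?_
    · have h0 := hx' 0
      simp only [expNodes_zero] at h0
      exact h0.unique (hasDerivAt_const _ _)
    · have h1 := (hasDerivAt_gapIntegral hx' i).log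
        (gapIntegral_ne_zero (strictMono_expNodes _) i)
      have h2 := h1.unique (hlog i)
      rw [Pi.zero_apply, div_eq_zero_iff,
        or_iff_left (gapIntegral_ne_zero (strictMono_expNodes _) i), sub_eq_zero] at h2
      simpa using h2
  funext i
  have h1 := hx' i.succ
  simp only [expNodes_succ] at h1
  have hexp : HasDerivAt (fun τ : ℝ ↦ Real.exp ((u + τ • w) i)) (Real.exp (u i) * w i) 0 := by
    simpa using ((hasDerivAt_pi.1 hline) i).exp
  have := h1.unique ((hx' i.castSucc).add hexp)
  simpa [hzero, Real.exp_ne_zero] using this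

theorem tendsto_logGapIntegral {k : ℕ} :
    Tendsto (logGapIntegral (k := k)) (cocompact _) (cocompact _) := by
  rw [← Metric.cobounded_eq_cocompact]
  intro s hs
  rw [Filter.mem_map, ← Bornology.isCobounded_def, ← Bornology.isBounded_compl_iff,
    ← Set.preimage_compl]
  rw [← Bornology.isCobounded_def, ← Bornology.isBounded_compl_iff] at hs
  obtain ⟨R, hR⟩ := hs.exists_norm_le
  obtain ⟨H, hH⟩ : ∃ H, H = 3 * Real.exp |R| := ⟨_, rfl⟩
  obtain ⟨L, hL⟩ : ∃ L, L = (k + 1) * H := ⟨_, rfl⟩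
  have hHpos : 0 < H := by rw [hH]; positivity
  have hLpos : 0 < L := by rw [hL]; positivity
  refine (Metric.isBounded_iff_subset_closedBall (0 : Fin k → ℝ)).2
    ⟨|Real.log H| + |R| + (k + 1) * |Real.log L|, fun u hu ↦ ?_⟩
  have hx := strictMono_expNodes u
  have hbound : ∀ i, |Real.log (abs (gapIntegral (expNodes u) i))| ≤ |R| := fun i ↦ by
    rw [Real.log_abs]
    exact (norm_le_pi_norm (logGapIntegral u) i).trans ((hR _ hu).trans (le_abs_self R))
  have hpos : ∀ i, 0 < |gapIntegral (expNodes u) i| := fun i ↦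
    abs_pos.2 (gapIntegral_ne_zero hx i)
  have hgap : ∀ i, expNodes u i.succ - expNodes u i.castSucc = Real.exp (u i) := fun i ↦ by
    rw [expNodes_succ]; ring
  have hle : ∀ i, Real.exp (u i) ≤ H := fun i ↦ by
    have h1 := pow_le_abs_gapIntegral hx i
    have h2 : |gapIntegral (expNodes u) i| ≤ Real.exp |R| :=
      (Real.log_le_iff_le_exp (hpos i)).1 ((le_abs_self _).trans (hbound i))
    rw [hgap] at h1
    by_contra! hlt
    have h3 : Real.exp |R| < Real.exp (u i) / 3 := by linarith
    have h4 : 1 ≤ Real.exp (u i) / 3 := (Real.one_le_exp (abs_nonneg R)).trans h3.le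
    linarith [le_self_pow₀ h4 (show k + 2 ≠ 0 by omega)]
  have hnodes : ∀ j : Fin (k + 1), 0 ≤ expNodes u j ∧ expNodes u j ≤ j * H := fun j ↦ by
    refine Fin.induction (by simp [expNodes_zero]) (fun i hi ↦ ?_) j
    rw [expNodes_succ]
    simp only [Fin.val_succ, Fin.val_castSucc] at hi ⊢
    push_cast
    exact ⟨by linarith [hi.1, Real.exp_pos (u i)], by linarith [hi.2, hle i]⟩
  have hdiam : ∀ a b, expNodes u a - expNodes u b ≤ L := fun a b ↦ by
    have ha : ((a : ℕ) : ℝ) ≤ k + 1 := by exact_mod_cast a.2.le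
    have := mul_le_mul_of_nonneg_right ha hHpos.le
    linarith [(hnodes a).2, (hnodes b).1]
  rw [mem_closedBall_zero_iff, pi_norm_le_iff_of_nonneg (by positivity)]
  intro i
  have hup : u i ≤ Real.log H := (Real.le_log_iff_exp_le hHpos).2 (hle i)
  have hlow : -|R| ≤ u i + (k + 1) * Real.log L := by
    have h1 := abs_gapIntegral_le hx i hdiam
    rw [hgap] at h1
    have h2 := Real.log_le_log (hpos i) h1
    rw [Real.log_mul (Real.exp_ne_zero _) (by positivity), Real.log_exp, Real.log_pow] at h2
    push_cast at h2
    linarith [(abs_le.1 (hbound i)).1]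
  have hlogL : (k + 1) * Real.log L ≤ (k + 1) * |Real.log L| := by gcongr; exact le_abs_self _
  have hlogL' : 0 ≤ (k + 1) * |Real.log L| := by positivity
  rw [Real.norm_eq_abs, abs_le]
  constructor <;> linarith [le_abs_self (Real.log H), abs_nonneg (Real.log H), abs_nonneg R]

theorem bijective_logGapIntegral {k : ℕ} : Function.Bijective (logGapIntegral (k := k)) :=
  bijective_of_injective_fderiv_of_tendsto_cocompact contDiff_logGapIntegral
    injective_fderiv_logGapIntegral tendsto_logGapIntegral

/-- The polynomial `f` has critical points `x 0 < ⋯ < x k`, all simple, with critical values `v`,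
and `c` is the leading coefficient of its derivative. -/
structure HasCritSeq {k : ℕ} (f : ℝ[X]) (c : ℝ) (x v : Fin (k + 1) → ℝ) : Prop where
  strictMono : StrictMono x
  ne_zero : c ≠ 0
  derivative_eq : derivative f = C c * nodePoly x
  eval_eq : ∀ i, f.eval (x i) = v i

/-- The increments of `v` alternate in sign; `e` has the sign of the first one. -/
def IsAlternating {k : ℕ} (e : ℝ) (v : Fin (k + 1) → ℝ) : Prop :=
  ∀ i : Fin k, 0 < e * (-1) ^ (i : ℕ) * (v i.succ - v i.castSucc)

theorem Polynomial.eq_of_derivative_eq_of_eval_eq {f g : ℝ[X]}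
    (h : derivative f = derivative g) {t : ℝ} (ht : f.eval t = g.eval t) : f = g := by
  have hfg := eq_C_of_derivative_eq_zero (p := f - g) (by rw [derivative_sub, h, sub_self])
  have ht' := congrArg (eval t) hfg
  rw [eval_sub, ht, sub_self, eval_C] at ht'
  rw [← ht', C_0] at hfg
  exact sub_eq_zero.1 hfg

theorem eval_nodePoly_eq_zero_iff {ι : Type*} [Fintype ι] (x : ι → ℝ) (t : ℝ) :
    (nodePoly x).eval t = 0 ↔ t ∈ Set.range x := by
  rw [eval_nodePoly, Finset.prod_eq_zero_iff]
  simp [sub_eq_zero, eq_comm]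

theorem nodePoly_comp_linear {ι : Type*} [Fintype ι] (y : ι → ℝ) {a : ℝ} (ha : a ≠ 0) (b : ℝ) :
    (nodePoly y).comp (C a * X + C b) =
      C (a ^ Fintype.card ι) * nodePoly fun i ↦ (y i - b) / a := by
  rw [nodePoly, prod_comp, nodePoly, ← Finset.card_univ, C_pow, ← Finset.prod_const,
    ← Finset.prod_mul_distrib]
  refine Finset.prod_congr rfl fun i _ ↦ ?_
  rw [sub_comp, X_comp, C_comp, mul_sub, ← C_mul, mul_div_cancel₀ _ ha, C_sub]
  ring

namespace HasCritSeq

variable {k : ℕ} {f g : ℝ[X]} {c c' : ℝ} {x y v w : Fin (k + 1) → ℝ}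

theorem sub_eq (h : HasCritSeq f c x v) (i : Fin k) :
    v i.succ - v i.castSucc = c * gapIntegral x i := by
  have hf : f = C c * (nodePoly x).primitive +
      C (v 0 - c * (nodePoly x).primitive.eval (x 0)) := by
    refine eq_of_derivative_eq_of_eval_eq (t := x 0) ?_ ?_
    · simp [derivative_primitive, h.derivative_eq]
    · simp [h.eval_eq]
  rw [← h.eval_eq, ← h.eval_eq, gapIntegral, hf]
  simp
  ring

theorem isAlternating (h : HasCritSeq f c x v) : IsAlternating (c * (-1) ^ k) v := fun i ↦ by
  rw [h.sub_eq]
  have := mul_pos (sq_pos_of_ne_zero h.ne_zero) (neg_one_pow_mul_gapIntegral_pos h.strictMono i)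
  rw [pow_add] at this
  linarith

theorem derivative_eq_zero_iff (h : HasCritSeq f c x v) (t : ℝ) :
    (derivative f).eval t = 0 ↔ t ∈ Set.range x := by
  rw [h.derivative_eq, eval_mul, eval_C, mul_eq_zero, or_iff_right h.ne_zero,
    eval_nodePoly_eq_zero_iff]

theorem values_unique (h : HasCritSeq f c x v) (h' : HasCritSeq f c' y w) : v = w := by
  have hxy : x = y := by
    rw [← StrictMono.range_inj h.strictMono h'.strictMono]
    ext t
    rw [← h.derivative_eq_zero_iff, h'.derivative_eq_zero_iff]
  funext i
  rw [← h.eval_eq, hxy, h'.eval_eq]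

theorem comp_linear_of_pos (h : HasCritSeq f c x v) {a : ℝ} (ha : 0 < a) (b : ℝ) :
    HasCritSeq (f.comp (C a * X + C b)) (a ^ (k + 2) * c) (fun i ↦ (x i - b) / a) v where
  strictMono i j hij := by
    have := h.strictMono hij
    simp only
    gcongr
  ne_zero := mul_ne_zero (pow_ne_zero _ ha.ne') h.ne_zero
  derivative_eq := by
    rw [derivative_comp, h.derivative_eq, mul_comp, nodePoly_comp_linear _ ha.ne']
    simp only [derivative_add, derivative_C_mul, derivative_X, derivative_C, C_comp,
      Fintype.card_fin, C_mul, C_pow]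
    ring
  eval_eq i := by
    rw [eval_comp, ← h.eval_eq]
    simp only [eval_add, eval_mul, eval_C, eval_X]
    congr 1
    field_simp
    ring

theorem comp_neg (h : HasCritSeq f c x v) :
    HasCritSeq (f.comp (-X)) ((-1) ^ (k + 2) * c) (fun i ↦ -x i.rev) (fun i ↦ v i.rev) where
  strictMono i j hij := neg_lt_neg (h.strictMono (Fin.rev_lt_rev.2 hij))
  ne_zero := mul_ne_zero (by simp) h.ne_zero
  derivative_eq := by
    have hrev : nodePoly (fun i : Fin (k + 1) ↦ -x i.rev) = nodePoly fun i ↦ -x i :=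
      Equiv.prod_comp Fin.revPerm fun i ↦ X - C (-x i)
    have := nodePoly_comp_linear x (show (-1 : ℝ) ≠ 0 by norm_num) 0
    simp only [C_neg, C_1, C_0, add_zero, neg_one_mul, sub_zero, div_neg, div_one] at this
    rw [derivative_comp, h.derivative_eq, mul_comp, this, hrev]
    simp only [derivative_neg, derivative_X, C_comp, Fintype.card_fin, C_mul, C_pow, C_neg, C_1]
    ring
  eval_eq i := by simp [h.eval_eq]

theorem comp_linear_of_neg (h : HasCritSeq f c x v) {a : ℝ} (ha : a < 0) (b : ℝ) :
    ∃ c' x', HasCritSeq (f.comp (C a * X + C b)) c' x' fun i ↦ v i.rev := by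
  have := (h.comp_linear_of_pos (neg_pos.2 ha) b).comp_neg
  rw [comp_assoc] at this
  simp only [add_comp, mul_comp, neg_comp, C_comp, X_comp, C_neg, neg_mul_neg] at this
  exact ⟨_, _, this⟩

/-- Critical values determine a normalized polynomial. -/
theorem eq_of_normalized (hf : HasCritSeq f c x v) (hg : HasCritSeq g c y v) (hx : x 0 = 0)
    (hy : y 0 = 0) : f = g := by
  have hxy : x = y := by
    have hgap : ∀ i, gapIntegral x i = gapIntegral y i := fun i ↦
      mul_left_cancel₀ hf.ne_zero ((hf.sub_eq i).symm.trans (hg.sub_eq i))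
    rw [eq_expNodes hf.strictMono hx, eq_expNodes hg.strictMono hy] at hgap ⊢
    rw [bijective_logGapIntegral.injective (funext fun i ↦ congrArg Real.log (hgap i))]
  refine eq_of_derivative_eq_of_eval_eq (t := x 0) ?_ ?_
  · rw [hf.derivative_eq, hg.derivative_eq, hxy]
  · rw [hf.eval_eq, hxy, hg.eval_eq]

theorem realPolyEquiv (hk : k ≠ 0) (hf : HasCritSeq f c x v) (hg : HasCritSeq g c' y v) :
    RealPolyEquiv f g := by
  have hc : 0 < c / c' := by
    let i : Fin k := ⟨0, Nat.pos_of_ne_zero hk⟩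
    have h1 := (hf.sub_eq i).symm.trans (hg.sub_eq i)
    have h2 := neg_one_pow_mul_gapIntegral_pos hf.strictMono i
    have h3 := neg_one_pow_mul_gapIntegral_pos hg.strictMono i
    have h4 : c / c' = ((-1) ^ (k + i : ℕ) * gapIntegral y i) /
        ((-1) ^ (k + i : ℕ) * gapIntegral x i) := by
      rw [div_eq_div_iff hg.ne_zero h2.ne']
      linear_combination (-1) ^ (k + i : ℕ) * h1
    rw [h4]
    positivity
  obtain ⟨a, ha, hac⟩ : ∃ a : ℝ, 0 < a ∧ a ^ (k + 2) = c / c' :=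
    ⟨_, Real.rpow_pos_of_pos hc _, Real.rpow_inv_natCast_pow hc.le (by simp)⟩
  have h1 := hf.comp_linear_of_pos one_pos (x 0)
  have h2 := hg.comp_linear_of_pos ha (y 0)
  rw [hac, div_mul_cancel₀ _ hg.ne_zero] at h2
  rw [one_pow, one_mul] at h1
  have h3 := congrArg (fun p ↦ p.comp (X - C (x 0)))
    (eq_of_normalized h1 h2 (by simp) (by simp))
  simp only [comp_assoc, add_comp, mul_comp, C_comp, X_comp, C_1, one_mul, sub_add_cancel,
    comp_X] at h3
  refine ⟨a, y 0 - a * x 0, ha.ne', h3.trans ?_⟩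
  congr 1
  rw [C_sub, C_mul]
  ring

theorem natDegree_eq (h : HasCritSeq f c x v) : f.natDegree = k + 2 := by
  have h1 : (derivative f).natDegree = k + 1 := by
    rw [h.derivative_eq, natDegree_C_mul h.ne_zero, natDegree_nodePoly, Fintype.card_fin]
  rw [natDegree_derivative] at h1
  omega

theorem realCritVals_eq (h : HasCritSeq f c x v) :
    realCritVals f = Complex.ofReal '' Set.range v := by
  have hcrit : ∀ z : ℂ, aeval z (derivative f) = 0 ↔ ∃ i, (x i : ℂ) = z := fun z ↦ by
    rw [h.derivative_eq, map_mul, aeval_C, mul_eq_zero, or_iff_right (by simpa using h.ne_zero),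
      nodePoly, map_prod, Finset.prod_eq_zero_iff]
    simp [sub_eq_zero, eq_comm]
  have heval : ∀ i, aeval (x i : ℂ) f = (v i : ℂ) := fun i ↦ by
    rw [← h.eval_eq]
    exact aeval_algebraMap_apply_eq_algebraMap_eval (x i) f
  ext z
  simp only [realCritVals, hcrit, Set.mem_ofPred_eq]
  constructor
  · rintro ⟨_, ⟨i, rfl⟩, rfl⟩
    exact ⟨v i, ⟨i, rfl⟩, (heval i).symm⟩
  · rintro ⟨_, ⟨i, rfl⟩, rfl⟩
    exact ⟨x i, ⟨i, rfl⟩, heval i⟩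

end HasCritSeq

theorem eq_of_abs_eq_of_mul_pos {a b s : ℝ} (h : |a| = |b|) (ha : 0 < s * a) (hb : 0 < s * b) :
    a = b := by
  rcases abs_eq_abs.1 h with h | rfl
  · exact h
  · rw [mul_neg] at ha
    linarith

/-- Every alternating sequence is the sequence of critical values of a real polynomial with
only real critical points. -/
theorem IsAlternating.exists_hasCritSeq {k : ℕ} {e : ℝ} (he : e ≠ 0) {v : Fin (k + 1) → ℝ}
    (hv : IsAlternating e v) : ∃ f c x, HasCritSeq f c x v := by
  obtain ⟨u, hu⟩ := bijective_logGapIntegral.surjective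
    fun i : Fin k ↦ Real.log (v i.succ - v i.castSucc)
  obtain ⟨x, hxu⟩ : ∃ x, x = expNodes u := ⟨_, rfl⟩
  have hx : StrictMono x := hxu ▸ strictMono_expNodes u
  obtain ⟨c, hc⟩ : ∃ c : ℝ, c = e / |e| * (-1) ^ k := ⟨_, rfl⟩
  have he' : 0 < |e| := abs_pos.2 he
  have hc1 : |c| = 1 := by
    rw [hc, abs_mul, abs_div, abs_abs, div_self he'.ne']
    simp
  have hgap : ∀ i : Fin k, c * gapIntegral x i = v i.succ - v i.castSucc := fun i ↦ by
    have hvi := hv i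
    refine eq_of_abs_eq_of_mul_pos (s := e * (-1) ^ (i : ℕ)) ?_ ?_ hvi
    · rw [abs_mul, hc1, one_mul]
      have h1 : Real.log (gapIntegral x i) = Real.log (v i.succ - v i.castSucc) := by
        rw [hxu]
        exact congrFun hu i
      rw [← Real.log_abs, ← Real.log_abs (_ - _)] at h1
      exact Real.log_injOn_pos (abs_pos.2 (gapIntegral_ne_zero hx i))
        (abs_pos.2 (right_ne_zero_of_mul hvi.ne')) h1
    · have h1 := mul_pos he' (neg_one_pow_mul_gapIntegral_pos hx i)
      have h2 : e * (e / |e|) = |e| := by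
        rw [← mul_div_assoc, ← abs_mul_abs_self e, mul_div_assoc, div_self he'.ne', mul_one]
      rw [hc]
      calc 0 < _ := h1
        _ = (e * (e / |e|)) * ((-1) ^ (k + i : ℕ) * gapIntegral x i) := by rw [h2]
        _ = _ := by rw [pow_add]; ring
  refine ⟨C c * (nodePoly x).primitive + C (v 0 - c * (nodePoly x).primitive.eval (x 0)), c, x,
    hx, ?_, ?_, ?_⟩
  · rintro rfl
    simp at hc1
  · simp [derivative_primitive]
  · refine Fin.induction (by simp) fun i hi ↦ ?_
    have := hgap i
    rw [gapIntegral] at this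
    simp only [eval_add, eval_mul, eval_C] at hi ⊢
    linarith

/-- If `f` has as many critical values as its degree allows, all of them real, then its critical
points are real and simple. -/
theorem exists_hasCritSeq_of_realCritVals {k : ℕ} {f : ℝ[X]} {S : Set ℝ} (hS : S.ncard = k + 1)
    (hdeg : f.natDegree = k + 2) (hf : realCritVals f = Complex.ofReal '' S) :
    ∃ c x v, HasCritSeq (k := k) f c x v ∧ Function.Injective v ∧ Set.range v = S := by
  classical
  have hdeg' : (derivative f).natDegree = k + 1 := by
    rw [natDegree_derivative, hdeg]
    rfl
  have hne : derivative f ≠ 0 := by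
    rintro h
    simp [h] at hdeg'
  obtain ⟨Z, hZ⟩ : ∃ Z, Z = ((derivative f).aroots ℂ).toFinset := ⟨_, rfl⟩
  have hmem : ∀ z, z ∈ Z ↔ aeval z (derivative f) = 0 := fun z ↦ by
    simp [hZ, hne]
  have himage : realCritVals f = ((Z.image fun z ↦ aeval z f : Finset ℂ) : Set ℂ) := by
    ext w
    simp [realCritVals, hmem]
  have hcard : (Z.image fun z ↦ aeval z f).card = k + 1 := by
    rw [← Set.ncard_coe_finset, ← himage, hf, Set.ncard_image_of_injective _ Complex.ofReal_injective,
      hS]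
  have hZcard : Z.card = k + 1 := by
    refine le_antisymm ?_ (hcard ▸ Finset.card_image_le)
    rw [hZ, ← hdeg']
    exact (Multiset.toFinset_card_le _).trans (card_roots_map_le_natDegree _)
  have hinj : Set.InjOn (fun z : ℂ ↦ aeval z f) Z :=
    Finset.card_image_iff.1 (hcard.trans hZcard.symm)
  have hreal : ∀ z ∈ Z, ∃ r : ℝ, (r : ℂ) = z := fun z hz ↦ by
    have hz' : (starRingEnd ℂ) z ∈ Z := by
      rw [hmem, aeval_conj, (hmem z).1 hz, map_zero]
    have hval : aeval z f ∈ realCritVals f := ⟨z, (hmem z).1 hz, rfl⟩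
    rw [hf] at hval
    obtain ⟨s, -, hs⟩ := hval
    have : (starRingEnd ℂ) z = z := hinj hz' hz (by
      simp only
      rw [aeval_conj, ← hs, Complex.conj_ofReal])
    exact ⟨z.re, Complex.conj_eq_iff_re.1 this⟩
  obtain ⟨R, hR⟩ : ∃ R, R = (derivative f).roots.toFinset := ⟨_, rfl⟩
  have haeval : ∀ (p : ℝ[X]) (r : ℝ), aeval (r : ℂ) p = ((p.eval r : ℝ) : ℂ) := fun p r ↦
    aeval_algebraMap_apply_eq_algebraMap_eval r p
  have hRZ : R.image Complex.ofReal = Z := by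
    ext z
    rw [Finset.mem_image]
    constructor
    · rintro ⟨r, hr, rfl⟩
      rw [hmem, haeval]
      simpa [hR, hne] using hr
    · intro hz
      obtain ⟨r, rfl⟩ := hreal z hz
      rw [hmem, haeval] at hz
      exact ⟨r, by simpa [hR, hne] using hz, rfl⟩
  have hRcard : R.card = k + 1 := by
    rw [← hZcard, ← hRZ, Finset.card_image_of_injective _ Complex.ofReal_injective]
  have hroots : (derivative f).roots.card = (derivative f).natDegree := by
    refine le_antisymm (card_roots' _) ?_
    rw [hdeg', ← hRcard, hR]
    exact Multiset.toFinset_card_le _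
  have hRval : R.val = (derivative f).roots := by
    refine Multiset.eq_of_le_of_card_le (hR ▸ Multiset.dedup_le _) ?_
    rw [hroots, hdeg', ← hRcard]
    rfl
  have hsplit := C_leadingCoeff_mul_prod_multiset_X_sub_C hroots
  rw [← hRval] at hsplit
  have hnode : nodePoly (R.orderEmbOfFin hRcard) = (R.val.map fun a ↦ X - C a).prod := by
    have := Finset.prod_map Finset.univ (R.orderEmbOfFin hRcard).toEmbedding fun a ↦ X - C a
    rw [R.map_orderEmbOfFin_univ hRcard] at this
    exact this.symm
  have hrange : Set.range (R.orderEmbOfFin hRcard) = R := R.range_orderEmbOfFin hRcard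
  have hcrit : HasCritSeq f (derivative f).leadingCoeff (R.orderEmbOfFin hRcard)
      fun i ↦ f.eval (R.orderEmbOfFin hRcard i) :=
    ⟨(R.orderEmbOfFin hRcard).strictMono, leadingCoeff_ne_zero.2 hne, by rw [hnode, hsplit],
      fun _ ↦ rfl⟩
  have hrangev := hcrit.realCritVals_eq
  rw [hf] at hrangev
  have hSv := Complex.ofReal_injective.image_injective hrangev
  refine ⟨_, _, _, hcrit, fun i j hij ↦ ?_, hSv.symm⟩
  have hZmem : ∀ i, ((R.orderEmbOfFin hRcard i : ℝ) : ℂ) ∈ Z := fun i ↦ by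
    rw [← hRZ]
    exact Finset.mem_image_of_mem _ (R.orderEmbOfFin_mem hRcard i)
  have := hinj (hZmem i) (hZmem j) (by simpa [haeval] using hij)
  exact (R.orderEmbOfFin hRcard).injective (Complex.ofReal_injective this)

theorem RealPolyEquiv.equivalence : Equivalence RealPolyEquiv where
  refl f := ⟨1, 0, one_ne_zero, by simp⟩
  symm := by
    rintro f g ⟨a, b, ha, rfl⟩
    refine ⟨a⁻¹, -(a⁻¹ * b), inv_ne_zero ha, ?_⟩
    rw [comp_assoc]
    simp only [add_comp, mul_comp, C_comp, X_comp, mul_add, ← mul_assoc, ← C_mul,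
      mul_inv_cancel₀ ha, mul_neg, C_neg, C_1, one_mul, neg_add_cancel_right, comp_X]
  trans := by
    rintro f g h ⟨a, b, ha, rfl⟩ ⟨a', b', ha', rfl⟩
    refine ⟨a' * a, a' * b + b', mul_ne_zero ha' ha, ?_⟩
    rw [comp_assoc]
    simp only [add_comp, mul_comp, C_comp, X_comp, C_mul, C_add]
    congr 1
    ring

theorem HasCritSeq.values_eq_or_eq_rev {k : ℕ} {f g : ℝ[X]} {c c' : ℝ} {x y v w : Fin (k + 1) → ℝ}
    (hf : HasCritSeq f c x v) (hg : HasCritSeq g c' y w) (h : RealPolyEquiv f g) :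
    v = w ∨ v = fun i ↦ w i.rev := by
  obtain ⟨a, b, ha, rfl⟩ := h
  rcases ha.lt_or_gt with ha | ha
  · obtain ⟨_, _, hg'⟩ := hg.comp_linear_of_neg ha b
    exact .inr (hf.values_unique hg')
  · exact .inl (hf.values_unique (hg.comp_linear_of_pos ha b))

theorem isUpDown_iff {k : ℕ} {r : Fin (k + 1) → ℝ} (hr : StrictMono r)
    (σ : Equiv.Perm (Fin (k + 1))) : IsUpDown σ ↔ IsAlternating 1 (r ∘ σ) := by
  have key : ∀ i : Fin k, (if (i : ℕ) % 2 = 0 then σ i.castSucc < σ i.succ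
      else σ i.succ < σ i.castSucc) ↔
      0 < (1 : ℝ) * (-1) ^ (i : ℕ) * ((r ∘ σ) i.succ - (r ∘ σ) i.castSucc) := fun i ↦ by
    rcases Nat.even_or_odd (i : ℕ) with hi | hi
    · simp [hi.neg_one_pow, Nat.even_iff.1 hi, hr.lt_iff_lt]
    · simp [hi.neg_one_pow, Nat.odd_iff.1 hi, hr.lt_iff_lt]
  exact ⟨fun h i ↦ (key i).1 (h i (Nat.succ_lt_succ i.2)),
    fun h i hi ↦ (key ⟨i, Nat.lt_of_succ_lt_succ hi⟩).2 (h ⟨i, _⟩)⟩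

theorem isUpDown_trans_revPerm_iff {k : ℕ} {r : Fin (k + 1) → ℝ} (hr : StrictMono r)
    (σ : Equiv.Perm (Fin (k + 1))) :
    IsUpDown (σ.trans Fin.revPerm) ↔ IsAlternating (-1) (r ∘ σ) := by
  rw [isUpDown_iff (r := fun i ↦ -r i.rev) fun i j hij ↦ neg_lt_neg (hr (Fin.rev_lt_rev.2 hij))]
  refine forall_congr' fun i ↦ ?_
  simp only [Function.comp_apply, Equiv.trans_apply, Fin.revPerm_apply, Fin.rev_rev]
  ring_nf

theorem IsAlternating.one_or_neg_one {k : ℕ} {e : ℝ} {v : Fin (k + 1) → ℝ} (he : e ≠ 0)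
    (h : IsAlternating e v) : IsAlternating 1 v ∨ IsAlternating (-1) v := by
  rcases he.lt_or_gt with he | he
  · refine .inr fun i ↦ pos_of_mul_pos_right ?_ (neg_nonneg.2 he.le)
    have := h i
    linarith
  · refine .inl fun i ↦ pos_of_mul_pos_right ?_ he.le
    have := h i
    linarith

/-- Of `σ` and its complement, the one whose first value is below its last one. -/
def orient {k : ℕ} (σ : Equiv.Perm (Fin (k + 1))) : Equiv.Perm (Fin (k + 1)) :=
  if σ 0 < σ (Fin.last k) then σ else σ.trans Fin.revPerm

theorem orient_zero_lt_orient_last {k : ℕ} (hk : k ≠ 0) (σ : Equiv.Perm (Fin (k + 1))) :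
    orient σ 0 < orient σ (Fin.last k) := by
  unfold orient
  split_ifs with h
  · exact h
  · have hne : σ (Fin.last k) ≠ σ 0 :=
      σ.injective.ne fun h0 ↦ hk (by simpa using congrArg Fin.val h0)
    exact Fin.rev_lt_rev.2 ((not_lt.1 h).lt_of_ne hne)

theorem trans_revPerm_trans_revPerm {k : ℕ} (σ : Equiv.Perm (Fin (k + 1))) :
    (σ.trans Fin.revPerm).trans Fin.revPerm = σ := by
  ext i
  simp

theorem orient_eq_of_lt {k : ℕ} {σ τ : Equiv.Perm (Fin (k + 1))}
    (hτ : τ 0 < τ (Fin.last k)) (h : σ = τ ∨ σ = τ.trans Fin.revPerm) : orient σ = τ := by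
  rcases h with rfl | rfl
  · exact if_pos hτ
  · have h : ¬ (τ.trans Fin.revPerm) 0 < (τ.trans Fin.revPerm) (Fin.last k) :=
      (Fin.rev_lt_rev.2 hτ).asymm
    rw [orient, if_neg h, trans_revPerm_trans_revPerm]

theorem IsUpDown.not_trans_revPerm {k : ℕ} (hk : k ≠ 0) {σ : Equiv.Perm (Fin (k + 1))}
    (h : IsUpDown σ) : ¬ IsUpDown (σ.trans Fin.revPerm) := fun h' ↦ by
  have h1 := h 0 (by omega)
  have h2 := h' 0 (by omega)
  exact lt_asymm h1 (Fin.rev_lt_rev.1 h2)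

theorem IsUpDown.orient_injective {k : ℕ} (hk : k ≠ 0) {σ τ : Equiv.Perm (Fin (k + 1))}
    (hσ : IsUpDown σ) (hτ : IsUpDown τ) (h : orient σ = orient τ) : σ = τ := by
  unfold orient at h
  split_ifs at h
  · exact h
  · exact absurd (h ▸ hσ) (hτ.not_trans_revPerm hk)
  · exact absurd (h ▸ hτ) (hσ.not_trans_revPerm hk)
  · rw [← trans_revPerm_trans_revPerm σ, h, trans_revPerm_trans_revPerm]

theorem IsUpDown.exists_hasCritSeq_orient {k : ℕ} {r : Fin (k + 1) → ℝ} (hr : StrictMono r)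
    {σ : Equiv.Perm (Fin (k + 1))} (hσ : IsUpDown σ) :
    ∃ f c x, HasCritSeq f c x (r ∘ orient σ) := by
  unfold orient
  split_ifs
  · exact ((isUpDown_iff hr σ).1 hσ).exists_hasCritSeq one_ne_zero
  · rw [← trans_revPerm_trans_revPerm σ, isUpDown_trans_revPerm_iff hr] at hσ
    exact hσ.exists_hasCritSeq (neg_ne_zero.2 one_ne_zero)

theorem exists_isUpDown_orient {k : ℕ} (hk : k ≠ 0) {r : Fin (k + 1) → ℝ} (hr : StrictMono r)
    {S : Set ℝ} (hrS : Set.range r = S) {f : ℝ[X]} (hdeg : f.natDegree = k + 2)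
    (hf : realCritVals f = Complex.ofReal '' S) :
    ∃ σ : Equiv.Perm (Fin (k + 1)), IsUpDown σ ∧
      ∃ g c x, HasCritSeq g c x (r ∘ orient σ) ∧ RealPolyEquiv g f := by
  have hS : S.ncard = k + 1 := by
    rw [← hrS, ← Set.image_univ, Set.ncard_image_of_injective _ hr.injective, Set.ncard_univ,
      Nat.card_eq_fintype_card, Fintype.card_fin]
  obtain ⟨c, x, v, h, hv, hvS⟩ := exists_hasCritSeq_of_realCritVals hS hdeg hf
  choose τ' hτ' using fun i ↦ (hrS ▸ hvS ▸ Set.mem_range_self i : v i ∈ Set.range r)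
  have hinj : Function.Injective τ' := fun i j hij ↦ hv (by rw [← hτ', hij, hτ'])
  obtain ⟨τ, rfl⟩ : ∃ τ : Equiv.Perm (Fin (k + 1)), v = r ∘ τ :=
    ⟨.ofBijective τ' (Finite.injective_iff_bijective.1 hinj), funext fun i ↦ (hτ' i).symm⟩
  obtain ⟨g, c, x, τ, hg, hlt, hgf⟩ : ∃ g c x, ∃ τ : Equiv.Perm (Fin (k + 1)),
      HasCritSeq g c x (r ∘ τ) ∧ τ 0 < τ (Fin.last k) ∧ RealPolyEquiv g f := by
    have hne : τ 0 ≠ τ (Fin.last k) :=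
      τ.injective.ne fun h0 ↦ hk (by simpa using (congrArg Fin.val h0).symm)
    rcases hne.lt_or_gt with hlt | hlt
    · exact ⟨f, c, x, τ, h, hlt, RealPolyEquiv.equivalence.refl f⟩
    · exact ⟨_, _, _, Fin.revPerm.trans τ, h.comp_neg, by simpa using hlt, -1, 0, by simp, by simp⟩
  have halt := hg.isAlternating.one_or_neg_one (mul_ne_zero hg.ne_zero (by simp))
  rw [← isUpDown_iff hr, ← isUpDown_trans_revPerm_iff hr] at halt
  rcases halt with hτ | hτ
  · exact ⟨_, hτ, g, c, x, by rwa [orient_eq_of_lt hlt (.inl rfl)], hgf⟩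
  · exact ⟨_, hτ, g, c, x, by rwa [orient_eq_of_lt hlt (.inr rfl)], hgf⟩

/-- For `n ≥ 3` and a set `C` of `n − 1` distinct real numbers, the number of equivalence
classes of real degree-`n` polynomials whose set of critical values equals `C`
is the Euler–Bernoulli number `K_{n−1}`. -/
theorem count_real_polynomials_with_real_critical_values
    (n : ℕ) (hn : 3 ≤ n) (C : Set ℝ) (hC : C.ncard = n - 1) :
    Nat.card (Quot fun f g : {f : Polynomial ℝ //
        f.natDegree = n ∧ realCritVals f = Complex.ofReal '' C} => RealPolyEquiv f.1 g.1) =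
      eulerBernoulli (n - 1) := by
  obtain ⟨k, rfl⟩ : ∃ k, n = k + 2 := ⟨n - 2, by omega⟩
  have hk : k ≠ 0 := by omega
  change C.ncard = k + 1 at hC
  obtain ⟨r, hr, hrC⟩ : ∃ r : Fin (k + 1) → ℝ, StrictMono r ∧ Set.range r = C := by
    have hfin : C.Finite := Set.finite_of_ncard_pos (by omega)
    have hcard : hfin.toFinset.card = k + 1 := by rw [← Set.ncard_eq_toFinset_card C hfin, hC]
    exact ⟨_, (hfin.toFinset.orderEmbOfFin hcard).strictMono, by simp⟩
  have hequiv : Equivalence fun f g : {f : Polynomial ℝ //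
      f.natDegree = k + 2 ∧ realCritVals f = Complex.ofReal '' C} => RealPolyEquiv f.1 g.1 :=
    ⟨fun _ ↦ RealPolyEquiv.equivalence.refl _, RealPolyEquiv.equivalence.symm,
      RealPolyEquiv.equivalence.trans⟩
  choose F c x hF using fun σ : {σ : Equiv.Perm (Fin (k + 1)) // IsUpDown σ} ↦
    σ.2.exists_hasCritSeq_orient hr
  have hmem : ∀ σ, (F σ).natDegree = k + 2 ∧ realCritVals (F σ) = Complex.ofReal '' C := fun σ ↦
    ⟨(hF σ).natDegree_eq, by rw [(hF σ).realCritVals_eq, EquivLike.range_comp, hrC]⟩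
  refine (Nat.card_eq_of_bijective (fun σ ↦ Quot.mk _ ⟨F σ, hmem σ⟩) ⟨fun σ τ h ↦ ?_, ?_⟩).symm
  · have hστ : RealPolyEquiv (F σ) (F τ) := hequiv.eqvGen_iff.1 (Quot.eqvGen_exact h)
    refine Subtype.ext (σ.2.orient_injective hk τ.2 (Equiv.ext fun i ↦ hr.injective ?_))
    rcases (hF σ).values_eq_or_eq_rev (hF τ) hστ with hv | hv
    · exact congrFun hv i
    · have h0 := hr.injective (congrFun hv 0)
      have h1 := hr.injective (congrFun hv (Fin.last k))
      have h2 := orient_zero_lt_orient_last hk σ.1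
      rw [h0, h1, Fin.rev_zero, Fin.rev_last] at h2
      exact absurd h2 (orient_zero_lt_orient_last hk τ.1).asymm
  · rintro ⟨f, hdeg, hf⟩
    obtain ⟨σ, hσ, g, c', x', hg, hgf⟩ := exists_isUpDown_orient hk hr hrC hdeg hf
    exact ⟨⟨σ, hσ⟩, Quot.sound
      (RealPolyEquiv.equivalence.trans ((hF ⟨σ, hσ⟩).realPolyEquiv hk hg) hgf)⟩
end

section
/- For every real t with |t| < π/2, the series Σ_{n=0}^∞ K_n t^n/n! converges to sec t + tan t, where K_n is the number of up-down permutations of {1,…,n} (with the convention K_0 = 1). -/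
/-- A permutation of `Fin (n + 2)` obtained by placing the value `p` in front of the complement of
a permutation `τ` of `Fin (n + 1)` is up-down iff `τ` is and the first step goes up. -/
theorem isUpDown_iff_of_succAbove_rev {n : ℕ} {σ : Equiv.Perm (Fin (n + 2))}
    {τ : Equiv.Perm (Fin (n + 1))} (h : ∀ i, σ i.succ = (σ 0).succAbove (τ i).rev) :
    IsUpDown σ ↔ IsUpDown τ ∧ (τ 0 : ℕ) + σ 0 < n + 1 := by
  have first : σ 0 < σ 1 ↔ (τ 0 : ℕ) + σ 0 < n + 1 := by
    have h0 := h 0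
    rw [Fin.succ_zero_eq_one] at h0
    rw [h0, Fin.lt_succAbove_iff_le_castSucc, Fin.le_def, Fin.val_castSucc, Fin.val_rev]
    omega
  have step (i j : Fin (n + 1)) : σ i.succ < σ j.succ ↔ τ j < τ i := by
    rw [h, h, Fin.succAbove_lt_succAbove_iff, Fin.rev_lt_rev]
  rw [← first]
  constructor
  · intro hσ
    refine ⟨fun i hi => ?_, by simpa using hσ 0 (by omega)⟩
    have := hσ (i + 1) (by omega)
    have h₁ := step ⟨i, by omega⟩ ⟨i + 1, hi⟩
    have h₂ := step ⟨i + 1, hi⟩ ⟨i, by omega⟩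
    simp only [Fin.succ_mk] at h₁ h₂
    rw [h₁, h₂] at this
    split_ifs at this ⊢ <;> first | assumption | omega
  · rintro ⟨hτ, h0⟩ i hi
    rcases i with _ | i
    · simpa using h0
    have := hτ i (by omega)
    have h₁ := step ⟨i, by omega⟩ ⟨i + 1, by omega⟩
    have h₂ := step ⟨i + 1, by omega⟩ ⟨i, by omega⟩
    simp only [Fin.succ_mk] at h₁ h₂
    rw [h₁, h₂]
    split_ifs at this ⊢ <;> first | assumption | omega

theorem exists_perm_succAbove_rev {n : ℕ} (σ : Equiv.Perm (Fin (n + 2))) :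
    ∃ τ : Equiv.Perm (Fin (n + 1)), ∀ i, σ i.succ = (σ 0).succAbove (τ i).rev := by
  have hne (i : Fin (n + 1)) : σ i.succ ≠ σ 0 := σ.injective.ne (Fin.succ_ne_zero i)
  choose τ hτ using fun i => Fin.exists_succAbove_eq (hne i)
  have hinj : Function.Injective fun i => (τ i).rev := fun i j hij => by
    have : τ i = τ j := Fin.rev_injective hij
    exact Fin.succ_injective _ (σ.injective (by rw [← hτ, ← hτ, this]))
  exact ⟨Equiv.ofBijective _ (Finite.injective_iff_bijective.mp hinj), fun i => by simp [hτ]⟩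

theorem exists_perm_cons_succAbove_rev {n : ℕ} (p : Fin (n + 2)) (τ : Equiv.Perm (Fin (n + 1))) :
    ∃ σ : Equiv.Perm (Fin (n + 2)), σ 0 = p ∧ ∀ i, σ i.succ = p.succAbove (τ i).rev := by
  have hinj : Function.Injective
      (Fin.cons p fun i => p.succAbove (τ i).rev : Fin (n + 2) → Fin (n + 2)) := by
    rw [Fin.cons_injective_iff]
    refine ⟨?_, fun i j hij => by simpa using hij⟩
    rintro ⟨i, hi⟩
    exact Fin.succAbove_ne _ _ hi
  exact ⟨Equiv.ofBijective _ (Finite.injective_iff_bijective.mp hinj), by simp, by simp⟩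

/-- The Entringer number counting the up-down permutations of `{0, …, n}` that start with the
value `n - k`. -/
noncomputable def entringer (n k : ℕ) : ℕ :=
  Nat.card {σ : Equiv.Perm (Fin (n + 1)) // IsUpDown σ ∧ (σ 0 : ℕ) + k = n}

theorem entringer_succ_eq_card {n k : ℕ} (hk : k ≤ n + 1) :
    entringer (n + 1) k =
      Nat.card {τ : Equiv.Perm (Fin (n + 1)) // IsUpDown τ ∧ (τ 0 : ℕ) < k} := by
  choose f hf using exists_perm_succAbove_rev (n := n)
  refine Nat.card_eq_of_bijective
    (fun σ => ⟨f σ.1, ((isUpDown_iff_of_succAbove_rev (hf σ.1)).mp σ.2.1).1, ?_⟩) ⟨?_, ?_⟩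
  · have := ((isUpDown_iff_of_succAbove_rev (hf σ.1)).mp σ.2.1).2
    have := σ.2.2
    omega
  · rintro ⟨σ, hσ, hσk⟩ ⟨ρ, hρ, hρk⟩ h
    have hfe : f σ = f ρ := congrArg Subtype.val h
    have h0 : σ 0 = ρ 0 := Fin.ext (by omega)
    refine Subtype.ext (Equiv.ext fun i => ?_)
    refine Fin.cases h0 (fun i => ?_) i
    rw [hf σ, hf ρ, h0, hfe]
  · rintro ⟨τ, hτ, hτk⟩
    obtain ⟨σ, h0, hσ⟩ := exists_perm_cons_succAbove_rev ⟨n + 1 - k, by omega⟩ τ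
    have hστ : ∀ i, σ i.succ = (σ 0).succAbove (τ i).rev := by rwa [h0]
    have hv : (σ 0 : ℕ) = n + 1 - k := by rw [h0]
    refine ⟨⟨σ, (isUpDown_iff_of_succAbove_rev hστ).mpr ⟨hτ, by omega⟩, by omega⟩,
      Subtype.ext (Equiv.ext fun i => ?_)⟩
    have := (hf σ i).symm.trans (hστ i)
    simpa using this

theorem entringer_succ_succ {n k : ℕ} (hk : k ≤ n) :
    entringer (n + 1) (k + 1) = entringer (n + 1) k + entringer n (n - k) := by
  classical
  rw [entringer_succ_eq_card (by omega), entringer_succ_eq_card (by omega), entringer]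
  simp only [Nat.card_eq_fintype_card, Fintype.card_subtype]
  rw [← Finset.card_union_of_disjoint]
  · congr 1
    ext τ
    simp only [Finset.mem_filter, Finset.mem_univ, true_and, Finset.mem_union, ← and_or_left]
    refine and_congr_right fun _ => ?_
    omega
  · refine Finset.disjoint_filter.mpr fun τ _ h₁ h₂ => ?_
    omega

theorem entringer_succ_zero (n : ℕ) : entringer (n + 1) 0 = 0 := by
  simp [entringer_succ_eq_card]

theorem eulerBernoulli_zero : eulerBernoulli 0 = 1 := by
  simp [eulerBernoulli, IsUpDown]

theorem entringer_self (n : ℕ) : entringer n n = eulerBernoulli n := by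
  cases n with
  | zero => simp [entringer, eulerBernoulli, IsUpDown]
  | succ n =>
    rw [entringer_succ_eq_card le_rfl, eulerBernoulli]
    simp only [Fin.is_lt, and_true]

theorem newton_forward_formula {R : Type*} [CommRing R] {g : ℕ → ℕ → R} {n : ℕ}
    (hg : ∀ j k, j + k < n → g j (k + 1) = g j k + g (j + 1) k) {j k : ℕ} (hjk : j + k ≤ n) :
    g j k = ∑ i ∈ Finset.range (k + 1), (k.choose i : R) * g (j + i) 0 := by
  induction k generalizing j with
  | zero => simp
  | succ k ih =>
    have shift (i : ℕ) : j + 1 + i = j + (i + 1) := by omega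
    rw [hg j k (by omega), ih (by omega), ih (by omega), Finset.sum_range_succ' _ (k + 1)]
    simp only [Nat.choose_succ_succ, Nat.cast_add, add_mul, Finset.sum_add_distrib, shift]
    rw [Finset.sum_range_succ (fun i => (k.choose (i + 1) : R) * g (j + (i + 1)) 0),
      Finset.sum_range_succ' (fun i => (k.choose i : R) * g (j + i) 0)]
    simp only [Nat.choose_succ_self, Nat.choose_zero_right, Nat.cast_zero, Nat.cast_one]
    ring

/-- The recurrence encoded by the identity `R = sin * R + cos`, where `s` and `c` are the values
at `0` of the iterated derivatives of `sin` and `cos`. -/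
theorem eulerBernoulli_eq_add_sum {R : Type*} [CommRing R] {s c : ℕ → R}
    (hs : ∀ j, s (j + 1) = c j) (hc : ∀ j, c (j + 1) = -s j) (hs0 : s 0 = 0) (hc0 : c 0 = 1)
    (n : ℕ) :
    (eulerBernoulli n : R) =
      c n + ∑ j ∈ Finset.range (n + 1), (n.choose j : R) * (s j * eulerBernoulli (n - j)) := by
  let g (j k : ℕ) : R := c j * entringer (n - j) k + s j * entringer (n - j) (n - j - k)
  have hg (j k : ℕ) (hjk : j + k < n) : g j (k + 1) = g j k + g (j + 1) k := by
    obtain ⟨l, rfl⟩ : ∃ l, n = j + k + l + 1 := ⟨n - (j + k + 1), by omega⟩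
    have h₁ : j + k + l + 1 - j = k + l + 1 := by omega
    have h₂ : j + k + l + 1 - (j + 1) = k + l := by omega
    have h₃ : k + l + 1 - (k + 1) = l := by omega
    have h₄ : k + l + 1 - k = l + 1 := by omega
    have e₁ := entringer_succ_succ (n := k + l) (k := k) (by omega)
    have e₂ := entringer_succ_succ (n := k + l) (k := l) (by omega)
    rw [Nat.add_sub_cancel] at e₂
    simp only [g, h₁, h₂, h₃, h₄, e₁, e₂, hs, hc, Nat.add_sub_cancel_left]
    push_cast
    ring
  have h := newton_forward_formula hg (j := 0) (k := n) (by omega)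
  have hg0 : g 0 n = eulerBernoulli n := by simp [g, hs0, hc0, entringer_self]
  rw [← hg0, h]
  simp only [g, zero_add, Nat.sub_zero, entringer_self, mul_add, Finset.sum_add_distrib]
  congr 1
  rw [Finset.sum_range_succ, Finset.sum_eq_zero, zero_add]
  · simp [entringer_self, eulerBernoulli_zero]
  · intro j hj
    obtain ⟨m, hm⟩ : ∃ m, n - j = m + 1 := ⟨n - j - 1, by have := Finset.mem_range.mp hj; omega⟩
    simp [hm, entringer_succ_zero]

open Complex in
theorem Complex.cos_ne_zero_of_norm_lt {z : ℂ} (hz : ‖z‖ < Real.pi / 2) : cos z ≠ 0 := by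
  rw [Ne, cos_eq_zero_iff]
  rintro ⟨k, rfl⟩
  have hk : (1 : ℝ) ≤ |((2 * k + 1 : ℤ) : ℝ)| := by
    rw [← Int.cast_abs]
    exact_mod_cast Int.one_le_abs (by omega)
  have : ‖(2 * k + 1 : ℂ) * Real.pi / 2‖ = |((2 * k + 1 : ℤ) : ℝ)| * (Real.pi / 2) := by
    have h : (2 * k + 1 : ℂ) * Real.pi / 2 = (((2 * k + 1 : ℤ) * (Real.pi / 2) : ℝ) : ℂ) := by
      push_cast
      ring
    rw [h, norm_real, Real.norm_eq_abs, abs_mul, abs_of_pos Real.pi_div_two_pos]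
  rw [this] at hz
  nlinarith [Real.pi_pos]

open Complex Filter Topology in
theorem iteratedDeriv_sec_add_tan_zero (n : ℕ) :
    iteratedDeriv n (fun z : ℂ => 1 / cos z + tan z) 0 = eulerBernoulli n := by
  set r : ℂ → ℂ := fun z => 1 / cos z + tan z with hr
  have hcos : ∀ᶠ z in 𝓝 (0 : ℂ), cos z ≠ 0 :=
    continuous_cos.continuousAt.eventually_ne (by simp)
  have hfun : r =ᶠ[𝓝 0] cos + sin * r := by
    filter_upwards [hcos] with z hz
    simp only [hr, Pi.add_apply, Pi.mul_apply, tan_eq_sin_div_cos]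
    field_simp
    linear_combination -sin_sq_add_cos_sq z
  have hrd (m : ℕ) : ContDiffAt ℂ m r 0 := by
    have h0 : cos (0 : ℂ) ≠ 0 := by simp
    exact (contDiffAt_const.div contDiff_cos.contDiffAt h0).add (contDiffAt_tan.mpr h0)
  have hrec (m : ℕ) : iteratedDeriv m r 0 = iteratedDeriv m cos 0 +
      ∑ j ∈ Finset.range (m + 1),
        (m.choose j : ℂ) * (iteratedDeriv j sin 0 * iteratedDeriv (m - j) r 0) := by
    rw [hfun.iteratedDeriv_eq, iteratedDeriv_add contDiff_cos.contDiffAt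
      (show ContDiffAt ℂ m (sin * r) 0 from contDiff_sin.contDiffAt.mul (hrd m)),
      iteratedDeriv_mul contDiff_sin.contDiffAt (hrd m)]
    simp only [mul_assoc]
  induction n using Nat.strong_induction_on with
  | _ n ih =>
    rw [hrec, eulerBernoulli_eq_add_sum (s := fun j => iteratedDeriv j sin (0 : ℂ))
      (c := fun j => iteratedDeriv j cos (0 : ℂ)) (by simp) (by simp) (by simp) (by simp)]
    congr 1
    refine Finset.sum_congr rfl fun j hj => ?_
    rcases j with _ | j
    · simp
    · rw [ih _ (by have := Finset.mem_range.mp hj; omega)]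

/-- For `|t| < π/2`, the series `Σ K_n t^n / n!` converges to `sec t + tan t`. -/
theorem eulerBernoulli_generating_function (t : ℝ) (ht : |t| < Real.pi / 2) :
    HasSum (fun n : ℕ => (eulerBernoulli n : ℝ) * t ^ n / n.factorial)
      (1 / Real.cos t + Real.tan t) := by
  have hd : DifferentiableOn ℂ (fun z : ℂ => 1 / Complex.cos z + Complex.tan z)
      (Metric.ball 0 (Real.pi / 2)) := fun z hz => by
    have hz := Complex.cos_ne_zero_of_norm_lt (mem_ball_zero_iff.mp hz)
    exact (((differentiableAt_const 1).div Complex.differentiable_cos.differentiableAt hz).add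
      (Complex.differentiableAt_tan.mpr hz)).differentiableWithinAt
  have h := Complex.hasSum_taylorSeries_on_ball hd (z := t) (by simpa using ht)
  simp only [iteratedDeriv_sec_add_tan_zero, sub_zero, smul_eq_mul] at h
  refine Complex.hasSum_ofReal.mp ?_
  push_cast
  have hcoeff (n : ℕ) : (eulerBernoulli n * (t : ℂ) ^ n / n.factorial) =
      (n.factorial : ℂ)⁻¹ * ((t : ℂ) ^ n * eulerBernoulli n) := by
    ring
  simp only [hcoeff]
  exact h
end

section
/- For every integer n ≥ 3 and every set C of n−1 distinct complex numbers, the number of equivalence classes of complex polynomials f of degree n whose set of critical values C(f) equals C is equal to n^{n−3} (a positive integer since n ≥ 3). -/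
/-- The set of critical values of a complex polynomial `f`:
`C(f) = {f(z) : z ∈ ℂ, f′(z) = 0}`. -/
def critVals (f : Polynomial ℂ) : Set ℂ :=
  {w | ∃ z : ℂ, (Polynomial.derivative f).eval z = 0 ∧ f.eval z = w}

/-- Two complex polynomials are equivalent if `f(X) = g(aX + b)` for some complex
`a ≠ 0`, `b`. -/
def CPolyEquiv (f g : Polynomial ℂ) : Prop :=
  ∃ a b : ℂ, a ≠ 0 ∧ f = g.comp (Polynomial.C a * Polynomial.X + Polynomial.C b)

/-- The number of monomials of total degree at most `T` in the variables `σ`. -/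
noncomputable def monomialCount (σ : Type*) (T : ℕ) : ℕ :=
  Nat.card {α : σ →₀ ℕ // α.degree ≤ T}

section MonomialCount

variable {σ : Type*} [Fintype σ]

theorem Finsupp.apply_le_degree (α : σ →₀ ℕ) (i : σ) : α i ≤ α.degree := by
  classical
  rw [Finsupp.degree_eq_sum]
  exact Finset.single_le_sum (f := fun i => α i) (fun _ _ => Nat.zero_le _) (Finset.mem_univ i)

theorem exists_degree_le_injective (σ : Type*) [Fintype σ] (T : ℕ) :
    ∃ f : {α : σ →₀ ℕ // α.degree ≤ T} → (σ → Fin (T + 1)), Function.Injective f := by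
  refine ⟨fun α i => ⟨α.1 i, Nat.lt_succ_of_le ((α.1.apply_le_degree i).trans α.2)⟩, ?_⟩
  intro α β h
  ext i
  simpa using congrFun h i

instance finite_degree_le (T : ℕ) : Finite {α : σ →₀ ℕ // α.degree ≤ T} :=
  let ⟨_, hf⟩ := exists_degree_le_injective σ T
  Finite.of_injective _ hf

theorem monomialCount_le (σ : Type*) [Fintype σ] (T : ℕ) :
    monomialCount σ T ≤ (T + 1) ^ Fintype.card σ := by
  obtain ⟨f, hf⟩ := exists_degree_le_injective σ T
  simpa [monomialCount, Nat.card_fun] using Nat.card_le_card_of_injective f hf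

theorem monomialCount_pos (σ : Type*) [Fintype σ] (T : ℕ) : 0 < monomialCount σ T := by
  have : Nonempty {α : σ →₀ ℕ // α.degree ≤ T} := ⟨⟨0, by simp⟩⟩
  exact Nat.card_pos

theorem monomialCount_mono (σ : Type*) [Fintype σ] : Monotone (monomialCount σ) := fun _ T h =>
  Nat.card_le_card_of_injective (fun α => (⟨α.1, α.2.trans h⟩ : {α : σ →₀ ℕ // α.degree ≤ T}))
    fun _ _ h => Subtype.ext (congrArg Subtype.val h :)

theorem pow_mul_monomialCount_le (σ : Type*) [Fintype σ] {n : ℕ} (hn : 0 < n) (T : ℕ) :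
    n ^ Fintype.card σ * monomialCount σ T ≤ monomialCount σ (n * (T + Fintype.card σ)) := by
  have : n ^ Fintype.card σ * monomialCount σ T =
      Nat.card ((σ → Fin n) × {α : σ →₀ ℕ // α.degree ≤ T}) := by
    simp [monomialCount, Nat.card_prod, Nat.card_fun]
  rw [this]
  refine Nat.card_le_card_of_injective (fun p =>
    ⟨Finsupp.equivFunOnFinite.symm (fun i => n * p.2.1 i + p.1 i), ?_⟩) ?_
  · have h := p.2.2
    rw [Finsupp.degree_eq_sum] at h ⊢
    simp only [Finsupp.equivFunOnFinite_symm_apply_apply, Finset.sum_add_distrib,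
      ← Finset.mul_sum, mul_add]
    gcongr
    calc _ ≤ ∑ i : σ, n := Finset.sum_le_sum fun i _ => (p.1 i).2.le
      _ = _ := by simp [mul_comm]
  · rintro ⟨g, α⟩ ⟨g', α'⟩ h
    have h1 : ∀ i, n * α.1 i + g i = n * α'.1 i + g' i := fun i => by
      simpa using DFunLike.congr_fun (congrArg Subtype.val h) i
    have h2 : ∀ i, α.1 i = α'.1 i ∧ (g i : ℕ) = g' i := fun i => by
      have e := h1 i
      have e1 := congrArg (· / n) e
      have e2 := congrArg (· % n) e
      simpa [Nat.mul_add_div hn, Nat.div_eq_of_lt, Nat.mod_eq_of_lt] using And.intro e1 e2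
    ext i
    · exact (h2 i).2
    · exact (h2 i).1

theorem monomialCount_mul_le (σ : Type*) [Fintype σ] {n : ℕ} (hn : 0 < n) (T : ℕ) :
    monomialCount σ (n * T) ≤ n ^ Fintype.card σ * monomialCount σ T := by
  have : n ^ Fintype.card σ * monomialCount σ T =
      Nat.card ((σ → Fin n) × {α : σ →₀ ℕ // α.degree ≤ T}) := by
    simp [monomialCount, Nat.card_prod, Nat.card_fun]
  rw [this]
  refine Nat.card_le_card_of_injective (fun α =>
    (fun i => ⟨α.1 i % n, Nat.mod_lt _ hn⟩,
      ⟨Finsupp.equivFunOnFinite.symm (fun i => α.1 i / n), ?_⟩)) ?_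
  · have h := α.2
    rw [Finsupp.degree_eq_sum] at h ⊢
    simp only [Finsupp.equivFunOnFinite_symm_apply_apply]
    refine Nat.le_of_mul_le_mul_left (le_trans ?_ h) hn
    rw [Finset.mul_sum]
    exact Finset.sum_le_sum fun i _ => Nat.mul_div_le _ _
  · intro α β h
    ext i
    have h1 := congrFun (congrArg Prod.fst h) i
    have h2 := DFunLike.congr_fun (congrArg Subtype.val (congrArg Prod.snd h)) i
    simp only [Fin.mk.injEq, Finsupp.equivFunOnFinite_symm_apply_apply] at h1 h2
    rw [← Nat.div_add_mod (α.1 i) n, ← Nat.div_add_mod (β.1 i) n, h1, h2]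

theorem le_of_mul_monomialCount_le (σ : Type*) [Fintype σ] {m M c : ℕ}
    (h : ∀ T, m * monomialCount σ T ≤ M * monomialCount σ (T + c)) : m ≤ M := by
  by_contra! hlt
  have hiter : ∀ j, m ^ j ≤ M ^ j * monomialCount σ (j * c) := by
    intro j
    have : ∀ j, m ^ j * monomialCount σ 0 ≤ M ^ j * monomialCount σ (j * c) := by
      intro j
      induction j with
      | zero => simp
      | succ j ih =>
        calc m ^ (j + 1) * monomialCount σ 0 = m * (m ^ j * monomialCount σ 0) := by ring
          _ ≤ m * (M ^ j * monomialCount σ (j * c)) := by gcongr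
          _ = M ^ j * (m * monomialCount σ (j * c)) := by ring
          _ ≤ M ^ j * (M * monomialCount σ (j * c + c)) :=
            Nat.mul_le_mul_left _ (h _)
          _ = _ := by rw [add_mul, one_mul]; ring
    exact (Nat.le_mul_of_pos_right _ (monomialCount_pos σ 0)).trans (this j)
  have hm : (0 : ℝ) < m := by exact_mod_cast (Nat.zero_le M).trans_lt hlt
  have hr : |(M / m : ℝ)| < 1 := by
    rw [abs_of_nonneg (by positivity), div_lt_one hm]
    exact_mod_cast hlt
  set k := Fintype.card σ
  have hlim := (tendsto_pow_const_mul_const_pow_of_abs_lt_one k hr).const_mul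
    (((c : ℝ) + 1) ^ k)
  rw [mul_zero] at hlim
  obtain ⟨j, hj, hj1⟩ := ((hlim.eventually (gt_mem_nhds one_pos)).and
    (Filter.eventually_ge_atTop 1)).exists
  have h1 : (m : ℝ) ^ j ≤ M ^ j * ((c + 1) ^ k * j ^ k) := by
    have : m ^ j ≤ M ^ j * ((c + 1) ^ k * j ^ k) := by
      refine (hiter j).trans ?_
      gcongr
      refine (monomialCount_le σ _).trans ?_
      rw [← mul_pow]
      gcongr
      nlinarith
    exact_mod_cast this
  have h2 : (M : ℝ) ^ j * ((c + 1) ^ k * j ^ k) < m ^ j := by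
    have e : ((c : ℝ) + 1) ^ k * (j ^ k * (M / m) ^ j) * m ^ j =
        M ^ j * ((c + 1) ^ k * j ^ k) := by
      rw [div_pow]
      field_simp
    rw [← e]
    exact mul_lt_of_lt_one_left (by positivity) hj
  exact absurd h1 (not_le.mpr h2)

end MonomialCount

namespace MvPolynomial

theorem finrank_restrictTotalDegree (σ K : Type*) [Field K] (T : ℕ) :
    Module.finrank K (restrictTotalDegree σ K T) = monomialCount σ T := by
  rw [restrictTotalDegree, Module.finrank_eq_nat_card_basis (basisRestrictSupport K _)]
  rfl

section Analytic

variable {σ : Type*} [Fintype σ]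

theorem differentiable_eval (p : MvPolynomial σ ℂ) : Differentiable ℂ fun x : σ → ℂ => eval x p :=
  fun x => (AnalyticOnNhd.eval_mvPolynomial p x (Set.mem_univ x)).differentiableAt

theorem fderiv_eval (p : MvPolynomial σ ℂ) (z ξ : σ → ℂ) :
    fderiv ℂ (fun x => eval x p) z ξ = eval z (mkDerivation ℂ (fun j => C (ξ j)) p) := by
  induction p using MvPolynomial.induction_on with
  | C a => simp
  | add p q hp hq =>
    simp only [map_add]
    rw [fderiv_fun_add (differentiable_eval p z) (differentiable_eval q z)]
    simp [hp, hq]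
  | mul_X p i hp =>
    simp only [map_mul, eval_X, Derivation.leibniz, mkDerivation_X]
    rw [fderiv_fun_mul (differentiable_eval p z) (by fun_prop)]
    have : fderiv ℂ (fun x : σ → ℂ => x i) z ξ = ξ i := by
      rw [(hasFDerivAt_apply i z).fderiv]
      rfl
    simp [hp, this]

theorem eq_zero_of_eventually_eval_eq_zero {a : MvPolynomial σ ℂ} {v : σ → ℂ}
    (h : ∀ᶠ y in nhds v, eval y a = 0) : a = 0 := by
  obtain ⟨r, hr, hball⟩ := Metric.eventually_nhds_iff_ball.mp h
  refine funext_set (fun i => Metric.ball (v i) r)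
    (fun i => infinite_of_mem_nhds (v i) (Metric.ball_mem_nhds _ hr)) fun x hx => ?_
  rw [map_zero]
  exact hball x (by rwa [ball_pi _ hr])

theorem exists_local_section (P : σ → MvPolynomial σ ℂ) {z w : σ → ℂ}
    (hz : ∀ i, eval z (P i) = w i)
    (hJ : ∀ ξ : σ → ℂ, (∀ i, eval z (mkDerivation ℂ (fun j => C (ξ j)) (P i)) = 0) → ξ = 0) :
    ∃ s : (σ → ℂ) → σ → ℂ, ContinuousAt s w ∧ s w = z ∧
      ∀ᶠ y in nhds w, ∀ i, eval (s y) (P i) = y i := by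
  classical
  set F : (σ → ℂ) → σ → ℂ := fun x i => eval x (P i) with hF
  have hFz : F z = w := _root_.funext hz
  have han : AnalyticAt ℂ F z := by
    rw [analyticAt_pi_iff]
    exact fun i => AnalyticOnNhd.eval_mvPolynomial (P i) z (Set.mem_univ z)
  have hd := han.hasStrictFDerivAt
  have hinj : Function.Injective (fderiv ℂ F z : (σ → ℂ) →ₗ[ℂ] σ → ℂ) := by
    rw [← LinearMap.ker_eq_bot, LinearMap.ker_eq_bot']
    intro ξ hξ
    refine hJ ξ fun i => ?_
    have hcomp : fderiv ℂ (fun x => eval x (P i)) z = (ContinuousLinearMap.proj i).comp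
        (fderiv ℂ F z) := (hasFDerivAt_pi'.mp han.differentiableAt.hasFDerivAt i).fderiv
    rw [← fderiv_eval, hcomp]
    exact congrFun hξ i
  let L : (σ → ℂ) ≃L[ℂ] (σ → ℂ) := (LinearEquiv.ofInjectiveEndo _ hinj).toContinuousLinearEquiv
  have hL : (L : (σ → ℂ) →L[ℂ] σ → ℂ) = fderiv ℂ F z := by
    ext ξ i
    rfl
  rw [← hL] at hd
  have hev := hd.eventually_right_inverse
  have hc := hd.localInverse_continuousAt
  rw [hFz] at hev hc
  refine ⟨hd.localInverse F L z, hc, ?_, hev.mono fun y hy i => congrFun hy i⟩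
  rw [← hFz]
  exact hd.localInverse_apply_image

end Analytic

theorem exists_interpolation {σ : Type*} (S : Finset (σ → ℂ)) :
    ∃ e : (σ → ℂ) → MvPolynomial σ ℂ,
      (∀ p, eval p (e p) = 1) ∧ ∀ p, ∀ q ∈ S, q ≠ p → eval q (e p) = 0 := by
  classical
  have key : ∀ p : σ → ℂ, ∃ e : MvPolynomial σ ℂ, eval p e = 1 ∧
      ∀ q ∈ S, q ≠ p → eval q e = 0 := by
    intro p
    have : ∀ q : σ → ℂ, q ≠ p → ∃ l : MvPolynomial σ ℂ, eval p l = 1 ∧ eval q l = 0 := by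
      intro q hq
      obtain ⟨i, hi⟩ := Function.ne_iff.mp hq
      refine ⟨C (p i - q i)⁻¹ * (X i - C (q i)), ?_, by simp⟩
      simp [inv_mul_cancel₀ (sub_ne_zero.mpr hi.symm)]
    choose! l hl1 hl2 using this
    refine ⟨∏ q ∈ S.erase p, l q, ?_, fun q hq hqp => ?_⟩
    · rw [map_prod]
      exact Finset.prod_eq_one fun q hq => hl1 q (Finset.ne_of_mem_erase hq)
    · rw [map_prod]
      exact Finset.prod_eq_zero (Finset.mem_erase.mpr ⟨hqp, hq⟩) (hl2 q hqp)
  choose e he1 he2 using key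
  exact ⟨e, he1, he2⟩

section Counting

variable {σ : Type*} [Fintype σ] {n : ℕ} {P : σ → MvPolynomial σ ℂ} {w : σ → ℂ}

theorem eq_zero_of_sum_aeval_mul_eq_zero {S : Finset (σ → ℂ)}
    (hS : ∀ z ∈ S, ∀ i, eval z (P i) = w i)
    (hJ : ∀ z ∈ S, ∀ ξ : σ → ℂ,
      (∀ i, eval z (mkDerivation ℂ (fun j => C (ξ j)) (P i)) = 0) → ξ = 0)
    {e : (σ → ℂ) → MvPolynomial σ ℂ}
    (he1 : ∀ p, eval p (e p) = 1) (he0 : ∀ p, ∀ q ∈ S, q ≠ p → eval q (e p) = 0)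
    {a : S → MvPolynomial σ ℂ} (ha : ∑ p, aeval P (a p) * e p = 0) : a = 0 := by
  classical
  choose s hsc hsw hs using fun q : S => exists_local_section P (hS q q.2) (hJ q q.2)
  let M : (σ → ℂ) → Matrix S S ℂ := fun y => Matrix.of fun q p => eval (s q y) (e p)
  have hM : ContinuousAt (fun y => (M y).det) w := by
    refine (continuous_id.matrix_det).continuousAt.comp (f := M)
      (continuousAt_pi.mpr fun q => continuousAt_pi.mpr fun p => ?_)
    exact ContinuousAt.comp (g := fun x => eval x (e p))
      (differentiable_eval (e p)).continuous.continuousAt (hsc q)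
  have hMw : (M w).det ≠ 0 := by
    have : M w = 1 := by
      ext q p
      change eval (s q w) (e p) = _
      rw [hsw]
      by_cases h : q = p
      · rw [h, he1, Matrix.one_apply_eq]
      · rw [he0 p q q.2 fun h' => h (Subtype.ext h'), Matrix.one_apply_ne h]
    simp [this]
  have hev := (Filter.eventually_all.mpr hs).and (hM.eventually_ne hMw)
  funext p
  refine eq_zero_of_eventually_eval_eq_zero (v := w) (hev.mono fun y hy => ?_)
  have : (M y).mulVec (fun p => eval y (a p)) = 0 := by
    funext q
    have h := congrArg (eval (s q y)) ha
    have hcomp : ∀ f, eval (s q y) (aeval P f) = eval y f := fun f => by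
      have : (eval (s q y)).comp (aeval P : _ →ₐ[ℂ] MvPolynomial σ ℂ).toRingHom = eval y := by
        ext i
        · simp
        · simp [hy.1 q i]
      exact congrArg (fun g : MvPolynomial σ ℂ →+* ℂ => g f) this
    simp only [map_sum, map_mul, hcomp, map_zero] at h
    simpa [Matrix.mulVec, dotProduct, M, mul_comm] using h
  exact congrFun (Matrix.eq_zero_of_mulVec_eq_zero hy.2 this) p

theorem totalDegree_aeval_le {σ : Type*} {P : σ → MvPolynomial σ ℂ}
    (hP : ∀ i, (P i).totalDegree ≤ n) (a : MvPolynomial σ ℂ) :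
    (aeval P a).totalDegree ≤ n * a.totalDegree := by
  rw [aeval_def, eval₂_eq]
  refine (totalDegree_finsetSum _ _).trans (Finset.sup_le fun α hα => ?_)
  refine (totalDegree_mul _ _).trans ?_
  rw [algebraMap_eq, totalDegree_C, zero_add]
  refine (totalDegree_finsetProd _ _).trans ?_
  refine le_trans ?_ (Nat.mul_le_mul_left n (le_totalDegree hα))
  rw [Finsupp.sum, Finset.mul_sum]
  refine Finset.sum_le_sum fun i _ => (totalDegree_pow _ _).trans ?_
  rw [mul_comm]
  exact Nat.mul_le_mul_right _ (hP i)

theorem card_mul_monomialCount_le (hP : ∀ i, (P i).totalDegree ≤ n) {S : Finset (σ → ℂ)}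
    (hS : ∀ z ∈ S, ∀ i, eval z (P i) = w i)
    (hJ : ∀ z ∈ S, ∀ ξ : σ → ℂ,
      (∀ i, eval z (mkDerivation ℂ (fun j => C (ξ j)) (P i)) = 0) → ξ = 0) :
    ∃ c, ∀ T, S.card * monomialCount σ T ≤ monomialCount σ (n * T + c) := by
  obtain ⟨e, he1, he0⟩ := exists_interpolation S
  refine ⟨S.sup fun p => (e p).totalDegree, fun T => ?_⟩
  let Ψ : (S → restrictTotalDegree σ ℂ T) →ₗ[ℂ] MvPolynomial σ ℂ :=
    ∑ p : S, (LinearMap.mulRight ℂ (e p)) ∘ₗ (aeval P).toLinearMap ∘ₗ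
      (restrictTotalDegree σ ℂ T).subtype ∘ₗ LinearMap.proj p
  have hΨ : ∀ a, Ψ a = ∑ p : S, aeval P (a p : MvPolynomial σ ℂ) * e p := fun a => by
    simp [Ψ, LinearMap.sum_apply]
  have hmem : ∀ a, Ψ a ∈
      restrictTotalDegree σ ℂ (n * T + S.sup fun p => (e p).totalDegree) := by
    intro a
    rw [mem_restrictTotalDegree, hΨ]
    refine (totalDegree_finsetSum _ _).trans (Finset.sup_le fun p _ => ?_)
    refine (totalDegree_mul _ _).trans ?_
    refine add_le_add ((totalDegree_aeval_le hP _).trans (Nat.mul_le_mul_left _ ?_))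
      (Finset.le_sup (f := fun p => (e p).totalDegree) p.2)
    exact (mem_restrictTotalDegree _ _ _).mp (a p).2
  have hinj : Function.Injective (Ψ.codRestrict _ hmem) := by
    rw [← LinearMap.ker_eq_bot, LinearMap.ker_eq_bot']
    intro a ha
    have h0 : Ψ a = 0 := congrArg Subtype.val ha
    rw [hΨ] at h0
    have := eq_zero_of_sum_aeval_mul_eq_zero hS hJ he1 he0 h0
    funext p
    exact Subtype.ext (congrFun this p)
  have := LinearMap.finrank_le_finrank_of_injective hinj
  simpa [Module.finrank_pi_fintype, finrank_restrictTotalDegree] using this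

end Counting

end MvPolynomial

namespace RingHom

variable {R A : Type*} [CommRing R] [CommRing A] {φ : R →+* A}

theorem finite_of_forall_exists_sum {ι : Type*} [Fintype ι] (e : ι → A)
    (h : ∀ f, ∃ c : ι → R, f = ∑ i, φ (c i) * e i) : φ.Finite := by
  let := φ.toAlgebra
  refine ⟨Submodule.fg_def.mpr ⟨Set.range e, Set.finite_range e, ?_⟩⟩
  rw [eq_top_iff]
  rintro f -
  obtain ⟨c, rfl⟩ := h f
  exact Submodule.sum_mem _ fun i _ =>
    Submodule.smul_mem _ (c i) (Submodule.subset_span (Set.mem_range_self i))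

theorem Finite.exists_sub_one_mem_of_forall_exists_sum_mem_map (hφ : φ.Finite) {I : Ideal R}
    {ι : Type*} [Fintype ι] (e : ι → A)
    (h : ∀ f, ∃ c : ι → R, f - ∑ i, φ (c i) * e i ∈ I.map φ) :
    ∃ d, d - 1 ∈ I ∧ ∀ f, ∃ c : ι → R, φ d * f = ∑ i, φ (c i) * e i := by
  let := φ.toAlgebra
  have : Module.Finite R A := hφ
  obtain ⟨d, hd, hle⟩ := Submodule.exists_sub_one_mem_and_smul_le_of_fg_of_le_sup
    (I := I) (N := Submodule.span R (Set.range e)) (N' := ⊤) (P := ⊤)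
    Module.Finite.fg_top le_rfl (by
      rintro f -
      obtain ⟨c, hc⟩ := h f
      rw [← sub_add_cancel f (∑ i, φ (c i) * e i), add_comm]
      refine Submodule.add_mem_sup (Submodule.sum_mem _ fun i _ =>
        Submodule.smul_mem _ (c i) (Submodule.subset_span (Set.mem_range_self i))) ?_
      rw [Ideal.smul_top_eq_map]
      exact hc)
  refine ⟨d, hd, fun f => ?_⟩
  have := hle (Submodule.smul_mem_pointwise_smul f d ⊤ trivial)
  rw [Submodule.mem_span_range_iff_exists_fun] at this
  obtain ⟨c, hc⟩ := this
  exact ⟨c, hc.symm⟩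

end RingHom

namespace MvPolynomial

section Generation

variable {σ K : Type*} [Field K] {n : ℕ}

theorem homogeneousComponent_mul_of_isHomogeneous {p : MvPolynomial σ K} (hp : p.IsHomogeneous n)
    (m : ℕ) (h : MvPolynomial σ K) :
    homogeneousComponent (m + n) (h * p) = homogeneousComponent m h * p := by
  classical
  conv_lhs => rw [← sum_homogeneousComponent h]
  rw [Finset.sum_mul, map_sum]
  have : ∀ i, homogeneousComponent (m + n) (homogeneousComponent i h * p) =
      if i = m then homogeneousComponent m h * p else 0 := by
    intro i
    have hi := (homogeneousComponent_isHomogeneous i h).mul hp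
    rw [homogeneousComponent_of_mem hi]
    by_cases him : i = m
    · simp [him]
    · simp [him, Ne.symm him]
  simp only [this, Finset.sum_ite_eq', Finset.mem_range]
  split_ifs with hm
  · rfl
  · rw [homogeneousComponent_eq_zero _ _ (by omega), zero_mul]

variable {P : σ → MvPolynomial σ K}

theorem exists_mem_span_of_isHomogeneous [Fintype σ] [IsAlgClosed K] (hn : 0 < n)
    (hP : ∀ i, (P i).IsHomogeneous n)
    (hzero : ∀ z : σ → K, (∀ i, eval z (P i) = 0) → z = 0) :
    ∃ c, ∀ N, ∀ f : MvPolynomial σ K, f.totalDegree ≤ N →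
      f ∈ Submodule.span K {g | ∃ (b : MvPolynomial σ K) (β : σ →₀ ℕ), β.degree ≤ c ∧
        n * b.totalDegree ≤ N ∧ g = aeval P b * monomial β (1 : K)} := by
  classical
  have hrad : idealOfVars σ K ≤ (Ideal.span (Set.range P)).radical := by
    rw [← vanishingIdeal_zeroLocus_eq_radical (K := K), idealOfVars, Ideal.span_le]
    rintro _ ⟨i, rfl⟩ z hz
    rw [zeroLocus_span] at hz
    have : z = 0 := hzero z fun i => by simpa using hz (P i) ⟨i, rfl⟩
    simp [this]
  obtain ⟨c, hc⟩ := Ideal.exists_pow_le_of_le_radical_of_fg hrad (idealOfVars_fg σ K)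
  refine ⟨c + n, fun N => ?_⟩
  induction N using Nat.strong_induction_on with
  | _ N ih =>
  intro f hf
  rw [f.as_sum]
  refine Submodule.sum_mem _ fun γ hγ => ?_
  have hγN : Finsupp.degree γ ≤ N := (le_totalDegree hγ).trans hf
  by_cases hγc : Finsupp.degree γ ≤ c + n
  · refine Submodule.subset_span ⟨C (coeff γ f), γ, hγc, by simp, ?_⟩
    simp [C_mul_monomial]
  · push Not at hγc
    set d := Finsupp.degree γ with hd
    have hmem : monomial γ (coeff γ f) ∈ Ideal.span (Set.range P) := by
      refine hc (Ideal.pow_le_pow_right (show c ≤ d by omega) ?_)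
      exact (monomial_mem_pow_idealOfVars_iff d γ (mem_support_iff.mp hγ)).mpr le_rfl
    obtain ⟨h, hh⟩ := (Ideal.mem_span_range_iff_exists_fun).mp hmem
    have hh' : monomial γ (coeff γ f) = ∑ i, homogeneousComponent (d - n) (h i) * P i := by
      have e := congrArg (homogeneousComponent (d - n + n)) hh
      rw [map_sum, homogeneousComponent_eq_self] at e
      · rw [← e]
        exact Finset.sum_congr rfl fun i _ =>
          homogeneousComponent_mul_of_isHomogeneous (hP i) _ _
      · rw [Nat.sub_add_cancel (by omega)]
        exact isHomogeneous_monomial _ rfl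
    rw [hh']
    refine Submodule.sum_mem _ fun i _ => ?_
    have hi := ih (N - n) (by omega) (homogeneousComponent (d - n) (h i))
      ((homogeneousComponent_isHomogeneous _ _).totalDegree_le.trans (by omega))
    generalize homogeneousComponent (d - n) (h i) = u at hi ⊢
    induction hi using Submodule.span_induction with
    | zero => simp
    | add x y _ _ hx hy =>
      rw [add_mul]
      exact Submodule.add_mem _ hx hy
    | smul r x _ hx =>
      rw [smul_mul_assoc]
      exact Submodule.smul_mem _ _ hx
    | mem x hx =>
      obtain ⟨b, β, hβ, hb, rfl⟩ := hx
      refine Submodule.subset_span ⟨X i * b, β, hβ, ?_, ?_⟩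
      · calc n * (X i * b).totalDegree ≤ n * (1 + b.totalDegree) := by
              gcongr
              exact (totalDegree_mul _ _).trans (by simp)
          _ = n * b.totalDegree + n := by ring
          _ ≤ N := by omega
      · simp only [map_mul, aeval_X]
        ring

theorem finite_aeval_of_isHomogeneous [Fintype σ] [IsAlgClosed K] (hn : 0 < n)
    (hP : ∀ i, (P i).IsHomogeneous n)
    (hzero : ∀ z : σ → K, (∀ i, eval z (P i) = 0) → z = 0) :
    (aeval P : MvPolynomial σ K →ₐ[K] MvPolynomial σ K).toRingHom.Finite := by
  classical
  obtain ⟨c, hc⟩ := exists_mem_span_of_isHomogeneous hn hP hzero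
  have := Fintype.ofFinite {β : σ →₀ ℕ // β.degree ≤ c}
  refine RingHom.finite_of_forall_exists_sum
    (fun β : {β : σ →₀ ℕ // β.degree ≤ c} => monomial β.1 (1 : K)) fun f => ?_
  have hf := hc _ f le_rfl
  generalize f.totalDegree = N at hf
  induction hf using Submodule.span_induction with
  | zero => exact ⟨0, by simp⟩
  | add x y _ _ hx hy =>
    obtain ⟨a, rfl⟩ := hx
    obtain ⟨b, rfl⟩ := hy
    exact ⟨a + b, by simp [add_mul, Finset.sum_add_distrib]⟩
  | smul r x _ hx =>
    obtain ⟨a, rfl⟩ := hx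
    refine ⟨r • a, ?_⟩
    rw [Finset.smul_sum]
    exact Finset.sum_congr rfl fun i _ => by simp
  | mem x hx =>
    obtain ⟨b, β, hβ, -, rfl⟩ := hx
    refine ⟨Pi.single ⟨β, hβ⟩ b, ?_⟩
    rw [Finset.sum_eq_single ⟨β, hβ⟩]
    · simp
    · intro i _ hi
      simp [hi]
    · simp

theorem aeval_injective_of_isHomogeneous [Fintype σ] [IsAlgClosed K] (hn : 0 < n)
    (hP : ∀ i, (P i).IsHomogeneous n)
    (hzero : ∀ z : σ → K, (∀ i, eval z (P i) = 0) → z = 0) :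
    Function.Injective (aeval P : MvPolynomial σ K →ₐ[K] MvPolynomial σ K) := by
  have hfin := finite_aeval_of_isHomogeneous hn hP hzero
  have halg : Algebra.IsAlgebraic (Algebra.adjoin K (Set.range P)) (MvPolynomial σ K) := by
    have hI : (algebraMap (Algebra.adjoin K (Set.range P)) (MvPolynomial σ K)).IsIntegral := by
      let g : MvPolynomial σ K →ₐ[K] Algebra.adjoin K (Set.range P) :=
        (aeval P).codRestrict _ fun x => by
          rw [Algebra.adjoin_range_eq_range_aeval]
          exact ⟨x, rfl⟩
      exact RingHom.IsIntegral.tower_top g.toRingHom _ hfin.to_isIntegral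
    exact ⟨fun x => IsIntegral.isAlgebraic (hI x)⟩
  have := Algebra.IsAlgebraic.isTranscendenceBasis_of_lift_le_trdeg_of_finite K P
    (by rw [MvPolynomial.trdeg_of_isDomain]; simp)
  exact this.1

end Generation

section Reduced

variable {σ K : Type*} [Field K]

theorem sub_C_eval_mem_span (q : σ → K) (f : MvPolynomial σ K) :
    f - C (eval q f) ∈ Ideal.span (Set.range fun j => X j - C (q j)) := by
  induction f using MvPolynomial.induction_on with
  | C a => simp
  | add f g hf hg =>
    have : f + g - C (eval q (f + g)) = (f - C (eval q f)) + (g - C (eval q g)) := by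
      simp only [map_add]; ring
    rw [this]
    exact Ideal.add_mem _ hf hg
  | mul_X f i hf =>
    have : f * X i - C (eval q (f * X i)) =
        C (q i) * (f - C (eval q f)) + f * (X i - C (q i)) := by
      simp only [map_mul, eval_X]; ring
    rw [this]
    exact Ideal.add_mem _ (Ideal.mul_mem_left _ _ hf)
      (Ideal.mul_mem_left _ _ (Ideal.subset_span ⟨i, rfl⟩))

theorem vanishingIdeal_singleton_eq_span (q : σ → K) :
    vanishingIdeal K {q} = Ideal.span (Set.range fun j => X j - C (q j)) := by
  refine le_antisymm (fun f hf => ?_) ?_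
  · have hf' : eval q f = 0 := by simpa using hf
    simpa [hf'] using sub_C_eval_mem_span q f
  · rw [Ideal.span_le]
    rintro _ ⟨j, rfl⟩
    simp

variable [Fintype σ]

theorem mkDerivation_eq_sum_pderiv (g : σ → MvPolynomial σ K) (f : MvPolynomial σ K) :
    mkDerivation K g f = ∑ j, g j * pderiv j f := by
  classical
  induction f using MvPolynomial.induction_on with
  | C a => simp [derivation_C]
  | add f h hf hh => simp only [map_add, hf, hh, mul_add, Finset.sum_add_distrib]
  | mul_X f i hf =>
    simp only [Derivation.leibniz, mkDerivation_X, hf, smul_eq_mul, pderiv_X, mul_add,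
      Finset.sum_add_distrib, Pi.single_apply, mul_ite, mul_one, mul_zero, Finset.mul_sum]
    congr 1
    · simp [mul_comm]
    · exact Finset.sum_congr rfl fun j _ => by ring

theorem sub_linear_part_mem_sq (q : σ → K) (f : MvPolynomial σ K) :
    f - C (eval q f) - ∑ j, C (eval q (pderiv j f)) * (X j - C (q j)) ∈
      Ideal.span (Set.range fun j => X j - C (q j)) ^ 2 := by
  classical
  induction f using MvPolynomial.induction_on with
  | C a => simp
  | add f g hf hg =>
    have := Ideal.add_mem _ hf hg
    convert this using 1
    simp only [map_add, add_mul, Finset.sum_add_distrib]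
    ring
  | mul_X f i hf =>
    have h : f * X i - C (eval q (f * X i)) -
        ∑ j, C (eval q (pderiv j (f * X i))) * (X j - C (q j)) =
        C (q i) * (f - C (eval q f) - ∑ j, C (eval q (pderiv j f)) * (X j - C (q j))) +
        (f - C (eval q f)) * (X i - C (q i)) := by
      have h1 : ∑ j, C (eval q (pderiv j (f * X i))) * (X j - C (q j)) =
          C (q i) * ∑ j, C (eval q (pderiv j f)) * (X j - C (q j)) +
            C (eval q f) * (X i - C (q i)) := by
        have h2 : ∀ j, C (eval q (pderiv j (f * X i))) * (X j - C (q j)) =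
            C (q i) * (C (eval q (pderiv j f)) * (X j - C (q j))) +
            if i = j then C (eval q f) * (X j - C (q j)) else 0 := by
          intro j
          rw [pderiv_mul, pderiv_X]
          by_cases hij : i = j
          · subst hij
            simp only [Pi.single_eq_same, map_add, map_mul, eval_X, mul_one, if_true]
            ring
          · simp only [Pi.single_eq_of_ne' (Ne.symm hij), hij, map_mul, eval_X, mul_zero, add_zero,
              if_false]
            ring
        simp only [h2, Finset.sum_add_distrib, Finset.mul_sum, Finset.sum_ite_eq,
          Finset.mem_univ, if_true]
      rw [h1]
      simp only [map_mul, eval_X]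
      ring
    rw [h]
    refine Ideal.add_mem _ (Ideal.mul_mem_left _ _ hf) ?_
    rw [sq]
    exact Ideal.mul_mem_mul (sub_C_eval_mem_span q f) (Ideal.subset_span ⟨i, rfl⟩)

theorem span_X_sub_C_le_sup_sq {P : σ → MvPolynomial σ K} {q w : σ → K}
    (hq : ∀ i, eval q (P i) = w i)
    (hJ : ∀ ξ : σ → K, (∀ i, eval q (mkDerivation K (fun j => C (ξ j)) (P i)) = 0) → ξ = 0) :
    Ideal.span (Set.range fun j => X j - C (q j)) ≤
      Ideal.span (Set.range fun i => P i - C (w i)) ⊔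
        Ideal.span (Set.range fun j => X j - C (q j)) ^ 2 := by
  classical
  set I := Ideal.span (Set.range fun i => P i - C (w i))
  set m := Ideal.span (Set.range fun j => (X j - C (q j) : MvPolynomial σ K))
  let A : Matrix σ σ K := Matrix.of fun i j => eval q (pderiv j (P i))
  have hA : IsUnit A := by
    rw [← Matrix.mulVec_injective_iff_isUnit]
    have : Function.Injective A.mulVecLin := by
      rw [← LinearMap.ker_eq_bot, LinearMap.ker_eq_bot']
      intro ξ hξ
      refine hJ ξ fun i => ?_
      rw [mkDerivation_eq_sum_pderiv]
      simpa [Matrix.mulVec, dotProduct, A, mul_comm] using congrFun hξ i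
    exact this
  obtain ⟨B, hB⟩ := hA.exists_left_inv
  have hL : ∀ i, ∑ l, C (A i l) * (X l - C (q l)) ∈ I ⊔ m ^ 2 := by
    intro i
    have h1 := Ideal.mem_sup_right (S := I) (sub_linear_part_mem_sq q (P i))
    have h2 : P i - C (w i) ∈ I ⊔ m ^ 2 := Ideal.mem_sup_left (Ideal.subset_span ⟨i, rfl⟩)
    have h3 := Ideal.sub_mem _ h2 h1
    rw [hq i, sub_sub_cancel] at h3
    exact h3
  rw [Ideal.span_le]
  rintro _ ⟨j, rfl⟩
  have hj : (X j - C (q j) : MvPolynomial σ K) =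
      ∑ i, C (B j i) * ∑ l, C (A i l) * (X l - C (q l)) := by
    simp only [Finset.mul_sum]
    rw [Finset.sum_comm]
    have : ∀ l, ∑ i, C (B j i) * (C (A i l) * (X l - C (q l))) =
        C ((B * A) j l) * (X l - C (q l)) := by
      intro l
      rw [Matrix.mul_apply, map_sum, Finset.sum_mul]
      simp only [map_mul, mul_assoc]
    simp [this, hB, Matrix.one_apply]
  change X j - C (q j) ∈ I ⊔ m ^ 2
  rw [hj]
  exact Ideal.sum_mem _ fun i _ => Ideal.mul_mem_left _ _ (hL i)

theorem mem_span_of_forall_eval_eq_zero [IsAlgClosed K] {P : σ → MvPolynomial σ K} {w : σ → K}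
    (hJ : ∀ z : σ → K, (∀ i, eval z (P i) = w i) → ∀ ξ : σ → K,
      (∀ i, eval z (mkDerivation K (fun j => C (ξ j)) (P i)) = 0) → ξ = 0)
    {f : MvPolynomial σ K} (hf : ∀ z : σ → K, (∀ i, eval z (P i) = w i) → eval z f = 0) :
    f ∈ Ideal.span (Set.range fun i => P i - C (w i)) := by
  classical
  set I := Ideal.span (Set.range fun i => P i - C (w i)) with hI
  let J : Ideal (MvPolynomial σ K) := Submodule.comap (LinearMap.mulRight _ f) I
  have hJmem : ∀ g, g ∈ J ↔ g * f ∈ I := fun g => Iff.rfl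
  by_contra hfI
  have hJtop : J ≠ ⊤ := by
    rw [Ideal.ne_top_iff_one, hJmem, one_mul]
    exact hfI
  obtain ⟨M, hM, hJM⟩ := Ideal.exists_le_maximal J hJtop
  obtain ⟨q, rfl⟩ := isMaximal_iff_eq_vanishingIdeal_singleton.mp hM
  have hq : ∀ i, eval q (P i) = w i := by
    intro i
    have : P i - C (w i) ∈ J := I.mul_mem_right f (Ideal.subset_span ⟨i, rfl⟩)
    simpa [sub_eq_zero] using hJM this
  have hfq : f ∈ vanishingIdeal K {q} := by simpa using hf q hq
  have hle := span_X_sub_C_le_sup_sq hq (hJ q hq)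
  rw [← vanishingIdeal_singleton_eq_span, sq] at hle
  obtain ⟨r, hr, hrle⟩ := Submodule.exists_sub_one_mem_and_smul_le_of_fg_of_le_sup
    (N := I) ((isNoetherianRing_iff_ideal_fg _).mp inferInstance (vanishingIdeal K {q}))
    le_rfl hle
  have hrJ : r ∈ J := by
    rw [hJmem]
    exact hrle (Submodule.smul_mem_pointwise_smul f r _ hfq)
  have h1 := Ideal.sub_mem _ (hJM hrJ) hr
  rw [sub_sub_cancel] at h1
  exact hM.ne_top ((Ideal.eq_top_iff_one _).mpr h1)

end Reduced

section Bezout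

variable {σ : Type*} [Fintype σ] {n : ℕ} {P : σ → MvPolynomial σ ℂ} {w : σ → ℂ}

theorem monomialCount_mul_le_card_mul (hn : 0 < n) (hP : ∀ i, (P i).IsHomogeneous n)
    (hzero : ∀ z : σ → ℂ, (∀ i, eval z (P i) = 0) → z = 0)
    (hJ : ∀ z : σ → ℂ, (∀ i, eval z (P i) = w i) → ∀ ξ : σ → ℂ,
      (∀ i, eval z (mkDerivation ℂ (fun j => C (ξ j)) (P i)) = 0) → ξ = 0)
    {S : Finset (σ → ℂ)} (hS : ∀ z, z ∈ S ↔ ∀ i, eval z (P i) = w i) :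
    ∃ c, ∀ T, monomialCount σ (n * T) ≤ S.card * monomialCount σ (T + c) := by
  classical
  obtain ⟨e, he1, he0⟩ := exists_interpolation S
  set φ : MvPolynomial σ ℂ →ₐ[ℂ] MvPolynomial σ ℂ := aeval P with hφ
  have hmap : (Ideal.span (Set.range fun i => (X i - C (w i) : MvPolynomial σ ℂ))).map
      φ.toRingHom = Ideal.span (Set.range fun i => P i - C (w i)) := by
    rw [Ideal.map_span, ← Set.range_comp]
    congr 2
    funext i
    simp [hφ]
  obtain ⟨d, hd, hdS⟩ := (finite_aeval_of_isHomogeneous hn hP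
    hzero).exists_sub_one_mem_of_forall_exists_sum_mem_map
    (I := Ideal.span (Set.range fun i => (X i - C (w i) : MvPolynomial σ ℂ)))
    (fun p : S => e p) (fun f => by
      refine ⟨fun p => C (eval p f), ?_⟩
      rw [hmap]
      refine mem_span_of_forall_eval_eq_zero hJ fun z hz => ?_
      have hzS := (hS z).mpr hz
      rw [map_sub, map_sum, Finset.sum_eq_single ⟨z, hzS⟩]
      · simp [he1]
      · intro p _ hp
        rw [map_mul, he0 p z hzS fun h => hp (Subtype.ext h.symm), mul_zero]
      · simp)
  have hd0 : d ≠ 0 := by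
    rintro rfl
    rw [← vanishingIdeal_singleton_eq_span] at hd
    simp at hd
  have hφd : φ d ≠ 0 := by
    rw [Ne, map_eq_zero_iff φ (aeval_injective_of_isHomogeneous hn hP hzero)]
    exact hd0
  obtain ⟨c, hc⟩ := exists_mem_span_of_isHomogeneous hn hP hzero
  choose a ha using fun β : {β : σ →₀ ℕ // β.degree ≤ c} => hdS (monomial β.1 1)
  have := Fintype.ofFinite {β : σ →₀ ℕ // β.degree ≤ c}
  let c' := Finset.univ.sup fun β => Finset.univ.sup fun p => (a β p).totalDegree
  have hc' : ∀ β p, (a β p).totalDegree ≤ c' := fun β p =>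
    (Finset.le_sup (f := fun p => (a β p).totalDegree) (Finset.mem_univ p)).trans
      (Finset.le_sup (f := fun β => Finset.univ.sup fun p => (a β p).totalDegree)
        (Finset.mem_univ β))
  refine ⟨c', fun T => ?_⟩
  let Ψ : (S → restrictTotalDegree σ ℂ (T + c')) →ₗ[ℂ] MvPolynomial σ ℂ :=
    ∑ p : S, (LinearMap.mulRight ℂ (e p)) ∘ₗ φ.toLinearMap ∘ₗ
      (restrictTotalDegree σ ℂ (T + c')).subtype ∘ₗ LinearMap.proj p
  have hΨ : ∀ a, Ψ a = ∑ p : S, φ (a p : MvPolynomial σ ℂ) * e p := fun a => by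
    simp [Ψ, LinearMap.sum_apply]
  let μ : restrictTotalDegree σ ℂ (n * T) →ₗ[ℂ] MvPolynomial σ ℂ :=
    LinearMap.mulLeft ℂ (φ d) ∘ₗ (restrictTotalDegree σ ℂ (n * T)).subtype
  have hμ : ∀ f, μ f ∈ LinearMap.range Ψ := by
    rintro ⟨f, hf⟩
    change φ d * f ∈ LinearMap.range Ψ
    have hf' := hc _ f ((mem_restrictTotalDegree _ _ _).mp hf)
    clear hf
    induction hf' using Submodule.span_induction with
    | zero => simp
    | add x y _ _ hx hy =>
      rw [mul_add]
      exact Submodule.add_mem _ hx hy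
    | smul r x _ hx =>
      rw [mul_smul_comm]
      exact Submodule.smul_mem _ _ hx
    | mem x hx =>
      obtain ⟨b, β, hβ, hb, rfl⟩ := hx
      refine ⟨fun p => ⟨b * a ⟨β, hβ⟩ p, ?_⟩, ?_⟩
      · rw [mem_restrictTotalDegree]
        exact (totalDegree_mul _ _).trans
          (add_le_add (Nat.le_of_mul_le_mul_left hb hn) (hc' _ _))
      · rw [hΨ]
        have := ha ⟨β, hβ⟩
        change φ d * monomial β 1 = ∑ p, φ (a ⟨β, hβ⟩ p) * e p at this
        rw [mul_left_comm, this, Finset.mul_sum]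
        simp only [map_mul, mul_assoc]
        rfl
  have hinj : Function.Injective (μ.codRestrict _ hμ) := by
    intro f g hfg
    have h1 : φ d * f.1 = φ d * g.1 := congrArg Subtype.val hfg
    exact Subtype.ext (mul_left_cancel₀ hφd h1)
  have h1 := LinearMap.finrank_le_finrank_of_injective hinj
  have h2 := h1.trans (LinearMap.finrank_range_le Ψ)
  simpa [Module.finrank_pi_fintype, finrank_restrictTotalDegree] using h2

/-- **Bézout's theorem** for a reduced fibre: `k` forms of degree `n` in `k` variables with no
common zero but the origin take a value `w`, all of whose preimages are nondegenerate, exactly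
`n ^ k` times. -/
theorem ncard_fiber_eq_pow (hn : 0 < n) (hP : ∀ i, (P i).IsHomogeneous n)
    (hzero : ∀ z : σ → ℂ, (∀ i, eval z (P i) = 0) → z = 0)
    (hJ : ∀ z : σ → ℂ, (∀ i, eval z (P i) = w i) → ∀ ξ : σ → ℂ,
      (∀ i, eval z (mkDerivation ℂ (fun j => C (ξ j)) (P i)) = 0) → ξ = 0) :
    {z : σ → ℂ | ∀ i, eval z (P i) = w i}.ncard = n ^ Fintype.card σ := by
  classical
  set Z := {z : σ → ℂ | ∀ i, eval z (P i) = w i} with hZ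
  have hub : ∀ S : Finset (σ → ℂ), (S : Set (σ → ℂ)) ⊆ Z → S.card ≤ n ^ Fintype.card σ := by
    intro S hS
    obtain ⟨c, hc⟩ := card_mul_monomialCount_le (fun i => (hP i).totalDegree_le)
      (S := S) (w := w) (fun z hz => hS hz) (fun z hz => hJ z (hS hz))
    refine le_of_mul_monomialCount_le σ (c := c) fun T => (hc T).trans ?_
    refine le_trans (monomialCount_mono σ ?_) (monomialCount_mul_le σ hn (T + c))
    rw [mul_add]
    exact Nat.add_le_add_left (Nat.le_mul_of_pos_left c hn) _
  have hfin : Z.Finite := by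
    by_contra hinf
    obtain ⟨S, hS, hcard⟩ := Set.Infinite.exists_subset_card_eq hinf (n ^ Fintype.card σ + 1)
    have := hub S hS
    omega
  rw [Set.ncard_eq_toFinset_card Z hfin]
  refine le_antisymm (hub _ (by simp)) ?_
  obtain ⟨c, hc⟩ := monomialCount_mul_le_card_mul hn hP hzero hJ (S := hfin.toFinset) (by simp [hZ])
  refine le_of_mul_monomialCount_le σ (c := Fintype.card σ + c) fun T => ?_
  refine (pow_mul_monomialCount_le σ hn T).trans ((hc _).trans (le_of_eq ?_))
  rw [add_assoc]

end Bezout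

end MvPolynomial

namespace Polynomial

theorem eq_of_derivative_eq_of_eval_eq_s2 {p q : ℂ[X]} (hd : derivative p = derivative q) {a : ℂ}
    (ha : p.eval a = q.eval a) : p = q := by
  have h : derivative (p - q) = 0 := by simp [hd]
  obtain ⟨c, hc⟩ := natDegree_eq_zero.1 (derivative_eq_zero.1 h)
  have : c = 0 := by
    have := congrArg (eval a) hc
    simpa [ha] using this
  rw [this, map_zero] at hc
  exact sub_eq_zero.1 hc.symm

theorem eq_of_isRoot_of_derivative_roots {p : ℂ[X]} (hp : p.natDegree ≠ 0)
    (h : ∀ x, (derivative p).eval x = 0 → p.eval x = 0) {x y : ℂ} (hx : p.eval x = 0)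
    (hy : p.eval y = 0) : x = y := by
  have hp0 : p ≠ 0 := by rintro rfl; simp at hp
  have hd0 : derivative p ≠ 0 := fun h0 => hp (derivative_eq_zero.1 h0)
  have h1 : ∑ t ∈ p.roots.toFinset, p.roots.count t = p.natDegree := by
    rw [Multiset.toFinset_sum_count_eq]
    exact (IsAlgClosed.card_roots_eq_natDegree (p := p))
  have hsub : (derivative p).roots.toFinset ⊆ p.roots.toFinset := by
    intro t ht
    simp only [Multiset.mem_toFinset, mem_roots hd0, mem_roots hp0, IsRoot.def] at ht ⊢
    exact h t ht
  have h2 : ∑ t ∈ p.roots.toFinset, (derivative p).roots.count t = (derivative p).natDegree := by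
    rw [← IsAlgClosed.card_roots_eq_natDegree (p := derivative p),
      ← Multiset.toFinset_sum_count_eq]
    refine (Finset.sum_subset hsub fun t _ ht => ?_).symm
    exact Multiset.count_eq_zero.2 fun h' => ht (Multiset.mem_toFinset.2 h')
  have h3 : ∑ t ∈ p.roots.toFinset, ((derivative p).roots.count t + 1) = p.natDegree := by
    rw [← h1]
    refine Finset.sum_congr rfl fun t ht => ?_
    have ht' : t ∈ p.roots := Multiset.mem_toFinset.1 ht
    rw [count_roots, derivative_rootMultiplicity_of_root (isRoot_of_mem_roots ht'), ← count_roots]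
    have := Multiset.count_pos.2 ht'
    omega
  rw [Finset.sum_add_distrib, h2, natDegree_derivative, Finset.sum_const, smul_eq_mul,
    mul_one] at h3
  have h4 : p.roots.toFinset.card ≤ 1 := by omega
  refine Finset.card_le_one.1 h4 x ?_ y ?_ <;>
    simpa [mem_roots hp0]

theorem eq_C_leadingCoeff_mul_prod_of_card_eq_natDegree {ι : Type*} [Fintype ι] {p : ℂ[X]}
    (hp : p ≠ 0) (hdeg : p.natDegree = Fintype.card ι) {ρ : ι → ℂ} (hρ : Function.Injective ρ)
    (hroot : ∀ i, p.eval (ρ i) = 0) : p = C p.leadingCoeff * ∏ i, (X - C (ρ i)) := by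
  have hdvd : ∏ i, (X - C (ρ i)) ∣ p :=
    Finset.prod_dvd_of_coprime
      (fun i _ j _ hij => isCoprime_X_sub_C_of_isUnit_sub
        (IsUnit.mk0 _ (sub_ne_zero.2 fun h => hij (hρ h))))
      fun i _ => dvd_iff_isRoot.2 (hroot i)
  have hmonic : (∏ i, (X - C (ρ i))).Monic := monic_prod_of_monic _ _ fun _ _ => monic_X_sub_C _
  have hnd : (∏ i, (X - C (ρ i))).natDegree = Fintype.card ι := by
    rw [natDegree_prod_of_monic _ _ fun _ _ => monic_X_sub_C _]
    simp
  obtain ⟨g, hg⟩ := hdvd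
  have hg0 : g ≠ 0 := by rintro rfl; exact hp (by rw [hg, mul_zero])
  have hgd : g.natDegree = 0 := by
    have := hmonic.natDegree_mul' hg0
    rw [← hg, hdeg, hnd] at this
    omega
  obtain ⟨c, rfl⟩ := natDegree_eq_zero.1 hgd
  have : p.leadingCoeff = c := by
    rw [hg, leadingCoeff_mul, hmonic.leadingCoeff, one_mul, leadingCoeff_C]
  rw [this, mul_comm]
  exact hg

variable {σ : Type*} [Fintype σ]

/-- The polynomial of degree `Fintype.card σ + 2` vanishing at `0` whose derivative is
`X * ∏ i, (X + C (z i))`. -/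
noncomputable def ofNegCriticalPoints (z : σ → ℂ) : ℂ[X] :=
  ∑ j ∈ Finset.range (Fintype.card σ + 1),
    C (((j : ℂ) + 2)⁻¹ * (∏ i, (X + C (z i))).coeff j) * X ^ (j + 2)

theorem natDegree_prod_X_add_C {R : Type*} [CommRing R] [Nontrivial R] (z : σ → R) :
    (∏ i, (X + C (z i))).natDegree = Fintype.card σ := by
  rw [natDegree_prod_of_monic _ _ fun _ _ => monic_X_add_C _]
  simp

theorem monic_prod_X_add_C {R : Type*} [CommRing R] (z : σ → R) : (∏ i, (X + C (z i))).Monic :=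
  monic_prod_of_monic _ _ fun _ _ => monic_X_add_C _

theorem coeff_prod_X_add_C_card {R : Type*} [CommRing R] [Nontrivial R] (z : σ → R) :
    (∏ i, (X + C (z i))).coeff (Fintype.card σ) = 1 := by
  have := (monic_prod_X_add_C z).coeff_natDegree
  rwa [natDegree_prod_X_add_C] at this

theorem derivative_ofNegCriticalPoints (z : σ → ℂ) :
    derivative (ofNegCriticalPoints z) = X * ∏ i, (X + C (z i)) := by
  conv_rhs => rw [as_sum_range_C_mul_X_pow (∏ i, (X + C (z i))), natDegree_prod_X_add_C,
    Finset.mul_sum]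
  rw [ofNegCriticalPoints, derivative_sum]
  refine Finset.sum_congr rfl fun j _ => ?_
  have hj : ((j : ℂ) + 2) ≠ 0 := by exact_mod_cast (by omega : j + 2 ≠ 0)
  rw [derivative_C_mul_X_pow]
  have : ((j : ℂ) + 2)⁻¹ * (∏ i, (X + C (z i))).coeff j * ((j + 2 : ℕ) : ℂ) =
      (∏ i, (X + C (z i))).coeff j := by
    push_cast
    field_simp
  rw [this, Nat.add_sub_assoc (by norm_num)]
  ring

@[simp]
theorem eval_zero_ofNegCriticalPoints (z : σ → ℂ) : (ofNegCriticalPoints z).eval 0 = 0 := by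
  simp [ofNegCriticalPoints, eval_finsetSum]

theorem eval_derivative_ofNegCriticalPoints_eq_zero (z : σ → ℂ) (x : ℂ) :
    (derivative (ofNegCriticalPoints z)).eval x = 0 ↔ x = 0 ∨ ∃ i, x = -z i := by
  rw [derivative_ofNegCriticalPoints]
  simp [eval_prod, Finset.prod_eq_zero_iff, add_eq_zero_iff_eq_neg]

theorem natDegree_ofNegCriticalPoints (z : σ → ℂ) :
    (ofNegCriticalPoints z).natDegree = Fintype.card σ + 2 := by
  have h : (derivative (ofNegCriticalPoints z)).natDegree = Fintype.card σ + 1 := by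
    rw [derivative_ofNegCriticalPoints, natDegree_X_mul (monic_prod_X_add_C z).ne_zero,
      natDegree_prod_X_add_C]
  rw [natDegree_derivative] at h
  omega

theorem coeff_ofNegCriticalPoints (z : σ → ℂ) :
    (ofNegCriticalPoints z).coeff (Fintype.card σ + 2) = ((Fintype.card σ : ℂ) + 2)⁻¹ := by
  rw [ofNegCriticalPoints, finsetSum_coeff, Finset.sum_eq_single (Fintype.card σ)]
  · simp [coeff_prod_X_add_C_card]
  · intro j _ hj
    rw [coeff_C_mul, coeff_X_pow, if_neg (by omega), mul_zero]
  · simp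

theorem ofNegCriticalPoints_smul_comp {a : ℂ} (ha : a ^ (Fintype.card σ + 2) = 1) (z : σ → ℂ) :
    (ofNegCriticalPoints (a • z)).comp (C a * X) = ofNegCriticalPoints z := by
  refine eq_of_derivative_eq_of_eval_eq_s2 (a := 0) ?_ (by simp)
  rw [derivative_comp, derivative_ofNegCriticalPoints, derivative_ofNegCriticalPoints]
  have h : ∀ i, (X + C ((a • z) i)).comp (C a * X) = C a * (X + C (z i)) := fun i => by
    simp [mul_add]
  simp only [mul_comp, X_comp, prod_comp, h, Finset.prod_mul_distrib, Finset.prod_const,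
    Finset.card_univ, derivative_C_mul, derivative_X, mul_one]
  have ha' : (C a : ℂ[X]) ^ (Fintype.card σ + 2) = 1 := by rw [← C_pow, ha, C_1]
  linear_combination X * (∏ i, (X + C (z i))) * ha'

end Polynomial

namespace MvPolynomial

theorem isHomogeneous_esymm (σ R : Type*) [Fintype σ] [CommSemiring R] (m : ℕ) :
    (esymm σ R m).IsHomogeneous m := by
  refine IsHomogeneous.sum _ _ _ fun t ht => ?_
  have := IsHomogeneous.prod t (fun i => (X i : MvPolynomial σ R)) (fun _ => 1)
    fun i _ => isHomogeneous_X R i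
  simpa [(Finset.mem_powersetCard.1 ht).2] using this

variable {σ : Type*} [Fintype σ]

/-- The value at `-z c` of `Polynomial.ofNegCriticalPoints z`, as a polynomial in `z`. -/
noncomputable def criticalValueForm (c : σ) : MvPolynomial σ ℂ :=
  ∑ j ∈ Finset.range (Fintype.card σ + 1),
    C ((j : ℂ) + 2)⁻¹ *
      (∏ i : σ, (Polynomial.X + Polynomial.C (X i : MvPolynomial σ ℂ))).coeff j *
        (-X c) ^ (j + 2)

theorem isHomogeneous_criticalValueForm (c : σ) :
    (criticalValueForm c).IsHomogeneous (Fintype.card σ + 2) := by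
  refine IsHomogeneous.sum _ _ _ fun j hj => ?_
  have hj' : j ≤ Fintype.card σ := by simpa [Nat.lt_succ_iff] using hj
  rw [prod_X_add_C_coeff ℂ σ j hj']
  have h := ((isHomogeneous_C σ ((j : ℂ) + 2)⁻¹).mul
    (isHomogeneous_esymm σ ℂ (Fintype.card σ - j))).mul ((isHomogeneous_X ℂ c).neg.pow (j + 2))
  convert h using 1
  omega

theorem eval_coeff_prod_X_add_C (z : σ → ℂ) (j : ℕ) :
    eval z ((∏ i : σ, (Polynomial.X + Polynomial.C (X i : MvPolynomial σ ℂ))).coeff j) =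
      (∏ i, (Polynomial.X + Polynomial.C (z i))).coeff j := by
  rw [← Polynomial.coeff_map, Polynomial.map_prod]
  simp

theorem eval_criticalValueForm (z : σ → ℂ) (c : σ) :
    eval z (criticalValueForm c) = (Polynomial.ofNegCriticalPoints z).eval (-z c) := by
  simp [criticalValueForm, Polynomial.ofNegCriticalPoints, Polynomial.eval_finsetSum,
    eval_coeff_prod_X_add_C]

theorem eq_zero_of_eval_criticalValueForm_eq_zero {z : σ → ℂ}
    (hz : ∀ c, eval z (criticalValueForm c) = 0) : z = 0 := by
  simp only [eval_criticalValueForm] at hz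
  funext c
  have := Polynomial.eq_of_isRoot_of_derivative_roots (p := Polynomial.ofNegCriticalPoints z)
    (by rw [Polynomial.natDegree_ofNegCriticalPoints]; omega) (fun x hx => ?_) (hz c)
    (Polynomial.eval_zero_ofNegCriticalPoints z)
  · simpa using this
  · rcases (Polynomial.eval_derivative_ofNegCriticalPoints_eq_zero z x).1 hx with rfl | ⟨i, rfl⟩
    · simp
    · exact hz i

theorem eval_mkDerivation_criticalValueForm (z ξ : σ → ℂ) (c : σ) :
    eval z (mkDerivation ℂ (fun j => C (ξ j)) (criticalValueForm c)) =
      z c ^ 2 * ∑ j ∈ Finset.range (Fintype.card σ),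
        ((j : ℂ) + 2)⁻¹ * eval z (mkDerivation ℂ (fun j => C (ξ j))
          ((∏ i : σ, (Polynomial.X + Polynomial.C (X i : MvPolynomial σ ℂ))).coeff j)) *
            (-z c) ^ j := by
  set D : Derivation ℂ (MvPolynomial σ ℂ) (MvPolynomial σ ℂ) :=
    mkDerivation ℂ (fun j => C (ξ j)) with hD
  set Q : Polynomial (MvPolynomial σ ℂ) :=
    ∏ i : σ, (Polynomial.X + Polynomial.C (X i : MvPolynomial σ ℂ)) with hQ
  have hterm : ∀ j : ℕ, eval z (D (C ((j : ℂ) + 2)⁻¹ * Q.coeff j * (-X c) ^ (j + 2))) =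
      z c ^ 2 * (((j : ℂ) + 2)⁻¹ * eval z (D (Q.coeff j)) * (-z c) ^ j) -
        ξ c * (-z c * (eval z (Q.coeff j) * (-z c) ^ j)) := by
    intro j
    have hj : ((j : ℂ) + 2) ≠ 0 := by exact_mod_cast (by omega : j + 2 ≠ 0)
    rw [Derivation.leibniz, Derivation.leibniz, Derivation.leibniz_pow, map_neg, hD,
      mkDerivation_X, derivation_C, ← hD]
    simp only [smul_eq_mul, map_add, map_mul, eval_C, map_pow, map_neg, eval_X, nsmul_eq_mul,
      map_natCast, map_ofNat, mul_zero, add_zero, Nat.cast_add, Nat.cast_ofNat,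
      show j + 2 - 1 = j + 1 from rfl]
    field_simp
    ring
  have hsum : ∑ j ∈ Finset.range (Fintype.card σ + 1), eval z (Q.coeff j) * (-z c) ^ j = 0 := by
    have h1 : (∏ i, (Polynomial.X + Polynomial.C (z i))).eval (-z c) = 0 := by
      rw [Polynomial.eval_prod]
      exact Finset.prod_eq_zero (Finset.mem_univ c) (by simp)
    rw [Polynomial.eval_eq_sum_range, Polynomial.natDegree_prod_X_add_C] at h1
    simpa only [hQ, eval_coeff_prod_X_add_C] using h1
  rw [criticalValueForm, map_sum, map_sum, Finset.sum_congr rfl fun j _ => hterm j,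
    Finset.sum_sub_distrib, ← Finset.mul_sum, ← Finset.mul_sum, ← Finset.mul_sum, hsum, mul_zero,
    mul_zero, sub_zero, Finset.sum_range_succ, hQ, Polynomial.coeff_prod_X_add_C_card,
    Derivation.map_one_eq_zero]
  simp

theorem eq_zero_of_eval_mkDerivation_coeff_eq_zero {z ξ : σ → ℂ} (hz : Function.Injective z)
    (h : ∀ j < Fintype.card σ, eval z (mkDerivation ℂ (fun j => C (ξ j))
      ((∏ i : σ, (Polynomial.X + Polynomial.C (X i : MvPolynomial σ ℂ))).coeff j)) = 0) :
    ξ = 0 := by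
  classical
  set D : Derivation ℂ (MvPolynomial σ ℂ) (MvPolynomial σ ℂ) :=
    mkDerivation ℂ (fun j => C (ξ j)) with hD
  set Q : Polynomial (MvPolynomial σ ℂ) :=
    ∏ i : σ, (Polynomial.X + Polynomial.C (X i : MvPolynomial σ ℂ)) with hQ
  funext c
  have h1 : eval z (D (Q.eval (C (-z c)))) = 0 := by
    rw [Polynomial.eval_eq_sum_range, map_sum, map_sum, hQ, Polynomial.natDegree_prod_X_add_C,
      ← hQ]
    refine Finset.sum_eq_zero fun j hj => ?_
    have hDj : eval z (D (Q.coeff j)) = 0 := by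
      rcases (Nat.lt_succ_iff.1 (Finset.mem_range.1 hj)).lt_or_eq with hj | rfl
      · exact h j hj
      · rw [hQ, Polynomial.coeff_prod_X_add_C_card, Derivation.map_one_eq_zero, map_zero]
    rw [Derivation.leibniz, ← C_pow, hD, derivation_C, ← hD]
    simp [hDj]
  rw [hQ, Polynomial.eval_prod, ← Finset.mul_prod_erase _ _ (Finset.mem_univ c),
    Derivation.leibniz] at h1
  simp only [Polynomial.eval_add, Polynomial.eval_X, Polynomial.eval_C, smul_eq_mul, map_add,
    map_mul, eval_C, eval_X, neg_add_cancel, zero_mul, zero_add, hD, derivation_C,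
    mkDerivation_X, map_prod, mul_eq_zero] at h1
  refine h1.resolve_left (Finset.prod_ne_zero_iff.2 fun i hi h0 => ?_)
  exact Finset.ne_of_mem_erase hi (hz (by linear_combination h0))

theorem eq_zero_of_eval_mkDerivation_criticalValueForm_eq_zero {z ξ : σ → ℂ}
    (hz : Function.Injective z) (hz0 : ∀ c, z c ≠ 0)
    (h : ∀ c, eval z (mkDerivation ℂ (fun j => C (ξ j)) (criticalValueForm c)) = 0) : ξ = 0 := by
  refine eq_zero_of_eval_mkDerivation_coeff_eq_zero hz fun j hj => ?_
  set e : ℕ → ℂ := fun j => ((j : ℂ) + 2)⁻¹ * eval z (mkDerivation ℂ (fun j => C (ξ j))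
    ((∏ i : σ, (Polynomial.X + Polynomial.C (X i : MvPolynomial σ ℂ))).coeff j)) with he
  have hH : ∑ j ∈ Finset.range (Fintype.card σ), Polynomial.C (e j) * Polynomial.X ^ j = 0 := by
    refine Polynomial.eq_zero_of_degree_lt_of_eval_index_eq_zero (s := Finset.univ)
      (v := fun c => -z c) (fun a _ b _ hab => hz (neg_injective hab)) ?_ fun c _ => ?_
    · rw [← Polynomial.mem_degreeLT]
      refine Submodule.sum_mem _ fun j hj => Polynomial.mem_degreeLT.2 ?_
      refine (Polynomial.degree_C_mul_X_pow_le _ _).trans_lt ?_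
      exact_mod_cast Finset.mem_range.1 hj
    · have := h c
      rw [eval_mkDerivation_criticalValueForm, mul_eq_zero] at this
      simpa [Polynomial.eval_finsetSum, he] using
        this.resolve_left (pow_ne_zero 2 (hz0 c))
  have hj0 : e j = 0 := by
    have := congrArg (fun p => Polynomial.coeff p j) hH
    simpa [Polynomial.finsetSum_coeff, Polynomial.coeff_X_pow, hj] using this
  refine (mul_eq_zero.1 hj0).resolve_left (inv_ne_zero ?_)
  exact_mod_cast (by omega : j + 2 ≠ 0)

end MvPolynomial

namespace Polynomial

variable {σ : Type*} [Fintype σ]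

/-- For distinct nonzero `w c`, the number of normalized polynomials with
critical value `w c` at the critical point `-z c`. -/
theorem ncard_setOf_eval_ofNegCriticalPoints {w : σ → ℂ} (hw : Function.Injective w)
    (hw0 : ∀ c, w c ≠ 0) :
    {z : σ → ℂ | ∀ c, (ofNegCriticalPoints z).eval (-z c) = w c}.ncard =
      (Fintype.card σ + 2) ^ Fintype.card σ := by
  simp only [← MvPolynomial.eval_criticalValueForm]
  refine MvPolynomial.ncard_fiber_eq_pow (by omega) MvPolynomial.isHomogeneous_criticalValueForm
    (fun z hz => MvPolynomial.eq_zero_of_eval_criticalValueForm_eq_zero hz) fun z hz ξ hξ => ?_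
  simp only [MvPolynomial.eval_criticalValueForm] at hz
  refine MvPolynomial.eq_zero_of_eval_mkDerivation_criticalValueForm_eq_zero (fun c d hcd => ?_)
    (fun c hc => ?_) hξ
  · exact hw (by rw [← hz, ← hz, hcd])
  · exact hw0 c (by rw [← hz, hc, neg_zero, eval_zero_ofNegCriticalPoints])

end Polynomial

theorem CPolyEquiv.refl (f : Polynomial ℂ) : CPolyEquiv f f :=
  ⟨1, 0, one_ne_zero, by simp⟩

theorem CPolyEquiv.symm {f g : Polynomial ℂ} (h : CPolyEquiv f g) : CPolyEquiv g f := by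
  obtain ⟨a, b, ha, rfl⟩ := h
  refine ⟨a⁻¹, -(a⁻¹ * b), inv_ne_zero ha, ?_⟩
  have : (Polynomial.C a * Polynomial.X + Polynomial.C b).comp
      (Polynomial.C a⁻¹ * Polynomial.X + Polynomial.C (-(a⁻¹ * b))) = Polynomial.X := by
    simp only [Polynomial.add_comp, Polynomial.mul_comp, Polynomial.C_comp, Polynomial.X_comp,
      mul_add, ← mul_assoc, ← Polynomial.C_mul, mul_neg, mul_inv_cancel₀ ha, one_mul,
      Polynomial.C_1, Polynomial.C_neg]
    ring
  rw [Polynomial.comp_assoc, this, Polynomial.comp_X]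

theorem CPolyEquiv.trans {f g h : Polynomial ℂ} (hfg : CPolyEquiv f g) (hgh : CPolyEquiv g h) :
    CPolyEquiv f h := by
  obtain ⟨a, b, ha, rfl⟩ := hfg
  obtain ⟨a', b', ha', rfl⟩ := hgh
  refine ⟨a' * a, a' * b + b', mul_ne_zero ha' ha, ?_⟩
  rw [Polynomial.comp_assoc]
  congr 1
  simp only [Polynomial.add_comp, Polynomial.mul_comp, Polynomial.C_comp, Polynomial.X_comp,
    Polynomial.C_mul, Polynomial.C_add]
  ring

theorem cPolyEquiv_add_C_iff {f g : Polynomial ℂ} (c : ℂ) :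
    CPolyEquiv (f + Polynomial.C c) (g + Polynomial.C c) ↔ CPolyEquiv f g := by
  simp [CPolyEquiv]

namespace Polynomial

variable {σ : Type*} [Fintype σ]

theorem critVals_ofNegCriticalPoints_add_C {z w : σ → ℂ}
    (hz : ∀ c, (ofNegCriticalPoints z).eval (-z c) = w c) (c₀ : ℂ) :
    critVals (ofNegCriticalPoints z + C c₀) = insert c₀ (Set.range fun c => w c + c₀) := by
  ext x
  simp only [critVals, derivative_add, derivative_C, add_zero,
    eval_derivative_ofNegCriticalPoints_eq_zero, Set.mem_ofPred_eq, Set.mem_insert_iff,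
    Set.mem_range, eval_add, eval_C]
  constructor
  · rintro ⟨y, rfl | ⟨i, rfl⟩, rfl⟩
    · simp
    · exact Or.inr ⟨i, by rw [hz]⟩
  · rintro (rfl | ⟨i, rfl⟩)
    · exact ⟨0, Or.inl rfl, by simp⟩
    · exact ⟨-z i, Or.inr ⟨i, rfl⟩, by rw [hz]⟩

theorem eval_ofNegCriticalPoints_smul {z w : σ → ℂ}
    (hz : ∀ c, (ofNegCriticalPoints z).eval (-z c) = w c) {a : ℂ}
    (ha : a ^ (Fintype.card σ + 2) = 1) (c : σ) :
    (ofNegCriticalPoints (a • z)).eval (-(a • z) c) = w c := by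
  rw [← hz, ← ofNegCriticalPoints_smul_comp ha z, eval_comp]
  simp

theorem cPolyEquiv_ofNegCriticalPoints_iff {z z' w : σ → ℂ} (hw : Function.Injective w)
    (hw0 : ∀ c, w c ≠ 0) (hz : ∀ c, (ofNegCriticalPoints z).eval (-z c) = w c)
    (hz' : ∀ c, (ofNegCriticalPoints z').eval (-z' c) = w c) :
    CPolyEquiv (ofNegCriticalPoints z) (ofNegCriticalPoints z') ↔
      ∃ a : ℂ, a ^ (Fintype.card σ + 2) = 1 ∧ z' = a • z := by
  constructor
  · rintro ⟨a, b, ha, h⟩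
    have hcrit : ∀ x, (derivative (ofNegCriticalPoints z)).eval x = 0 →
        (derivative (ofNegCriticalPoints z')).eval (a * x + b) = 0 := by
      intro x hx
      rw [h, derivative_comp] at hx
      simpa [ha] using hx
    have hval : ∀ x, (ofNegCriticalPoints z').eval (a * x + b) =
        (ofNegCriticalPoints z).eval x := by
      intro x
      rw [h, eval_comp]
      simp
    have hb : b = 0 := by
      have h1 := hcrit 0 ((eval_derivative_ofNegCriticalPoints_eq_zero z 0).2 (Or.inl rfl))
      have h2 := hval 0
      rw [mul_zero, zero_add] at h1 h2
      rcases (eval_derivative_ofNegCriticalPoints_eq_zero z' b).1 h1 with hb | ⟨i, rfl⟩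
      · exact hb
      · rw [hz', eval_zero_ofNegCriticalPoints] at h2
        exact absurd h2 (hw0 i)
    subst hb
    refine ⟨a, ?_, ?_⟩
    · have h1 := congrArg (fun p => p.coeff (Fintype.card σ + 2)) h
      simp only [map_zero, add_zero, comp_C_mul_X_coeff, coeff_ofNegCriticalPoints] at h1
      have h2 : ((Fintype.card σ : ℂ) + 2)⁻¹ ≠ 0 := by
        refine inv_ne_zero ?_
        exact_mod_cast (by omega : Fintype.card σ + 2 ≠ 0)
      exact (mul_eq_left₀ h2).1 h1.symm
    · funext c
      have h1 := hcrit (-z c)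
        ((eval_derivative_ofNegCriticalPoints_eq_zero z _).2 (Or.inr ⟨c, rfl⟩))
      have h2 := hval (-z c)
      rw [hz] at h2
      rcases (eval_derivative_ofNegCriticalPoints_eq_zero z' _).1 h1 with h3 | ⟨i, h3⟩
      · rw [h3, eval_zero_ofNegCriticalPoints] at h2
        exact absurd h2.symm (hw0 c)
      · rw [h3, hz'] at h2
        rw [hw h2] at h3
        rw [Pi.smul_apply, smul_eq_mul]
        linear_combination h3
  · rintro ⟨a, ha, rfl⟩
    refine ⟨a, 0, ?_, by rw [map_zero, add_zero, ofNegCriticalPoints_smul_comp ha z]⟩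
    rintro rfl
    simp at ha

theorem exists_cPolyEquiv_ofNegCriticalPoints {w : σ → ℂ} (hw : Function.Injective w)
    (hw0 : ∀ c, w c ≠ 0) {c₀ : ℂ} {f : ℂ[X]} (hf : f.natDegree = Fintype.card σ + 2)
    (hcrit : critVals f = insert c₀ (Set.range fun c => w c + c₀)) :
    ∃ z : σ → ℂ, (∀ c, (ofNegCriticalPoints z).eval (-z c) = w c) ∧
      CPolyEquiv (ofNegCriticalPoints z + C c₀) f := by
  have h0 : c₀ ∈ critVals f := hcrit ▸ Set.mem_insert _ _
  have h1 : ∀ c, w c + c₀ ∈ critVals f := fun c =>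
    hcrit ▸ Set.mem_insert_of_mem _ ⟨c, rfl⟩
  obtain ⟨r₀, hr₀, hfr₀⟩ := h0
  choose r hr hfr using h1
  have hdeg : (derivative f).natDegree = Fintype.card (Option σ) := by
    rw [natDegree_derivative, hf, Fintype.card_option]
    omega
  have hd0 : derivative f ≠ 0 := by
    intro h
    rw [h, natDegree_zero, Fintype.card_option] at hdeg
    omega
  let ρ : Option σ → ℂ := fun o => o.elim r₀ r
  have hρ : Function.Injective ρ := by
    rintro (_ | c) (_ | d) hcd
    · rfl
    · have := congrArg f.eval hcd
      simp only [ρ, Option.elim, hfr₀, hfr] at this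
      exact absurd (by linear_combination -this) (hw0 d)
    · have := congrArg f.eval hcd
      simp only [ρ, Option.elim, hfr₀, hfr] at this
      exact absurd (by linear_combination this) (hw0 c)
    · have := congrArg f.eval hcd
      simp only [ρ, Option.elim, hfr] at this
      rw [hw (add_right_cancel this)]
  have hfac := eq_C_leadingCoeff_mul_prod_of_card_eq_natDegree hd0 hdeg hρ
    (by rintro (_ | c); exacts [hr₀, hr c])
  set u := (derivative f).leadingCoeff
  have hu : u ≠ 0 := leadingCoeff_ne_zero.2 hd0
  obtain ⟨a, ha⟩ := IsAlgClosed.exists_pow_nat_eq u⁻¹ (n := Fintype.card σ + 2) (by omega)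
  have ha0 : a ≠ 0 := by
    rintro rfl
    exact inv_ne_zero hu (by rw [← ha, zero_pow (by omega)])
  have hz : ofNegCriticalPoints (fun c => (r₀ - r c) / a) + C c₀ =
      f.comp (C a * X + C r₀) := by
    refine eq_of_derivative_eq_of_eval_eq_s2 (a := 0) ?_ (by simp [hfr₀, eval_comp])
    rw [derivative_add, derivative_C, add_zero, derivative_ofNegCriticalPoints, derivative_comp,
      hfac, Fintype.prod_option]
    have h : ∀ i, (X - C (r i)).comp (C a * X + C r₀) = C a * (X + C ((r₀ - r i) / a)) := by
      intro i
      rw [mul_add, ← C_mul, mul_div_cancel₀ _ ha0]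
      simp only [sub_comp, X_comp, C_comp, C_sub]
      ring
    simp only [ρ, Option.elim, mul_comp, C_comp, prod_comp, h, Finset.prod_mul_distrib,
      Finset.prod_const, Finset.card_univ, sub_comp, X_comp, derivative_add, derivative_C,
      derivative_C_mul, derivative_X, mul_one, add_zero]
    have ha' : (C a : ℂ[X]) ^ (Fintype.card σ + 2) * C u = 1 := by
      rw [← C_pow, ha, ← C_mul, inv_mul_cancel₀ hu, C_1]
    linear_combination -X * (∏ i, (X + C ((r₀ - r i) / a))) * ha'
  refine ⟨fun c => (r₀ - r c) / a, fun c => ?_, a, r₀, ha0, hz⟩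
  have h2 := congrArg (eval (-((r₀ - r c) / a))) hz
  rw [eval_add, eval_C, eval_comp] at h2
  have h3 : (C a * X + C r₀).eval (-((r₀ - r c) / a)) = r c := by
    simp only [eval_add, eval_mul, eval_C, eval_X]
    field_simp
    ring
  rw [h3, hfr] at h2
  exact add_right_cancel h2

end Polynomial

theorem Nat.card_mul_card_eq_of_surjective_of_free {G Z Q : Type*} (act : G → Z → Z) (φ : Z → Q)
    (hφ : Function.Surjective φ) (hfib : ∀ z z', φ z = φ z' ↔ ∃ g, z' = act g z)
    (hfree : ∀ z g g', act g z = act g' z → g = g') :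
    Nat.card Q * Nat.card G = Nat.card Z := by
  choose s hs using hφ
  rw [← Nat.card_prod]
  refine Nat.card_congr (Equiv.ofBijective (fun x : Q × G => act x.2 (s x.1)) ⟨?_, ?_⟩)
  · rintro ⟨q, g⟩ ⟨q', g'⟩ h
    have h1 : ∀ q g, φ (act g (s q)) = q := fun q g => by
      rw [← (hfib (s q) _).2 ⟨g, rfl⟩, hs]
    have hq : q = q' := by rw [← h1 q g, ← h1 q' g']; exact congrArg φ h
    subst hq
    exact congrArg (Prod.mk q) (hfree _ _ _ h)
  · intro z
    obtain ⟨g, hg⟩ := (hfib (s (φ z)) z).1 (hs _)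
    exact ⟨(φ z, g), hg.symm⟩

/-- For `n ≥ 3` and a set `C` of `n − 1` distinct complex numbers, the number of
equivalence classes of complex degree-`n` polynomials whose set of critical values
equals `C` is `n^(n−3)`. -/
theorem count_complex_polynomials_with_given_critical_values
    (n : ℕ) (hn : 3 ≤ n) (C : Set ℂ) (hC : C.ncard = n - 1) :
    Nat.card (Quot fun f g : {f : Polynomial ℂ //
        f.natDegree = n ∧ critVals f = C} => CPolyEquiv f.1 g.1) = n ^ (n - 3) := by
  classical
  have hfin : C.Finite := Set.finite_of_ncard_pos (by omega)
  obtain ⟨c₀, hc₀⟩ : C.Nonempty := (Set.ncard_pos hfin).1 (by omega)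
  let S : Set ℂ := C \ {c₀}
  have : Fintype S := (hfin.subset Set.sdiff_subset).fintype
  have hcard : Fintype.card S + 2 = n := by
    rw [← Nat.card_eq_fintype_card, Nat.card_coe_set_eq, Set.ncard_sdiff_singleton_of_mem hc₀, hC]
    omega
  let w : S → ℂ := fun c => c - c₀
  have hw : Function.Injective w := fun c d h => Subtype.ext (sub_left_injective h)
  have hw0 : ∀ c, w c ≠ 0 := fun c => sub_ne_zero.2 c.2.2
  have hrange : insert c₀ (Set.range fun c => w c + c₀) = C := by
    have : (Set.range fun c => w c + c₀) = S := by simp [w]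
    rw [this, Set.insert_sdiff_singleton, Set.insert_eq_of_mem hc₀]
  let Z : Set (S → ℂ) :=
    {z | ∀ c, (Polynomial.ofNegCriticalPoints z).eval (-z c) = w c}
  have hZ : Nat.card Z = n ^ (n - 2) := by
    rw [Nat.card_coe_set_eq, Polynomial.ncard_setOf_eval_ofNegCriticalPoints hw hw0, hcard]
    congr 1
    omega
  let G : Set ℂ := {a | a ^ n = 1}
  have hG : Nat.card G = n := by
    have : G = (Polynomial.nthRootsFinset n (1 : ℂ) : Set ℂ) := by
      ext a
      simp [G, Polynomial.mem_nthRootsFinset (show 0 < n by omega)]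
    rw [Nat.card_coe_set_eq, this, Set.ncard_coe_finset]
    exact (Complex.isPrimitiveRoot_exp n (by omega)).card_nthRootsFinset
  let r := fun f g : {f : Polynomial ℂ // f.natDegree = n ∧ critVals f = C} => CPolyEquiv f.1 g.1
  have hr : Equivalence r := ⟨fun f => .refl f.1, fun h => h.symm, fun h h' => h.trans h'⟩
  let φ : Z → Quot r := fun z => Quot.mk r ⟨Polynomial.ofNegCriticalPoints z.1 + Polynomial.C c₀,
    by rw [Polynomial.natDegree_add_C, Polynomial.natDegree_ofNegCriticalPoints, hcard],
    by rw [Polynomial.critVals_ofNegCriticalPoints_add_C z.2, hrange]⟩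
  let act : G → Z → Z := fun a z => ⟨a.1 • z.1,
    Polynomial.eval_ofNegCriticalPoints_smul z.2 (by rw [hcard]; exact a.2)⟩
  have hcount : Nat.card (Quot r) * Nat.card G = Nat.card Z := by
    refine Nat.card_mul_card_eq_of_surjective_of_free act φ ?_ ?_ ?_
    · rintro ⟨f, hf, hfC⟩
      obtain ⟨z, hz, hzf⟩ := Polynomial.exists_cPolyEquiv_ofNegCriticalPoints hw hw0
        (hf.trans hcard.symm) (hfC.trans hrange.symm)
      exact ⟨⟨z, hz⟩, Quot.sound hzf⟩
    · intro z z'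
      rw [hr.quot_mk_eq_iff]
      refine (cPolyEquiv_add_C_iff c₀).trans
        ((Polynomial.cPolyEquiv_ofNegCriticalPoints_iff hw hw0 z.2 z'.2).trans ?_)
      rw [hcard]
      exact ⟨fun ⟨a, ha, h⟩ => ⟨⟨a, ha⟩, Subtype.ext h⟩,
        fun ⟨a, h⟩ => ⟨a.1, a.2, congrArg Subtype.val h⟩⟩
    · intro z a a' h
      have : Nonempty S := Fintype.card_pos_iff.1 (by omega)
      obtain ⟨c⟩ := this
      have hzc : z.1 c ≠ 0 := fun h0 => hw0 c (by
        rw [← z.2 c, h0, neg_zero, Polynomial.eval_zero_ofNegCriticalPoints])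
      exact Subtype.ext (mul_right_cancel₀ hzc (congrFun (congrArg Subtype.val h) c))
  rw [hG, hZ, show n - 2 = n - 3 + 1 by omega, pow_succ] at hcount
  exact Nat.eq_of_mul_eq_mul_right (by omega) hcount
end

section
/- In the ring of formal power series with real coefficients, (Σ_{n≥0} A(4n+1) x^{4n+1}/(4n+1)!) · (φ₀(x)² − φ₁(x)φ₃(x)) = φ₀(x)φ₁(x) − φ₂(x)φ₃(x), where A(m) denotes the number of 2up-2down permutations of {1,…,m}. -/
/-- A permutation of `{1,…,m}` (encoded as `Fin m`, 0-indexed) is 2up-2down if (in 1-based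
positions) `σ(i) < σ(i+1)` exactly when `i ≡ 1, 2 (mod 4)`; with 0-based index `i`
this reads `σ(i) < σ(i+1) ↔ i % 4 < 2`. -/
def Is2Up2Down {m : ℕ} (σ : Equiv.Perm (Fin m)) : Prop :=
  ∀ i : ℕ, ∀ h : i + 1 < m, (σ ⟨i, by omega⟩ < σ ⟨i + 1, h⟩ ↔ i % 4 < 2)

/-- `A m` is the number of 2up-2down permutations of `{1,…,m}`. -/
noncomputable def numTwoUpTwoDown (m : ℕ) : ℕ :=
  Nat.card {σ : Equiv.Perm (Fin m) // Is2Up2Down σ}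

/-- The `j`-th Olivier function `φ_j(x) = Σ_{k≥0} x^{4k+j}/(4k+j)!` as a real formal
power series. -/
noncomputable def olivier (j : ℕ) : PowerSeries ℝ :=
  PowerSeries.mk fun n => if n % 4 = j then (1 : ℝ) / n.factorial else 0

/-- The number of 2up-2down permutations of `Fin (n + 1)` whose last value is `j`. -/
noncomputable def endingCount (n j : ℕ) : ℕ :=
  Nat.card {σ : Equiv.Perm (Fin (n + 1)) // Is2Up2Down σ ∧ (σ (Fin.last n) : ℕ) = j}

/-- Permutations with last value `j` correspond to permutations of one element fewer, by deleting
the last value and standardizing. -/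
def permLastEquiv {n : ℕ} (j : Fin (n + 1)) :
    {σ : Equiv.Perm (Fin (n + 1)) // σ (Fin.last n) = j} ≃ Equiv.Perm (Fin n) where
  toFun σ := (finSuccAboveEquiv (Fin.last n)).trans
    ((σ.1.subtypeEquiv fun a => (σ.1.injective.ne_iff' σ.2).symm).trans
      (finSuccAboveEquiv j).symm)
  invFun τ := ⟨(finSuccEquiv' (Fin.last n)).trans (τ.optionCongr.trans (finSuccEquiv' j).symm),
    by simp⟩
  left_inv σ := by
    ext i : 2
    refine Fin.lastCases ?_ (fun i => ?_) i
    · simp only [Equiv.trans_apply, finSuccEquiv'_at, Equiv.optionCongr_apply, Option.map_none,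
        finSuccEquiv'_symm_none, σ.2]
    · simp only [Equiv.trans_apply, finSuccEquiv'_last_apply_castSucc, Equiv.optionCongr_apply,
        Option.map_some, finSuccEquiv'_symm_some]
      refine (congrArg Subtype.val ((finSuccAboveEquiv j).apply_symm_apply _)).trans ?_
      simp [finSuccAboveEquiv_apply]
  right_inv τ := by
    ext i : 1
    simp [Equiv.symm_apply_eq, finSuccAboveEquiv_apply, finSuccEquiv'_last_apply_castSucc]

theorem succAbove_permLastEquiv {n : ℕ} (j : Fin (n + 1))
    (σ : {σ : Equiv.Perm (Fin (n + 1)) // σ (Fin.last n) = j}) (i : Fin n) :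
    j.succAbove (permLastEquiv j σ i) = σ.1 i.castSucc := by
  obtain ⟨τ, rfl⟩ := (permLastEquiv j).symm.surjective σ
  rw [Equiv.apply_symm_apply]
  simp [permLastEquiv, finSuccEquiv'_last_apply_castSucc]

theorem is2Up2Down_iff_permLastEquiv {n : ℕ} (j : Fin (n + 2))
    (σ : {σ : Equiv.Perm (Fin (n + 2)) // σ (Fin.last (n + 1)) = j}) :
    Is2Up2Down σ.1 ↔ Is2Up2Down (permLastEquiv j σ) ∧
      ((permLastEquiv j σ (Fin.last n) : ℕ) < j ↔ n % 4 < 2) := by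
  have hstep (i : ℕ) (h : i + 1 < n + 1) :
      σ.1 ⟨i, by omega⟩ < σ.1 ⟨i + 1, by omega⟩ ↔
        permLastEquiv j σ ⟨i, by omega⟩ < permLastEquiv j σ ⟨i + 1, h⟩ := by
    rw [← Fin.succAbove_lt_succAbove_iff (p := j), succAbove_permLastEquiv,
      succAbove_permLastEquiv]
    rfl
  have hlast : σ.1 ⟨n, by omega⟩ < σ.1 ⟨n + 1, by omega⟩ ↔
      (permLastEquiv j σ (Fin.last n) : ℕ) < j := by
    have h1 : σ.1 ⟨n + 1, by omega⟩ = j := σ.2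
    have h2 := succAbove_permLastEquiv j σ (Fin.last n)
    have h3 : σ.1 ⟨n, by omega⟩ = σ.1 (Fin.last n).castSucc := rfl
    rw [h1, h3, ← h2, Fin.succAbove_lt_iff_castSucc_lt]
    rfl
  constructor
  · intro h
    exact ⟨fun i hi => (hstep i hi).symm.trans (h i (by omega)),
      hlast.symm.trans (h n (by omega))⟩
  · rintro ⟨h, h'⟩ i hi
    rcases Nat.lt_or_ge i n with hin | hin
    · exact (hstep i (by omega)).trans (h i (by omega))
    · obtain rfl : i = n := by omega
      exact hlast.trans h'

theorem card_is2Up2Down_and_last (n : ℕ) (Q : ℕ → Prop) [DecidablePred Q] :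
    Nat.card {σ : Equiv.Perm (Fin (n + 1)) // Is2Up2Down σ ∧ Q (σ (Fin.last n))} =
      ∑ k ∈ Finset.range (n + 1), if Q k then endingCount n k else 0 := by
  classical
  simp only [endingCount, Nat.card_eq_fintype_card, Fintype.card_subtype]
  rw [Finset.card_eq_sum_card_fiberwise (t := Finset.range (n + 1))
    (f := fun σ : Equiv.Perm (Fin (n + 1)) => (σ (Fin.last n) : ℕ))
    (fun σ _ => by simpa using Nat.lt_succ_iff.1 (σ (Fin.last n)).isLt)]
  refine Finset.sum_congr rfl fun k _ => ?_
  rw [Finset.filter_filter]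
  split_ifs with h
  · congr 1
    ext σ
    simp only [Finset.mem_filter, Finset.mem_univ, true_and]
    constructor
    · rintro ⟨⟨h1, _⟩, h3⟩
      exact ⟨h1, h3⟩
    · rintro ⟨h1, rfl⟩
      exact ⟨⟨h1, h⟩, rfl⟩
  · rw [Finset.card_eq_zero, Finset.filter_eq_empty_iff]
    rintro σ - ⟨⟨_, h2⟩, rfl⟩
    exact h h2

theorem endingCount_succ (n j : ℕ) (hj : j < n + 2) :
    endingCount (n + 1) j =
      ∑ k ∈ Finset.range (n + 1), if (k < j ↔ n % 4 < 2) then endingCount n k else 0 := by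
  rw [← card_is2Up2Down_and_last n fun k => (k < j ↔ n % 4 < 2)]
  let J : Fin (n + 2) := ⟨j, hj⟩
  refine Nat.card_congr ?_
  refine (Equiv.subtypeEquivRight fun σ => ?_).trans
    ((Equiv.subtypeSubtypeEquivSubtypeInter
      (fun σ : Equiv.Perm (Fin (n + 2)) => σ (Fin.last (n + 1)) = J) Is2Up2Down).symm.trans
    ((permLastEquiv J).subtypeEquiv fun σ => is2Up2Down_iff_permLastEquiv J σ))
  rw [and_comm, Fin.ext_iff]

theorem endingCount_zero_zero : endingCount 0 0 = 1 := by
  have : Unique {σ : Equiv.Perm (Fin (0 + 1)) //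
      Is2Up2Down σ ∧ (σ (Fin.last 0) : ℕ) = 0} :=
    { default := ⟨1, fun i h => by omega, by simp⟩
      uniq := fun σ => Subtype.ext (Equiv.ext fun _ => Subsingleton.elim (α := Fin 1) _ _) }
  exact Nat.card_unique

theorem endingCount_succ_zero {n : ℕ} (hn : n % 4 < 2) : endingCount (n + 1) 0 = 0 := by
  rw [endingCount_succ n 0 (by omega)]
  exact Finset.sum_eq_zero fun k _ => if_neg (by simp [hn])

theorem endingCount_succ_self {n : ℕ} (hn : 2 ≤ n % 4) : endingCount (n + 1) (n + 1) = 0 := by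
  rw [endingCount_succ n (n + 1) (by omega)]
  refine Finset.sum_eq_zero fun k hk => if_neg ?_
  rw [Finset.mem_range] at hk
  omega

theorem numTwoUpTwoDown_succ {n : ℕ} (hn : n % 4 < 2) :
    numTwoUpTwoDown (n + 1) = endingCount (n + 1) (n + 1) := by
  have h := card_is2Up2Down_and_last n fun _ => True
  simp only [and_true, if_true] at h
  rw [numTwoUpTwoDown, h, endingCount_succ n (n + 1) (by omega)]
  refine Finset.sum_congr rfl fun k hk => (if_pos ?_).symm
  rw [Finset.mem_range] at hk
  omega

/-- `endingCount`, signed by the parity of the number of descents in the prescribed word. -/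
noncomputable def signedCount (n j : ℕ) : ℝ :=
  (if n % 4 = 3 then -1 else 1) * endingCount n j

theorem signedCount_succ_succ {n j : ℕ} (hj : j ≤ n) :
    signedCount (n + 1) (j + 1) = signedCount (n + 1) j + signedCount n j := by
  have key : (endingCount (n + 1) (j + 1) : ℝ) - endingCount (n + 1) j =
      (if n % 4 < 2 then 1 else -1) * endingCount n j := by
    rw [endingCount_succ n _ (by omega), endingCount_succ n _ (by omega)]
    push_cast
    rw [← Finset.sum_sub_distrib, Finset.sum_eq_single_of_mem j (by simp; omega)]
    · by_cases h : n % 4 < 2 <;> simp [h]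
    · intro k _ hk
      have : k < j + 1 ↔ k < j := by omega
      simp [this]
  have h4 : n % 4 < 4 := Nat.mod_lt _ (by norm_num)
  unfold signedCount
  rcases (by omega : n % 4 = 0 ∨ n % 4 = 1 ∨ n % 4 = 2 ∨ n % 4 = 3) with h | h | h | h <;>
    simp only [Nat.add_mod n 1 4, h] at key ⊢ <;> norm_num at key ⊢ <;> linarith

/-- Newton's forward difference formula. -/
theorem signedCount_eq_sum (n j : ℕ) (hj : j ≤ n) :
    signedCount n j = ∑ p ∈ Finset.HasAntidiagonal.antidiagonal j,
      (j.choose p.1 : ℝ) * signedCount (n - p.1) 0 := by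
  induction j generalizing n with
  | zero => simp
  | succ j ih =>
    obtain ⟨n, rfl⟩ : ∃ m, n = m + 1 := ⟨n - 1, by omega⟩
    rw [signedCount_succ_succ (by omega), ih _ (by omega), ih _ (by omega),
      Finset.sum_antidiagonal_choose_succ_mul (fun a _ => signedCount (n + 1 - a) 0)]
    simp only [Nat.add_sub_add_right]
    congr 1
    refine Finset.sum_congr rfl fun p hp => ?_
    rw [Nat.choose_symm_of_eq_add (Finset.HasAntidiagonal.mem_antidiagonal.1 hp).symm]

theorem signedCount_self_div_factorial (n : ℕ) :
    signedCount n n / n.factorial = ∑ p ∈ Finset.HasAntidiagonal.antidiagonal n,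
      signedCount p.1 0 / p.1.factorial * (1 / p.2.factorial) := by
  rw [signedCount_eq_sum n n le_rfl, Finset.sum_div,
    ← Finset.Nat.sum_antidiagonal_swap]
  refine Finset.sum_congr rfl fun p hp => ?_
  obtain rfl : p.1 + p.2 = n := Finset.HasAntidiagonal.mem_antidiagonal.1 hp
  have h : ((p.1 + p.2).choose p.2 : ℝ) * p.1.factorial * p.2.factorial =
      (p.1 + p.2).factorial := by
    rw [mul_right_comm]
    have := Nat.choose_mul_factorial_mul_factorial (Nat.le_add_left p.2 p.1)
    rw [Nat.add_sub_cancel] at this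
    exact_mod_cast this
  rw [← h]
  simp only [Prod.fst_swap, Nat.add_sub_cancel]
  have : ((p.1 + p.2).choose p.2 : ℝ) ≠ 0 :=
    Nat.cast_ne_zero.2 (Nat.choose_pos (Nat.le_add_left _ _)).ne'
  field_simp

/-- The part of the exponential generating function of `signedCount · 0` supported on exponents
congruent to `r` modulo `4`. -/
noncomputable def signedSeries (r : ℕ) : PowerSeries ℝ :=
  PowerSeries.mk fun n => if n % 4 = r then signedCount n 0 / n.factorial else 0

theorem mk_signedCount_self {r : ℕ} (hr : r < 4) :
    (PowerSeries.mk fun n => if n % 4 = r then signedCount n n / n.factorial else 0) =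
      signedSeries 0 * olivier r + signedSeries 3 * olivier ((r + 1) % 4) := by
  ext n
  rw [map_add, PowerSeries.coeff_mul, PowerSeries.coeff_mul, ← Finset.sum_add_distrib,
    PowerSeries.coeff_mk, signedCount_self_div_factorial]
  have hzero (a : ℕ) (ha : a % 4 = 1 ∨ a % 4 = 2) : signedCount a 0 = 0 := by
    obtain ⟨m, rfl⟩ : ∃ m, a = m + 1 := ⟨a - 1, by omega⟩
    simp [signedCount, endingCount_succ_zero (n := m) (by omega)]
  trans ∑ p ∈ Finset.HasAntidiagonal.antidiagonal n,
      if n % 4 = r then signedCount p.1 0 / p.1.factorial * (1 / p.2.factorial) else 0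
  · split_ifs <;> simp
  refine Finset.sum_congr rfl fun p hp => ?_
  obtain rfl : p.1 + p.2 = n := Finset.HasAntidiagonal.mem_antidiagonal.1 hp
  simp only [signedSeries, olivier, PowerSeries.coeff_mk]
  rcases (by omega : p.1 % 4 = 0 ∨ p.1 % 4 = 3 ∨ p.1 % 4 = 1 ∨ p.1 % 4 = 2) with h | h | h
  · have : (p.1 + p.2) % 4 = r ↔ p.2 % 4 = r := by omega
    simp [h, this]
  · have : (p.1 + p.2) % 4 = r ↔ p.2 % 4 = (r + 1) % 4 := by omega
    simp [h, this]
  · simp [hzero _ h]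

/-- `(Σ_{n≥0} A(4n+1) x^{4n+1}/(4n+1)!) · (φ₀² − φ₁φ₃) = φ₀φ₁ − φ₂φ₃`. -/
theorem genfun_2up2down_length_4n1 :
    (PowerSeries.mk fun n =>
        if n % 4 = 1 then (numTwoUpTwoDown n : ℝ) / n.factorial else 0) *
      (olivier 0 ^ 2 - olivier 1 * olivier 3) =
    olivier 0 * olivier 1 - olivier 2 * olivier 3 := by
  have h0 := mk_signedCount_self (r := 0) (by norm_num)
  have h1 := mk_signedCount_self (r := 1) (by norm_num)
  have h3 := mk_signedCount_self (r := 3) (by norm_num)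
  norm_num at h0 h1 h3
  have e0 : (PowerSeries.mk fun n => if n % 4 = 0 then signedCount n n / n.factorial else 0) =
      1 := by
    ext n
    rw [PowerSeries.coeff_mk, PowerSeries.coeff_one]
    rcases n with _ | n
    · simp [signedCount, endingCount_zero_zero]
    · rw [if_neg n.succ_ne_zero]
      split_ifs with h
      · simp [signedCount, endingCount_succ_self (n := n) (by omega)]
      · rfl
  have e3 : (PowerSeries.mk fun n => if n % 4 = 3 then signedCount n n / n.factorial else 0) =
      0 := by
    ext n
    rw [PowerSeries.coeff_mk, map_zero]
    split_ifs with h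
    · obtain ⟨n, rfl⟩ : ∃ m, n = m + 1 := ⟨n - 1, by omega⟩
      simp [signedCount, endingCount_succ_self (n := n) (by omega)]
    · rfl
  have e1 : (PowerSeries.mk fun n =>
      if n % 4 = 1 then (numTwoUpTwoDown n : ℝ) / n.factorial else 0) =
      PowerSeries.mk fun n => if n % 4 = 1 then signedCount n n / n.factorial else 0 := by
    ext n
    rw [PowerSeries.coeff_mk, PowerSeries.coeff_mk]
    split_ifs with h
    · obtain ⟨n, rfl⟩ : ∃ m, n = m + 1 := ⟨n - 1, by omega⟩
      simp [signedCount, numTwoUpTwoDown_succ (n := n) (by omega), h]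
    · rfl
  rw [e0] at h0
  rw [e3] at h3
  rw [e1, h1]
  linear_combination (olivier 1 ^ 2 - olivier 0 * olivier 2) * h3 -
    (olivier 0 * olivier 1 - olivier 2 * olivier 3) * h0
end

section
/- In the ring of formal power series with real coefficients, (Σ_{n≥0} A(4n+3) x^{4n+3}/(4n+3)!) · (φ₀(x)² − φ₁(x)φ₃(x)) = φ₃(x), where A(m) denotes the number of 2up-2down permutations of {1,…,m}. -/
/-- `σ` has up-down pattern `W`: position `i` (0-based) is an ascent exactly when `W i`. -/
def HasPattern (W : ℕ → Prop) {m : ℕ} (σ : Equiv.Perm (Fin m)) : Prop :=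
  ∀ i : ℕ, ∀ h : i + 1 < m, (σ ⟨i, by omega⟩ < σ ⟨i + 1, h⟩ ↔ W i)

/-- `σ` has pattern `W` on its first `a` entries and increases on its remaining `b` entries. -/
def HasPatternThenIncreasing (W : ℕ → Prop) {a b : ℕ} (σ : Equiv.Perm (Fin (a + b))) : Prop :=
  (∀ i : ℕ, ∀ h : i + 1 < a, (σ ⟨i, by omega⟩ < σ ⟨i + 1, by omega⟩ ↔ W i)) ∧
    ∀ i : ℕ, ∀ h : i + 1 < b, σ ⟨a + i, by omega⟩ < σ ⟨a + (i + 1), by omega⟩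

/-- The permutation whose first `a` entries form the set `S`, ordered as in `τ`, and whose
remaining entries increase. -/
def shuffle {a b : ℕ} (p : {S : Finset (Fin (a + b)) // S.card = a} × Equiv.Perm (Fin a)) :
    Equiv.Perm (Fin (a + b)) :=
  finSumFinEquiv.symm.trans ((Equiv.sumCongr p.2 (Equiv.refl (Fin b))).trans
    (finSumEquivOfFinset p.1.2 (by simp [Finset.card_compl, p.1.2])))

lemma shuffle_castAdd {a b : ℕ}
    (p : {S : Finset (Fin (a + b)) // S.card = a} × Equiv.Perm (Fin a)) (i : Fin a) :
    shuffle p (Fin.castAdd b i) = p.1.1.orderEmbOfFin p.1.2 (p.2 i) := by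
  simp [shuffle]

lemma shuffle_natAdd {a b : ℕ}
    (p : {S : Finset (Fin (a + b)) // S.card = a} × Equiv.Perm (Fin a)) (i : Fin b) :
    shuffle p (Fin.natAdd a i) =
      (p.1.1)ᶜ.orderEmbOfFin (by simp [Finset.card_compl, p.1.2]) i := by
  simp [shuffle]

lemma shuffle_injective {a b : ℕ} : Function.Injective (shuffle (a := a) (b := b)) := by
  have image_eq (p : {S : Finset (Fin (a + b)) // S.card = a} × Equiv.Perm (Fin a)) :
      Set.range (fun i => shuffle p (Fin.castAdd b i)) = (p.1.1 : Set (Fin (a + b))) := by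
    simp only [shuffle_castAdd]
    rw [← Finset.range_orderEmbOfFin p.1.1 p.1.2]
    exact p.2.surjective.range_comp _
  rintro p q h
  have hS : p.1 = q.1 := by
    apply Subtype.ext
    rw [← Finset.coe_inj, ← image_eq, ← image_eq, h]
  obtain ⟨S, τ⟩ := p
  obtain ⟨S', τ'⟩ := q
  obtain rfl : S = S' := hS
  congr 1
  ext i : 1
  have := congrArg (fun σ => σ (Fin.castAdd b i)) h
  simpa [shuffle_castAdd] using this

lemma hasPatternThenIncreasing_shuffle {W : ℕ → Prop} {a b : ℕ}
    (p : {S : Finset (Fin (a + b)) // S.card = a} × Equiv.Perm (Fin a)) :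
    HasPatternThenIncreasing W (shuffle p) ↔ HasPattern W p.2 := by
  constructor
  · rintro ⟨h, -⟩ i hi
    rw [← h i hi]
    have h₁ := shuffle_castAdd p ⟨i, by omega⟩
    have h₂ := shuffle_castAdd p ⟨i + 1, hi⟩
    simp only [Fin.castAdd_mk] at h₁ h₂
    rw [h₁, h₂, OrderEmbedding.lt_iff_lt]
  · intro h
    refine ⟨fun i hi => ?_, fun i hi => ?_⟩
    · rw [← h i hi]
      have h₁ := shuffle_castAdd p ⟨i, by omega⟩
      have h₂ := shuffle_castAdd p ⟨i + 1, hi⟩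
      simp only [Fin.castAdd_mk] at h₁ h₂
      rw [h₁, h₂, OrderEmbedding.lt_iff_lt]
    · have h₁ := shuffle_natAdd p ⟨i, by omega⟩
      have h₂ := shuffle_natAdd p ⟨i + 1, hi⟩
      simp only [Fin.natAdd_mk] at h₁ h₂
      rw [h₁, h₂, OrderEmbedding.lt_iff_lt]
      simp

lemma exists_shuffle_eq {a b : ℕ} (σ : Equiv.Perm (Fin (a + b)))
    (hσ : ∀ i : ℕ, ∀ h : i + 1 < b, σ ⟨a + i, by omega⟩ < σ ⟨a + (i + 1), by omega⟩) :
    ∃ p, shuffle p = σ := by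
  let S : Finset (Fin (a + b)) :=
    Finset.univ.map ((Fin.castAddEmb b).trans σ.toEmbedding)
  have hS : S.card = a := by simp [S]
  have hSc : Sᶜ.card = b := by simp [Finset.card_compl, hS]
  let e := finSumEquivOfFinset hS hSc
  obtain ⟨⟨τ, ρ⟩, h⟩ := Equiv.Perm.mem_sumCongrHom_range_of_perm_mapsTo_inl
    (σ := (finSumFinEquiv.trans σ).trans e.symm) (by
      rintro _ ⟨i, rfl⟩
      have hi : σ (Fin.castAdd b i) ∈ S := by simp [S]
      rw [← Finset.mem_coe, ← Finset.range_orderEmbOfFin S hS] at hi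
      obtain ⟨j, hj⟩ := hi
      refine ⟨j, ?_⟩
      simp [e, Equiv.eq_symm_apply, hj])
  have key (x : Fin a ⊕ Fin b) : e (Equiv.sumCongr τ ρ x) = σ (finSumFinEquiv x) := by
    have := congrArg (fun π => e (π x)) h
    simpa using this
  have hρ : ρ = 1 := by
    have hmono : StrictMono ρ := by
      cases b with
      | zero => exact fun i => i.elim0
      | succ b =>
        rw [Fin.strictMono_iff_lt_succ]
        intro i
        have h₁ := key (Sum.inr i.castSucc)
        have h₂ := key (Sum.inr i.succ)
        have h₃ := hσ i (by omega)
        simp only [e, Equiv.sumCongr_apply, Sum.map_inr, finSumEquivOfFinset_inr,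
          finSumFinEquiv_apply_right] at h₁ h₂
        have h₄ : σ (Fin.natAdd a i.castSucc) < σ (Fin.natAdd a i.succ) := h₃
        rwa [← h₁, ← h₂, OrderEmbedding.lt_iff_lt] at h₄
    have hid := (StrictMono.range_inj hmono strictMono_id).1 (by simp)
    ext i : 1
    exact congrFun hid i
  refine ⟨(⟨S, hS⟩, τ), ?_⟩
  ext x : 1
  obtain ⟨y, rfl⟩ := finSumFinEquiv.surjective x
  rw [← key y, hρ]
  simp [shuffle, e, Equiv.Perm.one_def]

lemma card_hasPatternThenIncreasing (W : ℕ → Prop) (a b : ℕ) :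
    Nat.card {σ : Equiv.Perm (Fin (a + b)) // HasPatternThenIncreasing W σ} =
      (a + b).choose a * Nat.card {τ : Equiv.Perm (Fin a) // HasPattern W τ} := by
  have hcard : Nat.card {S : Finset (Fin (a + b)) // S.card = a} = (a + b).choose a := by
    rw [Nat.card_eq_fintype_card, Fintype.card_finset_len, Fintype.card_fin]
  rw [← hcard, ← Nat.card_prod]
  symm
  refine Nat.card_congr (Equiv.ofBijective
    (fun q => ⟨shuffle (q.1, q.2.1), (hasPatternThenIncreasing_shuffle _).2 q.2.2⟩) ⟨?_, ?_⟩)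
  · intro p q h
    have := shuffle_injective (congrArg Subtype.val h)
    simp only [Prod.mk.injEq] at this
    exact Prod.ext this.1 (Subtype.ext this.2)
  · rintro ⟨σ, hσ⟩
    obtain ⟨p, rfl⟩ := exists_shuffle_eq σ hσ.2
    exact ⟨(p.1, ⟨p.2, (hasPatternThenIncreasing_shuffle _).1 hσ⟩), rfl⟩

/-- The number of permutations of `n` letters that follow the 2up-2down pattern at positions
`< k` and have ascents at all later positions. -/
noncomputable def numTailIncreasing (n k : ℕ) : ℕ :=
  Nat.card {σ : Equiv.Perm (Fin n) // HasPattern (fun i => i % 4 < 2 ∨ k ≤ i) σ}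

lemma numTailIncreasing_succ (n k : ℕ) (hk : k % 4 < 2) :
    numTailIncreasing n (k + 1) = numTailIncreasing n k := by
  have : (fun i => i % 4 < 2 ∨ k + 1 ≤ i) = fun i => i % 4 < 2 ∨ k ≤ i := by
    funext i
    apply propext
    rcases eq_or_ne i k with rfl | h <;> omega
  rw [numTailIncreasing, numTailIncreasing, this]

lemma numTailIncreasing_eq_numTwoUpTwoDown (n k : ℕ) (hk : n ≤ k + 1) :
    numTailIncreasing n k = numTwoUpTwoDown n := by
  refine Nat.card_congr (Equiv.subtypeEquivRight fun σ => ?_)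
  refine forall_congr' fun i => forall_congr' fun h => ?_
  have : (i % 4 < 2 ∨ k ≤ i) ↔ i % 4 < 2 := by omega
  exact iff_congr Iff.rfl this

lemma numTailIncreasing_zero_right (n : ℕ) : numTailIncreasing n 0 = 1 := by
  have h := card_hasPatternThenIncreasing (fun _ => True) 0 n
  have h₀ : Nat.card {τ : Equiv.Perm (Fin 0) // HasPattern (fun _ => True) τ} = 1 := by
    have : Nonempty {τ : Equiv.Perm (Fin 0) // HasPattern (fun _ => True) τ} :=
      ⟨1, fun i hi => by omega⟩
    exact Nat.card_unique
  rw [h₀, Nat.choose_zero_right, mul_one] at h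
  rw [← h]
  have hn : n = 0 + n := by omega
  rw [numTailIncreasing]
  conv_lhs => rw [hn]
  refine Nat.card_congr (Equiv.subtypeEquivRight fun σ => ?_)
  simp only [HasPattern, HasPatternThenIncreasing, Nat.zero_le, or_true, iff_true]
  constructor
  · intro h
    refine ⟨fun i hi => by omega, fun i hi => ?_⟩
    exact h (0 + i) (by omega)
  · rintro ⟨-, h⟩ i hi
    convert h i (by omega) using 3 <;> simp

lemma choose_mul_numTwoUpTwoDown (n a : ℕ) (ha : 2 ≤ a % 4) (hn : a + 1 < n) :
    n.choose (a + 1) * numTwoUpTwoDown (a + 1) =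
      numTailIncreasing n a + numTailIncreasing n (a + 1) := by
  obtain ⟨b, rfl⟩ : ∃ b, n = a + 1 + (b + 1) := ⟨n - a - 2, by omega⟩
  have h := card_hasPatternThenIncreasing (fun i => i % 4 < 2) (a + 1) (b + 1)
  change _ = _ * numTwoUpTwoDown (a + 1) at h
  rw [← h, numTailIncreasing, numTailIncreasing]
  classical
  simp only [Nat.card_eq_fintype_card, Fintype.card_subtype]
  rw [← Finset.card_union_of_disjoint]
  · congr 1
    ext σ
    simp only [Finset.mem_filter, Finset.mem_univ, true_and, Finset.mem_union]
    constructor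
    · rintro ⟨h₁, h₂⟩
      have h₂' : ∀ i (hi : i + 1 < a + 1 + (b + 1)), a + 1 ≤ i →
          σ ⟨i, by omega⟩ < σ ⟨i + 1, hi⟩ := by
        intro i hi hai
        obtain ⟨j, rfl⟩ := Nat.exists_eq_add_of_le hai
        exact h₂ j (by omega)
      by_cases hJ : σ ⟨a, by omega⟩ < σ ⟨a + 1, by omega⟩
      · left
        intro i hi
        rcases lt_trichotomy i a with hlt | rfl | hgt
        · rw [h₁ i (by omega)]; omega
        · simp [hJ]
        · simp [h₂' i hi hgt, hgt.le]
      · right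
        intro i hi
        rcases lt_trichotomy i a with hlt | rfl | hgt
        · rw [h₁ i (by omega)]; omega
        · simp [hJ]; omega
        · simp [h₂' i hi hgt, Nat.succ_le_of_lt hgt]
    · rintro (h | h)
      all_goals
        refine ⟨fun i hi => ?_, fun i hi => ?_⟩
        · rw [h i (by omega)]; omega
        · exact (h (a + 1 + i) (by omega)).2 (by omega)
  · rw [Finset.disjoint_left]
    intro σ h₁ h₂
    simp only [Finset.mem_filter, Finset.mem_univ, true_and] at h₁ h₂
    have := (h₁ a (by omega)).symm.trans (h₂ a (by omega))
    omega

/-- The signs `+1` for residue `0`, `-1` for residue `3` modulo `4`. -/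
def twoUpTwoDownSign (a : ℕ) : ℤ := if a % 4 = 0 then 1 else if a % 4 = 3 then -1 else 0

lemma partial_sum_sign_choose (n K : ℕ) (hK : K < n) :
    ∑ a ∈ Finset.range (K + 1), twoUpTwoDownSign a * (n.choose a * numTwoUpTwoDown a : ℕ) =
      (if K % 4 = 3 then -1 else 1) * (numTailIncreasing n K : ℤ) := by
  induction K with
  | zero =>
    have := numTailIncreasing_eq_numTwoUpTwoDown 0 0 (by omega)
    simp [twoUpTwoDownSign, numTailIncreasing_zero_right, ← this]
  | succ K ih =>
    rw [Finset.sum_range_succ, ih (by omega)]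
    by_cases h : K % 4 < 2
    · rw [numTailIncreasing_succ n K h, twoUpTwoDownSign, if_neg (by omega), if_neg (by omega),
        if_neg (by omega), if_neg (by omega)]
      ring
    · rw [choose_mul_numTwoUpTwoDown n K (by omega) hK, twoUpTwoDownSign]
      obtain h | h : K % 4 = 2 ∨ K % 4 = 3 := by omega
      · rw [if_neg (by omega), if_neg (by omega), if_pos (by omega), if_pos (by omega)]
        push_cast; ring
      · rw [if_pos (by omega), if_pos (by omega), if_neg (by omega)]
        push_cast; ring

lemma sum_sign_choose_eq_zero (n : ℕ) (hn : n % 4 = 0 ∨ n % 4 = 3) (hpos : n ≠ 0) :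
    ∑ a ∈ Finset.range (n + 1), twoUpTwoDownSign a * (n.choose a * numTwoUpTwoDown a : ℕ) = 0 := by
  obtain ⟨K, rfl⟩ := Nat.exists_eq_succ_of_ne_zero hpos
  rw [Finset.sum_range_succ, Nat.succ_eq_add_one, partial_sum_sign_choose _ K (by omega),
    numTailIncreasing_eq_numTwoUpTwoDown _ K le_rfl, Nat.choose_self, one_mul, twoUpTwoDownSign]
  rcases hn with hn | hn
  · rw [if_pos (by omega), if_pos (by omega)]; ring
  · rw [if_neg (by omega), if_neg (by omega), if_pos (by omega)]; ring

lemma sum_antidiagonal_sign (n : ℕ) (hn : n % 4 = 0 ∨ n % 4 = 3) (hpos : n ≠ 0) :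
    ∑ p ∈ Finset.HasAntidiagonal.antidiagonal n,
      (twoUpTwoDownSign p.1 : ℝ) * (numTwoUpTwoDown p.1 / p.1.factorial) *
        (1 / p.2.factorial) = 0 := by
  have h := congrArg (fun z : ℤ => (z : ℝ) / n.factorial) (sum_sign_choose_eq_zero n hn hpos)
  simp only [Int.cast_zero, zero_div] at h
  rw [← h, Finset.Nat.sum_antidiagonal_eq_sum_range_succ_mk, Int.cast_sum, Finset.sum_div]
  refine Finset.sum_congr rfl fun a ha => ?_
  have ha : a ≤ n := by simpa [Nat.lt_succ_iff] using ha
  push_cast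
  rw [Nat.cast_choose ℝ ha]
  have h₁ := Nat.factorial_ne_zero n
  field_simp

/-- The exponential generating function of 2up-2down permutations of lengths `≡ j` modulo `4`. -/
noncomputable def twoUpTwoDownSeries (j : ℕ) : PowerSeries ℝ :=
  PowerSeries.mk fun n => if n % 4 = j then (numTwoUpTwoDown n : ℝ) / n.factorial else 0

lemma twoUpTwoDownSeries_zero_mul_olivier_three :
    twoUpTwoDownSeries 0 * olivier 3 = twoUpTwoDownSeries 3 * olivier 0 := by
  rw [← sub_eq_zero]
  ext n
  rw [map_sub, PowerSeries.coeff_mul, PowerSeries.coeff_mul, ← Finset.sum_sub_distrib, map_zero]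
  simp only [twoUpTwoDownSeries, olivier, PowerSeries.coeff_mk]
  by_cases hn : n % 4 = 3
  · refine Eq.trans ?_ (sum_antidiagonal_sign n (.inr hn) (by omega))
    refine Finset.sum_congr rfl fun p hp => ?_
    rw [Finset.HasAntidiagonal.mem_antidiagonal] at hp
    rw [twoUpTwoDownSign]
    split_ifs <;> first | omega | simp
  · refine Finset.sum_eq_zero fun p hp => ?_
    rw [Finset.HasAntidiagonal.mem_antidiagonal] at hp
    split_ifs <;> first | omega | simp

lemma twoUpTwoDownSeries_zero_mul_olivier_zero :
    twoUpTwoDownSeries 0 * olivier 0 - twoUpTwoDownSeries 3 * olivier 1 = 1 := by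
  ext n
  rw [map_sub, PowerSeries.coeff_mul, PowerSeries.coeff_mul, ← Finset.sum_sub_distrib]
  simp only [twoUpTwoDownSeries, olivier, PowerSeries.coeff_mk, PowerSeries.coeff_one]
  rcases eq_or_ne n 0 with rfl | hpos
  · simp [← numTailIncreasing_eq_numTwoUpTwoDown 0 0 (by omega), numTailIncreasing_zero_right]
  rw [if_neg hpos]
  by_cases hn : n % 4 = 0
  · refine Eq.trans ?_ (sum_antidiagonal_sign n (.inl hn) hpos)
    refine Finset.sum_congr rfl fun p hp => ?_
    rw [Finset.HasAntidiagonal.mem_antidiagonal] at hp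
    rw [twoUpTwoDownSign]
    split_ifs <;> first | omega | simp
  · refine Finset.sum_eq_zero fun p hp => ?_
    rw [Finset.HasAntidiagonal.mem_antidiagonal] at hp
    split_ifs <;> first | omega | simp

/-- `(Σ_{n≥0} A(4n+3) x^{4n+3}/(4n+3)!) · (φ₀² − φ₁φ₃) = φ₃`. -/
theorem genfun_2up2down_length_4n3 :
    (PowerSeries.mk fun n =>
        if n % 4 = 3 then (numTwoUpTwoDown n : ℝ) / n.factorial else 0) *
      (olivier 0 ^ 2 - olivier 1 * olivier 3) =
    olivier 3 := by
  change twoUpTwoDownSeries 3 * (olivier 0 ^ 2 - olivier 1 * olivier 3) = olivier 3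
  linear_combination (-olivier 0) * twoUpTwoDownSeries_zero_mul_olivier_three +
    olivier 3 * twoUpTwoDownSeries_zero_mul_olivier_zero
end
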